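/- Under the stated hypotheses, the Orbit 5 (L,K,K) three-term relation holds: A(1−a, e−a, f−a, g−a)·A(1+a−f, 1+b−f, 1+c−f, 1+d−f)·B_4(e−a, e−b, e−c, e−d, 1+e−f, e, 1+e−g)·K(a;b,c,d;e,f,g) − A(g−a, g−b, g−c, g−d)·A(a, 1+a−e, 1+a−f, 1+a−g)·B_4(a,b,c,d,g,f,e)·K(e−a; e−b, e−c, e−d; e, 1+e−f, 1+e−g) − A(a,b,c,d)·A(e−a, e−b, e−c, e−d)·B_2(a,b,c,d,e,f,g)·L(1−a, 1−b, 1−c, 1−d; 2−g; 2−f, 2−e) = 0. Here B_4(e−a,e−b,e−c,e−d,1+e−f,e,1+e−g) and B_4(a,b,c,d,g,f,e) denote the function B_4 evaluated at the indicated 7-tuples of arguments. -/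

import Mathlib

noncomputable section

open Complex

/-- `Sn x = sin (π x)`. -/
def Sn (x : ℂ) : ℂ := Complex.sin ((Real.pi : ℂ) * x)

/-- The renormalized Saalschützian series
`F*(a,b,c,d;e,f,g) = ∑ₖ Γ(k+a)Γ(k+b)Γ(k+c)Γ(k+d)/(k!·Γ(k+e)Γ(k+f)Γ(k+g))`. -/
def Fstar (a b c d e f g : ℂ) : ℂ :=
  ∑' k : ℕ, (Complex.Gamma (k + a) * Complex.Gamma (k + b) *
      Complex.Gamma (k + c) * Complex.Gamma (k + d)) /
    ((k.factorial : ℂ) * Complex.Gamma (k + e) * Complex.Gamma (k + f) *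
      Complex.Gamma (k + g))

/-- The function `K(a;b,c,d;e,f,g)`. -/
def Kf (a b c d e f g : ℂ) : ℂ :=
  (Fstar a b c d e f g +
      Fstar a (1 + a - e) (1 + a - f) (1 + a - g) (1 + a - b) (1 + a - c) (1 + a - d)) /
    (Sn a * Complex.Gamma a ^ 2 * Complex.Gamma b * Complex.Gamma c * Complex.Gamma d *
      Complex.Gamma (1 + a - e) * Complex.Gamma (1 + a - f) * Complex.Gamma (1 + a - g))

/-- The function `L(a,b,c,d;e;f,g)`. -/
def Lf (a b c d e f g : ℂ) : ℂ :=
  (Fstar a b c d e f g -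
      Fstar (1 + a - e) (1 + b - e) (1 + c - e) (1 + d - e) (2 - e) (1 + f - e) (1 + g - e)) /
    (Sn e * Complex.Gamma a * Complex.Gamma b * Complex.Gamma c * Complex.Gamma d *
      Complex.Gamma (1 + a - e) * Complex.Gamma (1 + b - e) * Complex.Gamma (1 + c - e) *
      Complex.Gamma (1 + d - e))

/-- `A(x,y,z,t) = 1/(Γ(x)Γ(y)Γ(z)Γ(t))`. -/
def Af (x y z t : ℂ) : ℂ :=
  1 / (Complex.Gamma x * Complex.Gamma y * Complex.Gamma z * Complex.Gamma t)

def B1 (a b c d e f g : ℂ) : ℂ :=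
  Sn b * Sn c * (Sn (b - a) * Sn (c - a) * Sn d + Sn (e - a) * Sn (f - a) * Sn (g - a)) /
    (Real.pi : ℂ) ^ 4

def B2 (a b c d e f g : ℂ) : ℂ :=
  Sn (f - a) * Sn (g - a) *
    (Sn (b - a) * Sn (c - a) * Sn (d - a) + Sn (e - 2 * a) * Sn (f - a) * Sn (g - a)) /
    (Real.pi : ℂ) ^ 4

def B3 (a b c d e f g : ℂ) : ℂ :=
  (Sn f * Sn (f - e) * Sn (g - a) * Sn (g - b) * Sn (g - c) * Sn (g - d) -
      Sn g * Sn (g - e) * Sn (f - a) * Sn (f - b) * Sn (f - c) * Sn (f - d)) /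
    ((Real.pi : ℂ) ^ 4 * Sn (f - g))

def B4 (a b c d e f g : ℂ) : ℂ :=
  Sn (f - a) * Sn (g - a) * (Sn b * Sn c * Sn d + Sn (e - a) * Sn f * Sn g) /
    (Real.pi : ℂ) ^ 4

def B5 (a b c d e f g : ℂ) : ℂ :=
  Sn b * Sn (e - b) *
    (Sn (b - a) * Sn (c - a) * Sn (d - a) + Sn (e - 2 * a) * Sn (f - a) * Sn (g - a)) /
    (Real.pi : ℂ) ^ 4

def Cf (a b c d e f g : ℂ) : ℂ :=
  Sn (e - a) * (Sn b * Sn c * Sn d * B2 a b c d e f g +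
      Sn e * Sn (f - a) * Sn (g - a) * B4 a b c d e f g) / (Real.pi : ℂ) ^ 4

section

open Filter Topology Asymptotics

theorem tendsto_Gamma_add_one_div (z : ℂ) :
    Tendsto (fun n : ℕ => Complex.Gamma (n + 1 + z) / (n.factorial * (n : ℂ) ^ z)) atTop (𝓝 1) := by
  have step : ∀ w : ℂ,
      Tendsto (fun n : ℕ => Complex.Gamma (n + 1 + (w + 1)) / (n.factorial * (n : ℂ) ^ (w + 1)))
        atTop (𝓝 1) →
      Tendsto (fun n : ℕ => Complex.Gamma (n + 1 + w) / (n.factorial * (n : ℂ) ^ w))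
        atTop (𝓝 1) := by
    intro w hw
    have h1 : Tendsto (fun n : ℕ => (n : ℂ) / (n + (1 + w))) atTop (𝓝 1) :=
      tendsto_natCast_div_add_atTop (1 + w)
    have h2 := hw.mul h1
    rw [mul_one] at h2
    refine h2.congr' ?_
    obtain ⟨N, hN⟩ := exists_nat_gt ‖1 + w‖
    filter_upwards [eventually_ge_atTop (N + 1)] with n hn
    have hn0 : (n : ℂ) ≠ 0 := by
      have : n ≠ 0 := by omega
      exact_mod_cast this
    have hne : (n : ℂ) + 1 + w ≠ 0 := by
      intro h
      have : (1 + w) = -(n : ℂ) := by linear_combination h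
      rw [this, norm_neg, Complex.norm_natCast] at hN
      have : n < N := by exact_mod_cast hN
      omega
    have hne' : (n : ℂ) + (1 + w) ≠ 0 := by rwa [← add_assoc]
    rw [show (n : ℂ) + 1 + (w + 1) = n + 1 + w + 1 by ring, Complex.Gamma_add_one _ hne,
      Complex.cpow_add _ _ hn0, Complex.cpow_one]
    have hc : (n : ℂ) ^ w ≠ 0 := by
      rw [Ne, Complex.cpow_eq_zero_iff]; tauto
    have hf : (n.factorial : ℂ) ≠ 0 := by exact_mod_cast n.factorial_ne_zero
    field_simp
    ring
  have pos : ∀ w : ℂ, 0 < w.re →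
      Tendsto (fun n : ℕ => Complex.Gamma (n + 1 + w) / (n.factorial * (n : ℂ) ^ w))
        atTop (𝓝 1) := by
    intro w hw
    have hG : Complex.Gamma w ≠ 0 := Complex.Gamma_ne_zero_of_re_pos hw
    have h1 := (Complex.GammaSeq_tendsto_Gamma w).inv₀ hG
    have h2 := h1.const_mul (Complex.Gamma w)
    rw [mul_inv_cancel₀ hG] at h2
    refine h2.congr' ?_
    filter_upwards with n
    have key : ∀ m : ℕ, Complex.Gamma (m + w) = Complex.Gamma w * ∏ j ∈ Finset.range m, (w + j) := by
      intro m
      induction m with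
      | zero => simp
      | succ m ih =>
        rw [Finset.prod_range_succ, ← mul_assoc, ← ih]
        push_cast
        rw [show (m : ℂ) + 1 + w = (m + w) + 1 by ring, Complex.Gamma_add_one]
        · ring
        · intro h
          have := congrArg Complex.re h
          simp at this
          have : (0 : ℝ) ≤ m := Nat.cast_nonneg m
          linarith
    have := key (n + 1)
    push_cast at this
    rw [this, Complex.GammaSeq, inv_div, mul_div_assoc]
    congr 2
    ring
  have main : ∀ m : ℕ, ∀ w : ℂ, 0 < (w + m).re →
      Tendsto (fun n : ℕ => Complex.Gamma (n + 1 + w) / (n.factorial * (n : ℂ) ^ w))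
        atTop (𝓝 1) := by
    intro m
    induction m with
    | zero => intro w hw; exact pos w (by simpa using hw)
    | succ m ih =>
      intro w hw
      apply step
      apply ih
      push_cast at hw
      rwa [show w + 1 + (m : ℂ) = w + (m + 1) by ring]
  obtain ⟨m, hm⟩ := exists_nat_gt (-z.re)
  exact main m z (by simp; linarith)

/-- `|Γ(n + z)| ~ n! (n + 1)^(Re z - 1)`. -/
theorem tendsto_norm_Gamma_nat_add_div (z : ℂ) :
    Tendsto (fun n : ℕ => ‖Complex.Gamma (n + z)‖ / (n.factorial * ((n : ℝ) + 1) ^ (z.re - 1)))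
      atTop (𝓝 1) := by
  have h1 := (tendsto_Gamma_add_one_div (z - 1)).norm
  have h2 : Tendsto (fun n : ℕ => ((n : ℝ) / (n + 1)) ^ (z.re - 1)) atTop (𝓝 1) := by
    have := (tendsto_natCast_div_add_atTop (1 : ℝ)).rpow_const (p := z.re - 1) (Or.inl one_ne_zero)
    simpa using this
  have h3 := h1.mul h2
  simp only [norm_one, mul_one] at h3
  refine h3.congr' ?_
  filter_upwards [eventually_ge_atTop 1] with n hn
  have hn0 : (0 : ℝ) < n := by exact_mod_cast hn
  rw [show (n : ℂ) + 1 + (z - 1) = n + z by ring, norm_div, norm_mul,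
    Complex.norm_natCast_cpow_of_pos (by omega), Complex.norm_natCast, Complex.sub_re,
    Complex.one_re, Real.div_rpow hn0.le (by positivity)]
  have := (Real.rpow_pos_of_pos hn0 (z.re - 1)).ne'
  field_simp

theorem exists_norm_Gamma_nat_add_le (z : ℂ) :
    ∃ C : ℝ, 0 < C ∧ ∀ n : ℕ,
      ‖Complex.Gamma (n + z)‖ ≤ C * (n.factorial * ((n : ℝ) + 1) ^ (z.re - 1)) := by
  obtain ⟨C, hC⟩ := (tendsto_norm_Gamma_nat_add_div z).bddAbove_range
  refine ⟨max C 1, by positivity, fun n => ?_⟩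
  rw [← div_le_iff₀ (by positivity)]
  exact (hC ⟨n, rfl⟩).trans (le_max_left _ _)

theorem exists_norm_Gamma_nat_add_inv_le (z : ℂ) :
    ∃ C : ℝ, 0 < C ∧ ∀ n : ℕ,
      ‖(Complex.Gamma (n + z))⁻¹‖ ≤ C * ((n.factorial : ℝ)⁻¹ * ((n : ℝ) + 1) ^ (1 - z.re)) := by
  obtain ⟨C, hC⟩ := ((tendsto_norm_Gamma_nat_add_div z).inv₀ one_ne_zero).bddAbove_range
  refine ⟨max C 1, by positivity, fun n => ?_⟩
  have h := (hC ⟨n, rfl⟩).trans (le_max_left C 1)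
  simp only [inv_div] at h
  have hf : (0 : ℝ) < n.factorial := by positivity
  have hp : (0 : ℝ) < ((n : ℝ) + 1) ^ (z.re - 1) := by positivity
  rw [show 1 - z.re = -(z.re - 1) by ring, Real.rpow_neg (by positivity), ← mul_inv,
    ← div_eq_mul_inv, le_div_iff₀ (by positivity), norm_inv, mul_comm, ← div_eq_mul_inv]
  exact h

theorem summable_rpow_nat_add_one {p : ℝ} (hp : p < -1) :
    Summable (fun n : ℕ => ((n : ℝ) + 1) ^ p) := by
  have := (summable_nat_add_iff 1).mpr (Real.summable_nat_rpow.mpr hp)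
  simpa using this

theorem exists_norm_gauss_term_le (x y z : ℂ) :
    ∃ C : ℝ, 0 < C ∧ ∀ n : ℕ,
      ‖Complex.Gamma (n + x) * Complex.Gamma (n + y) / (n.factorial * Complex.Gamma (n + z))‖
        ≤ C * ((n : ℝ) + 1) ^ ((x + y - z).re - 1) := by
  obtain ⟨A, hA, hA'⟩ := exists_norm_Gamma_nat_add_le x
  obtain ⟨B, hB, hB'⟩ := exists_norm_Gamma_nat_add_le y
  obtain ⟨D, hD, hD'⟩ := exists_norm_Gamma_nat_add_inv_le z
  refine ⟨A * B * D, by positivity, fun n => ?_⟩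
  have hn : (0 : ℝ) < (n : ℝ) + 1 := by positivity
  have hf : (0 : ℝ) < n.factorial := by positivity
  calc _ = ‖Complex.Gamma (n + x)‖ * ‖Complex.Gamma (n + y)‖ * ‖(Complex.Gamma (n + z))⁻¹‖ /
        n.factorial := by
        rw [norm_div, norm_mul, norm_mul, Complex.norm_natCast, norm_inv]; field_simp
    _ ≤ (A * (n.factorial * ((n : ℝ) + 1) ^ (x.re - 1))) *
        (B * (n.factorial * ((n : ℝ) + 1) ^ (y.re - 1))) *
        (D * ((n.factorial : ℝ)⁻¹ * ((n : ℝ) + 1) ^ (1 - z.re))) / n.factorial := by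
        gcongr
        · exact hA' n
        · exact hB' n
        · exact hD' n
    _ = _ := by
        have : (x + y - z).re - 1 = (x.re - 1) + (y.re - 1) + (1 - z.re) := by
          simp; ring
        rw [this, Real.rpow_add hn, Real.rpow_add hn]
        field_simp

theorem summable_gauss {x y z : ℂ} (h : 0 < (z - x - y).re) :
    Summable (fun n : ℕ => Complex.Gamma (n + x) * Complex.Gamma (n + y) /
      (n.factorial * Complex.Gamma (n + z))) := by
  obtain ⟨C, hC, hC'⟩ := exists_norm_gauss_term_le x y z
  refine Summable.of_norm_bounded ((summable_rpow_nat_add_one ?_).mul_left C) hC'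
  simp at h ⊢; linarith

theorem Gamma_inv_eq_mul (z : ℂ) : (Complex.Gamma z)⁻¹ = z * (Complex.Gamma (z + 1))⁻¹ := by
  by_cases hz : z = 0
  · simp [hz]
  · rw [Complex.Gamma_add_one z hz]
    field_simp

theorem gauss_tsum_step {x y z : ℂ} (hx : ∀ m : ℕ, x ≠ -m) (hy : ∀ m : ℕ, y ≠ -m)
    (h : 0 < (z - x - y).re) :
    (z - x) * (z - y) * ∑' n : ℕ, Complex.Gamma (n + x) * Complex.Gamma (n + y) /
      (n.factorial * Complex.Gamma (n + (z + 1))) =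
    (z - x - y) * ∑' n : ℕ, Complex.Gamma (n + x) * Complex.Gamma (n + y) /
      (n.factorial * Complex.Gamma (n + z)) := by
  have h' : 0 < (z + 1 - x - y).re := by simp at h ⊢; linarith
  have s0 := (summable_gauss h).mul_left (z - x - y)
  have s1 := (summable_gauss h').mul_left ((z - x) * (z - y))
  rw [← tsum_mul_left, ← tsum_mul_left, ← sub_eq_zero, ← s1.tsum_sub s0]
  set u : ℕ → ℂ := fun n => n * (Complex.Gamma (n + x) * Complex.Gamma (n + y) /
      (n.factorial * Complex.Gamma (n + z))) with hu
  have hlim : Tendsto u atTop (𝓝 0) := by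
    obtain ⟨C, hC, hC'⟩ := exists_norm_gauss_term_le x y z
    have hb : Tendsto (fun n : ℕ => C * ((n : ℝ) + 1) ^ (-((z - x - y).re))) atTop (𝓝 (C * 0)) := by
      refine Tendsto.const_mul _ ?_
      exact (tendsto_rpow_neg_atTop h).comp
        (tendsto_atTop_add_const_right _ 1 tendsto_natCast_atTop_atTop)
    rw [mul_zero] at hb
    refine squeeze_zero_norm (fun n => ?_) hb
    rw [hu, norm_mul, Complex.norm_natCast]
    have hn : (0 : ℝ) < (n : ℝ) + 1 := by positivity
    calc _ ≤ ((n : ℝ) + 1) * (C * ((n : ℝ) + 1) ^ ((x + y - z).re - 1)) := by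
          gcongr
          · linarith
          · exact hC' n
      _ = _ := by
          rw [show -((z - x - y).re) = 1 + ((x + y - z).re - 1) by simp; ring, Real.rpow_add hn,
            Real.rpow_one]
          ring
  have key : ∀ n : ℕ, (z - x) * (z - y) * (Complex.Gamma (n + x) * Complex.Gamma (n + y) /
      (n.factorial * Complex.Gamma (n + (z + 1)))) -
      (z - x - y) * (Complex.Gamma (n + x) * Complex.Gamma (n + y) /
      (n.factorial * Complex.Gamma (n + z))) = u (n + 1) - u n := by
    intro n
    have hnx : (n : ℂ) + x ≠ 0 := fun hh => hx n (by linear_combination hh)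
    have hny : (n : ℂ) + y ≠ 0 := fun hh => hy n (by linear_combination hh)
    have e1 : Complex.Gamma ((n + 1 : ℕ) + x) = (n + x) * Complex.Gamma (n + x) := by
      rw [← Complex.Gamma_add_one _ hnx]; push_cast; ring_nf
    have e2 : Complex.Gamma ((n + 1 : ℕ) + y) = (n + y) * Complex.Gamma (n + y) := by
      rw [← Complex.Gamma_add_one _ hny]; push_cast; ring_nf
    have e3 : Complex.Gamma ((n + 1 : ℕ) + z) = Complex.Gamma (n + (z + 1)) := by
      push_cast; ring_nf
    have e4 := Gamma_inv_eq_mul (n + z)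
    rw [add_assoc] at e4
    have hf : (n.factorial : ℂ) ≠ 0 := by exact_mod_cast n.factorial_ne_zero
    have hn1 : (n : ℂ) + 1 ≠ 0 := by exact_mod_cast n.succ_ne_zero
    simp only [hu]
    rw [e1, e2, e3, Nat.factorial_succ]
    simp only [div_eq_mul_inv, mul_inv, e4]
    push_cast
    field_simp
    ring
  have hsum : HasSum (fun n => u (n + 1) - u n) (0 - u 0) := by
    rw [((s1.sub s0).congr (fun n => (key n))).hasSum_iff_tendsto_nat]
    simp_rw [Finset.sum_range_sub]
    exact hlim.sub_const _
  have hu0 : u 0 = 0 := by simp [hu]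
  rw [hu0, sub_zero] at hsum
  rw [← hsum.tsum_eq]
  exact tsum_congr key

theorem tendsto_Gamma_ratio (u v w : ℂ) :
    Tendsto (fun N : ℕ => Complex.Gamma (N + u) * Complex.Gamma (N + (v + w - u)) /
      (Complex.Gamma (N + v) * Complex.Gamma (N + w))) atTop (𝓝 1) := by
  have h := fun z : ℂ => tendsto_Gamma_add_one_div (z - 1)
  have h1 := ((h u).mul (h (v + w - u))).div ((h v).mul (h w)) (by simp)
  simp only [mul_one, div_one] at h1
  refine h1.congr' ?_
  filter_upwards [eventually_ge_atTop 1] with n hn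
  have hn0 : (n : ℂ) ≠ 0 := by
    have : n ≠ 0 := by omega
    exact_mod_cast this
  have hc : ∀ z : ℂ, (n : ℂ) ^ z ≠ 0 := fun z => by rw [Ne, Complex.cpow_eq_zero_iff]; tauto
  have hf : (n.factorial : ℂ) ≠ 0 := by exact_mod_cast n.factorial_ne_zero
  have e : (n : ℂ) ^ (u - 1) * (n : ℂ) ^ (v + w - u - 1) = (n : ℂ) ^ (v - 1) * (n : ℂ) ^ (w - 1) := by
    rw [← Complex.cpow_add _ _ hn0, ← Complex.cpow_add _ _ hn0]; ring_nf
  have r : ∀ z : ℂ, (n : ℂ) + 1 + (z - 1) = n + z := fun z => by ring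
  simp only [Pi.div_apply, r]
  rw [div_mul_div_comm, div_mul_div_comm]
  rw [show (n.factorial : ℂ) * (n : ℂ) ^ (u - 1) * (n.factorial * (n : ℂ) ^ (v + w - u - 1)) =
    n.factorial * (n : ℂ) ^ (v - 1) * (n.factorial * (n : ℂ) ^ (w - 1)) by
      linear_combination (n.factorial : ℂ) ^ 2 * e]
  rw [div_div_div_cancel_right₀]
  exact mul_ne_zero (mul_ne_zero hf (hc _)) (mul_ne_zero hf (hc _))

theorem norm_Gamma_ratio_le {z : ℂ} (hz : 0 < z.re) (n N : ℕ) :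
    ‖Complex.Gamma (N + z) / Complex.Gamma (n + (N + z))‖ ≤
      ‖Complex.Gamma z / Complex.Gamma (n + z)‖ := by
  induction N with
  | zero => simp
  | succ N ih =>
    refine le_trans ?_ ih
    have h1 : (N : ℂ) + z ≠ 0 := fun h => by
      have := congrArg Complex.re h
      simp at this
      have : (0 : ℝ) ≤ N := N.cast_nonneg
      linarith
    have h2 : (n : ℂ) + (N + z) ≠ 0 := fun h => by
      have := congrArg Complex.re h
      simp at this
      have : (0 : ℝ) ≤ N := N.cast_nonneg
      have : (0 : ℝ) ≤ n := n.cast_nonneg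
      linarith
    have e1 : ((N + 1 : ℕ) : ℂ) + z = (N + z) + 1 := by push_cast; ring
    have e2 : (n : ℂ) + (N + z + 1) = (n + (N + z)) + 1 := by ring
    rw [e1, e2, Complex.Gamma_add_one _ h1, Complex.Gamma_add_one _ h2, mul_div_mul_comm, norm_mul]
    refine mul_le_of_le_one_left (norm_nonneg _) ?_
    rw [norm_div, div_le_one (by positivity), ← sq_le_sq₀ (norm_nonneg _) (norm_nonneg _),
      Complex.sq_norm, Complex.sq_norm, Complex.normSq_apply, Complex.normSq_apply]
    have h3 : (0 : ℝ) ≤ N := N.cast_nonneg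
    have h4 : (0 : ℝ) ≤ n := n.cast_nonneg
    simp
    nlinarith [mul_nonneg h3 h4, mul_nonneg h4 hz.le]

theorem tendsto_Gamma_ratio_zero {z : ℂ} (hz : 0 < z.re) {n : ℕ} (hn : n ≠ 0) :
    Tendsto (fun N : ℕ => Complex.Gamma (N + z) / Complex.Gamma (n + (N + z))) atTop (𝓝 0) := by
  obtain ⟨m, rfl⟩ := Nat.exists_eq_succ_of_ne_zero hn
  have hb : Tendsto (fun N : ℕ => ‖Complex.Gamma z / Complex.Gamma (m + z)‖ * (N : ℝ)⁻¹) atTop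
      (𝓝 (‖Complex.Gamma z / Complex.Gamma (m + z)‖ * 0)) :=
    tendsto_inv_atTop_nhds_zero_nat.const_mul _
  rw [mul_zero] at hb
  refine squeeze_zero_norm' ?_ hb
  filter_upwards [eventually_ge_atTop 1] with N hN
  have hN0 : (0 : ℝ) < N := by exact_mod_cast hN
  have hm0 : (0 : ℝ) ≤ m := m.cast_nonneg
  have hre : (N : ℝ) ≤ ‖(m : ℂ) + (N + z)‖ := by
    refine le_trans ?_ (Complex.re_le_norm _)
    simp; linarith
  have h2 : (m : ℂ) + (N + z) ≠ 0 := by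
    rw [← norm_pos_iff]; linarith
  have e2 : ((m + 1 : ℕ) : ℂ) + (N + z) = (m + (N + z)) + 1 := by push_cast; ring
  rw [Nat.succ_eq_add_one, e2, Complex.Gamma_add_one _ h2, mul_comm (_ + _), ← div_div, norm_div,
    div_eq_mul_inv]
  gcongr
  exact norm_Gamma_ratio_le hz m N

theorem tendsto_gauss_tsum {x y z : ℂ} (hz : 0 < z.re) (h : 0 < (z - x - y).re) :
    Tendsto (fun N : ℕ => Complex.Gamma (N + z) *
      ∑' n : ℕ, Complex.Gamma (n + x) * Complex.Gamma (n + y) /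
      (n.factorial * Complex.Gamma (n + (N + z)))) atTop
      (𝓝 (Complex.Gamma x * Complex.Gamma y)) := by
  have hval : Complex.Gamma x * Complex.Gamma y =
      ∑' n : ℕ, if n = 0 then Complex.Gamma x * Complex.Gamma y else 0 := by simp
  rw [hval]
  simp_rw [← tsum_mul_left]
  have e : ∀ n N : ℕ, Complex.Gamma (N + z) * (Complex.Gamma (n + x) * Complex.Gamma (n + y) /
      (n.factorial * Complex.Gamma (n + (N + z)))) =
      Complex.Gamma (n + x) * Complex.Gamma (n + y) / n.factorial *
      (Complex.Gamma (N + z) / Complex.Gamma (n + (N + z))) := by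
    intro n N
    rw [← mul_div_assoc, mul_comm, mul_div_mul_comm]
  refine tendsto_tsum_of_dominated_convergence
    (((summable_gauss h).norm).mul_left ‖Complex.Gamma z‖) (fun n => ?_) ?_
  · simp_rw [e]
    by_cases hn : n = 0
    · subst hn
      simp only [Nat.cast_zero, zero_add, Nat.factorial_zero, Nat.cast_one, div_one, if_true]
      have : ∀ N : ℕ, Complex.Gamma (N + z) ≠ 0 := fun N =>
        Complex.Gamma_ne_zero_of_re_pos (by simp; positivity)
      simp [this]
    · rw [if_neg hn]
      have := (tendsto_Gamma_ratio_zero hz hn).const_mul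
        (Complex.Gamma (n + x) * Complex.Gamma (n + y) / n.factorial)
      rwa [mul_zero] at this
  · filter_upwards with N n
    rw [e, norm_mul]
    calc _ ≤ _ := mul_le_mul_of_nonneg_left (norm_Gamma_ratio_le hz n N) (norm_nonneg _)
      _ = _ := by simp only [norm_div, norm_mul]; field_simp

theorem gauss_tsum_of_re_pos {x y z : ℂ} (hx : ∀ m : ℕ, x ≠ -m) (hy : ∀ m : ℕ, y ≠ -m)
    (h : 0 < (z - x - y).re) (hz : 0 < z.re) (hzx : 0 < (z - x).re) (hzy : 0 < (z - y).re) :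
    ∑' n : ℕ, Complex.Gamma (n + x) * Complex.Gamma (n + y) /
      (n.factorial * Complex.Gamma (n + z)) =
    Complex.Gamma x * Complex.Gamma y * Complex.Gamma (z - x - y) /
      (Complex.Gamma (z - x) * Complex.Gamma (z - y)) := by
  set T : ℂ → ℂ := fun z => ∑' n : ℕ, Complex.Gamma (n + x) * Complex.Gamma (n + y) /
      (n.factorial * Complex.Gamma (n + z)) with hT
  set H : ℂ → ℂ := fun z => T z * (Complex.Gamma (z - x) * Complex.Gamma (z - y) /
    Complex.Gamma (z - x - y)) with hH
  have hstep : ∀ w : ℂ, 0 < (w - x - y).re → 0 < (w - x).re → 0 < (w - y).re →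
      H (w + 1) = H w := by
    intro w h1 h2 h3
    have n1 : w - x - y ≠ 0 := fun h => by rw [h] at h1; simp at h1
    have n2 : w - x ≠ 0 := fun h => by rw [h] at h2; simp at h2
    have n3 : w - y ≠ 0 := fun h => by rw [h] at h3; simp at h3
    have g1 := Complex.Gamma_ne_zero_of_re_pos h1
    have st := gauss_tsum_step hx hy h1
    change (w - x) * (w - y) * T (w + 1) = (w - x - y) * T w at st
    simp only [hH]
    rw [show w + 1 - x = (w - x) + 1 by ring, show w + 1 - y = (w - y) + 1 by ring,
      show w - x + 1 - y = (w - x - y) + 1 by ring,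
      Complex.Gamma_add_one _ n1, Complex.Gamma_add_one _ n2, Complex.Gamma_add_one _ n3]
    field_simp
    linear_combination (Complex.Gamma (w - x) * Complex.Gamma (w - y)) * st
  have hN : ∀ N : ℕ, H (N + z) = H z := by
    intro N
    induction N with
    | zero => simp
    | succ N ih =>
      rw [← ih, ← hstep (N + z)]
      · push_cast; ring_nf
      all_goals
        simp only [Complex.add_re, Complex.sub_re, Complex.natCast_re] at *
        have : (0 : ℝ) ≤ N := N.cast_nonneg
        linarith
  have hlim : Tendsto (fun N : ℕ => H (N + z)) atTop (𝓝 (Complex.Gamma x * Complex.Gamma y * 1)) := by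
    refine ((tendsto_gauss_tsum hz h).mul (tendsto_Gamma_ratio (z - x) z (z - x - y))).congr ?_
    intro N
    have : Complex.Gamma (N + z) ≠ 0 :=
      Complex.Gamma_ne_zero_of_re_pos (by simp; positivity)
    simp only [hH, hT]
    rw [show z + (z - x - y) - (z - x) = z - y by ring]
    simp only [← add_sub_assoc]
    field_simp
  have hfin : H z = Complex.Gamma x * Complex.Gamma y := by
    rw [mul_one] at hlim
    simp_rw [hN] at hlim
    exact tendsto_nhds_unique tendsto_const_nhds hlim
  have g1 := Complex.Gamma_ne_zero_of_re_pos h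
  have g2 := Complex.Gamma_ne_zero_of_re_pos hzx
  have g3 := Complex.Gamma_ne_zero_of_re_pos hzy
  rw [← hfin]
  simp only [hH]
  change T z = _
  field_simp

/-- Gauss's summation of `₂F₁(x, y; z; 1)`. -/
theorem gauss_tsum {x y z : ℂ} (hx : ∀ m : ℕ, x ≠ -m) (hy : ∀ m : ℕ, y ≠ -m)
    (h : 0 < (z - x - y).re) :
    ∑' n : ℕ, Complex.Gamma (n + x) * Complex.Gamma (n + y) /
      (n.factorial * Complex.Gamma (n + z)) =
    Complex.Gamma x * Complex.Gamma y * Complex.Gamma (z - x - y) /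
      (Complex.Gamma (z - x) * Complex.Gamma (z - y)) := by
  obtain ⟨M, hM⟩ := exists_nat_gt (max (-z.re) (max (-(z - x).re) (-(z - y).re)))
  simp only [max_lt_iff] at hM
  have main : ∀ M : ℕ, ∀ z : ℂ, 0 < (z - x - y).re → 0 < (M + z).re → 0 < (M + z - x).re →
      0 < (M + z - y).re →
      ∑' n : ℕ, Complex.Gamma (n + x) * Complex.Gamma (n + y) /
      (n.factorial * Complex.Gamma (n + z)) =
    Complex.Gamma x * Complex.Gamma y * Complex.Gamma (z - x - y) /
      (Complex.Gamma (z - x) * Complex.Gamma (z - y)) := by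
    intro M
    induction M with
    | zero => intro z h1 h2 h3 h4; exact gauss_tsum_of_re_pos hx hy h1 (by simpa using h2)
                (by simpa using h3) (by simpa using h4)
    | succ M ih =>
      intro z h1 h2 h3 h4
      have st := gauss_tsum_step hx hy h1
      have n1 : z - x - y ≠ 0 := fun h => by rw [h] at h1; simp at h1
      rw [ih (z + 1)] at st
      · apply mul_left_cancel₀ n1
        rw [← st, div_eq_mul_inv, div_eq_mul_inv, mul_inv, mul_inv, Gamma_inv_eq_mul (z - x),
          Gamma_inv_eq_mul (z - y), show z + 1 - x = (z - x) + 1 by ring,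
          show z + 1 - y = (z - y) + 1 by ring,
          show z - x + 1 - y = (z - x - y) + 1 by ring, Complex.Gamma_add_one _ n1]
        ring
      all_goals
        simp at *
        linarith
  refine main M z h ?_ ?_ ?_ <;> simp at * <;> linarith

theorem exists_norm_Gamma_div_Gamma_le (x y : ℂ) :
    ∃ C : ℝ, 0 < C ∧ ∀ n : ℕ,
      ‖Complex.Gamma (n + x) / Complex.Gamma (n + y)‖ ≤ C * ((n : ℝ) + 1) ^ (x - y).re := by
  obtain ⟨A, hA, hA'⟩ := exists_norm_Gamma_nat_add_le x
  obtain ⟨D, hD, hD'⟩ := exists_norm_Gamma_nat_add_inv_le y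
  refine ⟨A * D, by positivity, fun n => ?_⟩
  have hn : (0 : ℝ) < (n : ℝ) + 1 := by positivity
  have hf : (0 : ℝ) < n.factorial := by positivity
  calc _ = ‖Complex.Gamma (n + x)‖ * ‖(Complex.Gamma (n + y))⁻¹‖ := by
        rw [norm_div, norm_inv]; field_simp
    _ ≤ (A * (n.factorial * ((n : ℝ) + 1) ^ (x.re - 1))) *
        (D * ((n.factorial : ℝ)⁻¹ * ((n : ℝ) + 1) ^ (1 - y.re))) := by
        gcongr
        · exact hA' n
        · exact hD' n
    _ = _ := by
        have : (x - y).re = (x.re - 1) + (1 - y.re) := by simp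
        rw [this, Real.rpow_add hn]
        field_simp

theorem tendsto_Gamma_ratio_three {a b c x y z : ℂ} (h : a + b + c = x + y + z) :
    Tendsto (fun N : ℕ => Complex.Gamma (N + a) * Complex.Gamma (N + b) * Complex.Gamma (N + c) /
      (Complex.Gamma (N + x) * Complex.Gamma (N + y) * Complex.Gamma (N + z))) atTop (𝓝 1) := by
  have g := fun z : ℂ => tendsto_Gamma_add_one_div (z - 1)
  have h1 := (((g a).mul (g b)).mul (g c)).div (((g x).mul (g y)).mul (g z)) (by simp)
  simp only [mul_one, div_one] at h1
  refine h1.congr' ?_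
  filter_upwards [eventually_ge_atTop 1] with n hn
  have hn0 : (n : ℂ) ≠ 0 := by
    have : n ≠ 0 := by omega
    exact_mod_cast this
  have hc : ∀ z : ℂ, (n : ℂ) ^ z ≠ 0 := fun z => by rw [Ne, Complex.cpow_eq_zero_iff]; tauto
  have hf : (n.factorial : ℂ) ≠ 0 := by exact_mod_cast n.factorial_ne_zero
  have e : (n : ℂ) ^ (a - 1) * (n : ℂ) ^ (b - 1) * (n : ℂ) ^ (c - 1) =
      (n : ℂ) ^ (x - 1) * (n : ℂ) ^ (y - 1) * (n : ℂ) ^ (z - 1) := by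
    simp only [← Complex.cpow_add _ _ hn0]
    congr 1
    linear_combination h
  have r : ∀ z : ℂ, (n : ℂ) + 1 + (z - 1) = n + z := fun z => by ring
  simp only [Pi.div_apply, r]
  rw [div_mul_div_comm, div_mul_div_comm, div_mul_div_comm, div_mul_div_comm]
  rw [show (n.factorial : ℂ) * (n : ℂ) ^ (a - 1) * (n.factorial * (n : ℂ) ^ (b - 1)) *
      (n.factorial * (n : ℂ) ^ (c - 1)) = n.factorial * (n : ℂ) ^ (x - 1) *
      (n.factorial * (n : ℂ) ^ (y - 1)) * (n.factorial * (n : ℂ) ^ (z - 1)) by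
      linear_combination (n.factorial : ℂ) ^ 3 * e]
  rw [div_div_div_cancel_right₀]
  simp only [ne_eq, mul_eq_zero, hc, hf, or_self, not_false_eq_true]

/-- The `k`-th term of the `₃F₂(1)` series with Gamma-function normalization. -/
def threeTerm (a b c f H : ℂ) (k : ℕ) : ℂ :=
  Complex.Gamma (k + a) * Complex.Gamma (k + b) * Complex.Gamma (k + c) /
    (k.factorial * Complex.Gamma (k + f) * Complex.Gamma (k + H))

theorem exists_norm_threeTerm_le (a b c f H : ℂ) :
    ∃ C : ℝ, 0 < C ∧ ∀ n : ℕ,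
      ‖threeTerm a b c f H n‖ ≤ C * ((n : ℝ) + 1) ^ ((a + b + c - f - H).re - 1) := by
  obtain ⟨A, hA, hA'⟩ := exists_norm_gauss_term_le a b f
  obtain ⟨D, hD, hD'⟩ := exists_norm_Gamma_div_Gamma_le c H
  refine ⟨A * D, by positivity, fun n => ?_⟩
  have hn : (0 : ℝ) < (n : ℝ) + 1 := by positivity
  have e : threeTerm a b c f H n = Complex.Gamma (n + a) * Complex.Gamma (n + b) /
      (n.factorial * Complex.Gamma (n + f)) * (Complex.Gamma (n + c) / Complex.Gamma (n + H)) := by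
    rw [threeTerm, div_mul_div_comm]
  rw [e, norm_mul]
  calc _ ≤ (A * ((n : ℝ) + 1) ^ ((a + b - f).re - 1)) * (D * ((n : ℝ) + 1) ^ (c - H).re) := by
        gcongr
        · exact hA' n
        · exact hD' n
    _ = _ := by
        have : (a + b + c - f - H).re - 1 = ((a + b - f).re - 1) + (c - H).re := by simp; ring
        rw [this, Real.rpow_add hn]
        ring

theorem summable_threeTerm {a b c f H : ℂ} (h : 0 < (f + H - a - b - c).re) :
    Summable (threeTerm a b c f H) := by
  obtain ⟨C, hC, hC'⟩ := exists_norm_threeTerm_le a b c f H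
  refine Summable.of_norm_bounded ((summable_rpow_nat_add_one ?_).mul_left C) hC'
  simp at h ⊢; linarith

/-- Gamma recursion in a shape convenient for shifting summation indices. -/
theorem Gamma_natCast_succ_add {x : ℂ} (hx : ∀ m : ℕ, x ≠ -m) (n : ℕ) :
    Complex.Gamma ((n + 1 : ℕ) + x) = (n + x) * Complex.Gamma (n + x) := by
  have hnx : (n : ℂ) + x ≠ 0 := fun hh => hx n (by linear_combination hh)
  rw [← Complex.Gamma_add_one _ hnx]; push_cast; ring_nf

theorem tsum_threeTerm_step {a b c f h : ℂ} (ha : ∀ m : ℕ, a ≠ -m) (hb : ∀ m : ℕ, b ≠ -m)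
    (hc : ∀ m : ℕ, c ≠ -m) (hh : h = 1 + a + b - f) :
    (c + h - a) * (c + h - b) * ∑' k, threeTerm a b (c + 1) f (c + 1 + h) k -
      c * (1 + c - f) * ∑' k, threeTerm a b c f (c + h) k = 1 := by
  have s1 := (summable_threeTerm (a := a) (b := b) (c := c + 1) (f := f) (H := c + 1 + h)
    (by rw [hh]; ring_nf; simp)).mul_left ((c + h - a) * (c + h - b))
  have s0 := (summable_threeTerm (a := a) (b := b) (c := c) (f := f) (H := c + h)
    (by rw [hh]; ring_nf; simp)).mul_left (c * (1 + c - f))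
  rw [← tsum_mul_left, ← tsum_mul_left, ← s1.tsum_sub s0]
  set V : ℕ → ℂ := fun k => Complex.Gamma (k + a) * Complex.Gamma (k + b) * Complex.Gamma (k + c) /
    (Complex.Gamma (k + 0) * Complex.Gamma (k + (f - 1)) * Complex.Gamma (k + (c + h))) with hV
  have hlim : Tendsto V atTop (𝓝 1) := tendsto_Gamma_ratio_three (by rw [hh]; ring)
  have key : ∀ k, (c + h - a) * (c + h - b) * threeTerm a b (c + 1) f (c + 1 + h) k -
      c * (1 + c - f) * threeTerm a b c f (c + h) k = V (k + 1) - V k := by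
    intro k
    simp only [hV, threeTerm, div_eq_mul_inv, mul_inv]
    rw [Gamma_natCast_succ_add ha, Gamma_natCast_succ_add hb, Gamma_natCast_succ_add hc,
      show ((k + 1 : ℕ) : ℂ) + (f - 1) = k + f by push_cast; ring,
      show ((k + 1 : ℕ) : ℂ) + (c + h) = k + (c + h) + 1 by push_cast; ring,
      show ((k + 1 : ℕ) : ℂ) + 0 = k + 1 by push_cast; ring,
      show (k : ℂ) + (c + 1 + h) = k + (c + h) + 1 by ring,
      show (k : ℂ) + (c + 1) = k + c + 1 by ring,
      Gamma_inv_eq_mul (k + (c + h)), Gamma_inv_eq_mul (k + (f - 1)), Gamma_inv_eq_mul (k + 0),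
      Complex.Gamma_add_one (k + c) (fun hh => hc k (by linear_combination hh)),
      show (k : ℂ) + (f - 1) + 1 = k + f by ring, add_zero, Complex.Gamma_nat_eq_factorial, hh]
    ring
  have hsum : HasSum (fun n => V (n + 1) - V n) (1 - V 0) := by
    rw [((s1.sub s0).congr (fun n => (key n))).hasSum_iff_tendsto_nat]
    simp_rw [Finset.sum_range_sub]
    exact hlim.sub_const _
  have hu0 : V 0 = 0 := by simp [hV]
  rw [hu0, sub_zero] at hsum
  exact (tsum_congr key).trans hsum.tsum_eq

/-- The difference of the two `₃F₂(1)` series attached to the exponents `0` and `1 - f`. -/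
def threeDiff (a b c f H : ℂ) : ℂ :=
  ∑' k, threeTerm a b c f H k -
    ∑' k, threeTerm (1 + a - f) (1 + b - f) (1 + c - f) (2 - f) (1 + H - f) k

theorem tendsto_tsum_threeTerm {a b c f h : ℂ} (hh : 0 ≤ h.re) (hf : 0 < (f - a - b).re) :
    Tendsto (fun N : ℕ => Complex.Gamma (N + (c + h)) / Complex.Gamma (N + c) *
      ∑' k, threeTerm a b (N + c) f (N + (c + h)) k) atTop
      (𝓝 (∑' k : ℕ, Complex.Gamma (k + a) * Complex.Gamma (k + b) /
        (k.factorial * Complex.Gamma (k + f)))) := by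
  simp_rw [← tsum_mul_left]
  obtain ⟨A, hA, hA'⟩ := exists_norm_Gamma_div_Gamma_le c (c + h)
  obtain ⟨B, hB, hB'⟩ := exists_norm_Gamma_div_Gamma_le (c + h) c
  have e : ∀ k N : ℕ, Complex.Gamma (N + (c + h)) / Complex.Gamma (N + c) *
      threeTerm a b (N + c) f (N + (c + h)) k =
      Complex.Gamma (k + a) * Complex.Gamma (k + b) / (k.factorial * Complex.Gamma (k + f)) *
      (Complex.Gamma (N + (k + c)) * Complex.Gamma (N + (c + (k + (c + h)) - (k + c))) /
        (Complex.Gamma (N + c) * Complex.Gamma (N + (k + (c + h))))) := by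
    intro k N
    rw [threeTerm, show (k : ℂ) + (N + c) = N + (k + c) by ring,
      show (k : ℂ) + (N + (c + h)) = N + (k + (c + h)) by ring,
      show (c + (k + (c + h)) - (k + c) : ℂ) = c + h by ring]
    simp only [div_eq_mul_inv, mul_inv]
    ring
  simp_rw [e]
  refine tendsto_tsum_of_dominated_convergence
    (((summable_gauss hf).norm).mul_right (A * B)) (fun k => ?_) ?_
  · have := (tendsto_Gamma_ratio (k + c) c (k + (c + h))).const_mul
      (Complex.Gamma (k + a) * Complex.Gamma (k + b) / (k.factorial * Complex.Gamma (k + f)))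
    rwa [mul_one] at this
  · filter_upwards with N k
    rw [norm_mul]
    gcongr
    have h1 := hA' (N + k)
    have h2 := hB' N
    rw [show (c + (k + (c + h)) - (k + c) : ℂ) = c + h by ring,
      show (N : ℂ) + (k + c) = (N + k : ℕ) + c by push_cast; ring,
      show (N : ℂ) + (k + (c + h)) = (N + k : ℕ) + (c + h) by push_cast; ring]
    rw [show ∀ p q r s : ℂ, p * q / (r * s) = (p / s) * (q / r) by
      intro p q r s; rw [mul_comm r s, mul_div_mul_comm], norm_mul]
    have hN : (0 : ℝ) < (N : ℝ) + 1 := by positivity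
    calc _ ≤ (A * (((N + k : ℕ) : ℝ) + 1) ^ (c - (c + h)).re) *
          (B * ((N : ℝ) + 1) ^ (c + h - c).re) := by gcongr
      _ = A * B * ((((N + k : ℕ) : ℝ) + 1) ^ (-h.re) * ((N : ℝ) + 1) ^ h.re) := by
          simp only [Complex.sub_re, Complex.add_re]; ring_nf
      _ ≤ A * B * (((N : ℝ) + 1) ^ (-h.re) * ((N : ℝ) + 1) ^ h.re) := by
          refine mul_le_mul_of_nonneg_left (mul_le_mul_of_nonneg_right ?_ (by positivity))
            (by positivity)
          refine Real.rpow_le_rpow_of_nonpos hN ?_ (by linarith)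
          push_cast
          have : (0 : ℝ) ≤ k := k.cast_nonneg
          linarith
      _ = A * B := by rw [← Real.rpow_add hN]; simp

theorem sin_gauss_identity (a b f : ℂ) :
    Sn (f - a) * Sn (f - b) - Sn a * Sn b = Sn f * Sn (f - a - b) := by
  simp only [Sn, mul_sub, Complex.sin_sub, Complex.cos_sub]
  have h1 := Complex.sin_sq_add_cos_sq (Real.pi * a)
  have h2 := Complex.sin_sq_add_cos_sq (Real.pi * b)
  have h3 := Complex.sin_sq_add_cos_sq (Real.pi * f)
  generalize Complex.sin (Real.pi * a) = sa at *
  generalize Complex.cos (Real.pi * a) = ca at *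
  generalize Complex.sin (Real.pi * b) = sb at *
  generalize Complex.cos (Real.pi * b) = cb at *
  generalize Complex.sin (Real.pi * f) = sf at *
  generalize Complex.cos (Real.pi * f) = cf at *
  linear_combination (sa * sb) * h3

theorem Gamma_mul_Gamma_one_sub' (z : ℂ) :
    (Complex.Gamma z)⁻¹ * (Complex.Gamma (1 - z))⁻¹ = Sn z / Real.pi := by
  rw [← mul_inv, Complex.Gamma_mul_Gamma_one_sub, inv_div, Sn]

theorem threeDiff_step {a b c f h : ℂ} (ha : ∀ m : ℕ, a ≠ -m) (hb : ∀ m : ℕ, b ≠ -m)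
    (hc : ∀ m : ℕ, c ≠ -m) (ha' : ∀ m : ℕ, 1 + a - f ≠ -m) (hb' : ∀ m : ℕ, 1 + b - f ≠ -m)
    (hc' : ∀ m : ℕ, 1 + c - f ≠ -m) (hh : h = 1 + a + b - f) :
    (c + h - a) * (c + h - b) * threeDiff a b (c + 1) f (c + 1 + h) =
      c * (1 + c - f) * threeDiff a b c f (c + h) := by
  have h1 := tsum_threeTerm_step (f := f) (h := h) ha hb hc hh
  have h2 := tsum_threeTerm_step (f := 2 - f) (h := h) ha' hb' hc' (by rw [hh]; ring)
  simp only [threeDiff]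
  rw [show 1 + c - f + 1 = 1 + (c + 1) - f by ring,
    show 1 + (c + 1) - f + h = 1 + (c + 1 + h) - f by ring,
    show 1 + c - f + h = 1 + (c + h) - f by ring] at h2
  linear_combination h1 - h2

theorem gauss_threeDiff {a b f : ℂ} (ha : ∀ m : ℕ, a ≠ -m) (hb : ∀ m : ℕ, b ≠ -m)
    (ha' : ∀ m : ℕ, 1 + a - f ≠ -m) (hb' : ∀ m : ℕ, 1 + b - f ≠ -m)
    (hf : 0 < (f - a - b).re) :
    (∑' k : ℕ, Complex.Gamma (k + a) * Complex.Gamma (k + b) /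
        (k.factorial * Complex.Gamma (k + f))) -
      ∑' k : ℕ, Complex.Gamma (k + (1 + a - f)) * Complex.Gamma (k + (1 + b - f)) /
        (k.factorial * Complex.Gamma (k + (2 - f))) =
    Sn f / Real.pi * Complex.Gamma a * Complex.Gamma b * Complex.Gamma (1 + a - f) *
      Complex.Gamma (1 + b - f) / Complex.Gamma (1 + a + b - f) := by
  rw [gauss_tsum ha hb hf, gauss_tsum ha' hb' (by
    rw [show 2 - f - (1 + a - f) - (1 + b - f) = f - a - b by ring]; exact hf)]
  have hne : ∀ x : ℂ, (∀ m : ℕ, x ≠ -m) → Complex.Gamma x ≠ 0 := fun x hx =>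
    Complex.Gamma_ne_zero hx
  have r1 := Gamma_mul_Gamma_one_sub' (f - a)
  have r2 := Gamma_mul_Gamma_one_sub' (f - b)
  have r3 := Gamma_mul_Gamma_one_sub' a
  have r4 := Gamma_mul_Gamma_one_sub' b
  have r5 := Gamma_mul_Gamma_one_sub' (f - a - b)
  have hs := sin_gauss_identity a b f
  have g1 := hne _ ha
  have g2 := hne _ hb
  have g3 := hne _ ha'
  have g4 := hne _ hb'
  have g5 : Complex.Gamma (f - a - b) ≠ 0 := Complex.Gamma_ne_zero_of_re_pos hf
  rw [show 1 - (f - a) = 1 + a - f by ring] at r1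
  rw [show 1 - (f - b) = 1 + b - f by ring] at r2
  rw [show 1 - (f - a - b) = 1 + a + b - f by ring] at r5
  rw [show 2 - f - (1 + a - f) - (1 + b - f) = f - a - b by ring,
    show 2 - f - (1 + a - f) = 1 - a by ring, show 2 - f - (1 + b - f) = 1 - b by ring]
  have q1 : (Complex.Gamma (f - a))⁻¹ = Sn (f - a) / Real.pi * Complex.Gamma (1 + a - f) := by
    rw [← r1]; field_simp
  have q2 : (Complex.Gamma (f - b))⁻¹ = Sn (f - b) / Real.pi * Complex.Gamma (1 + b - f) := by
    rw [← r2]; field_simp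
  have q3 : (Complex.Gamma (1 - a))⁻¹ = Sn a / Real.pi * Complex.Gamma a := by
    rw [← r3]; field_simp
  have q4 : (Complex.Gamma (1 - b))⁻¹ = Sn b / Real.pi * Complex.Gamma b := by
    rw [← r4]; field_simp
  have q5 : (Complex.Gamma (1 + a + b - f))⁻¹ =
      Sn (f - a - b) / Real.pi * Complex.Gamma (f - a - b) := by
    rw [← r5]; field_simp
  simp only [div_eq_mul_inv, mul_inv] at *
  rw [q1, q2, q3, q4, q5]
  linear_combination (Complex.Gamma a * Complex.Gamma b * Complex.Gamma (1 + a - f) *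
    Complex.Gamma (1 + b - f) * Complex.Gamma (f - a - b) * (Real.pi : ℂ)⁻¹ ^ 2) * hs

/-- The nonterminating Saalschütz summation. -/
theorem threeDiff_saalschutz {a b c f h : ℂ} (ha : ∀ m : ℕ, a ≠ -m) (hb : ∀ m : ℕ, b ≠ -m)
    (hc : 0 < c.re) (ha' : ∀ m : ℕ, 1 + a - f ≠ -m) (hb' : ∀ m : ℕ, 1 + b - f ≠ -m)
    (hc' : 0 < (1 + c - f).re) (hh : h = 1 + a + b - f) (hh0 : 0 ≤ h.re) (hh1 : h.re < 1)
    (hca : 0 < (c + h - a).re) (hcb : 0 < (c + h - b).re) :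
    threeDiff a b c f (c + h) =
      Sn f / Real.pi * Complex.Gamma a * Complex.Gamma b * Complex.Gamma c *
        Complex.Gamma (1 + a - f) * Complex.Gamma (1 + b - f) * Complex.Gamma (1 + c - f) /
        (Complex.Gamma h * Complex.Gamma (c + h - a) * Complex.Gamma (c + h - b)) := by
  set R : ℂ → ℂ := fun c => Complex.Gamma (c + h - a) * Complex.Gamma (c + h - b) /
    (Complex.Gamma c * Complex.Gamma (1 + c - f)) with hR
  have hfab : 0 < (f - a - b).re := by rw [hh] at hh1; simp at hh1 ⊢; linarith
  have hfab' : 0 < (2 - f - (1 + a - f) - (1 + b - f)).re := by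
    rwa [show 2 - f - (1 + a - f) - (1 + b - f) = f - a - b by ring]
  have ne : ∀ z : ℂ, 0 < z.re → ∀ m : ℕ, z ≠ -m := by
    rintro z hz m rfl
    simp at hz
    have : (0 : ℝ) ≤ m := m.cast_nonneg
    linarith
  have hN : ∀ N : ℕ, R (N + c) * threeDiff a b (N + c) f (N + c + h) =
      R c * threeDiff a b c f (c + h) := by
    intro N
    induction N with
    | zero => simp
    | succ N ih =>
      rw [← ih]
      have hN0 : (0 : ℝ) ≤ N := N.cast_nonneg
      have p1 : 0 < (N + c : ℂ).re := by simp; linarith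
      have p2 : 0 < (1 + (N + c) - f : ℂ).re := by simp at hc' ⊢; linarith
      have p3 : 0 < (N + c + h - a : ℂ).re := by simp at hca ⊢; linarith
      have p4 : 0 < (N + c + h - b : ℂ).re := by simp at hcb ⊢; linarith
      have st := threeDiff_step (c := N + c) ha hb (ne _ p1) ha' hb' (ne _ p2) hh
      have z1 : (N + c : ℂ) ≠ 0 := fun h => by simpa using ne _ p1 0 (by simpa using h)
      have nz : ∀ z : ℂ, 0 < z.re → z ≠ 0 := fun z hz h => by simp [h] at hz
      have g1 := Complex.Gamma_ne_zero_of_re_pos p1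
      have g2 := Complex.Gamma_ne_zero_of_re_pos p2
      simp only [hR]
      rw [show ((N + 1 : ℕ) : ℂ) + c = N + c + 1 by push_cast; ring,
        show (N : ℂ) + c + 1 + h - a = (N + c + h - a) + 1 by ring,
        show (N : ℂ) + c + 1 + h - b = (N + c + h - b) + 1 by ring,
        show 1 + ((N : ℂ) + c + 1) - f = (1 + (N + c) - f) + 1 by ring,
        Complex.Gamma_add_one _ (nz _ p1), Complex.Gamma_add_one _ (nz _ p2),
        Complex.Gamma_add_one _ (nz _ p3), Complex.Gamma_add_one _ (nz _ p4)]
      have n1 := nz _ p1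
      have n2 := nz _ p2
      field_simp
      linear_combination (Complex.Gamma (N + c + h - a) * Complex.Gamma (N + c + h - b)) * st
  have hlim : Tendsto (fun N : ℕ => R (N + c) * threeDiff a b (N + c) f (N + c + h)) atTop
      (𝓝 (Sn f / Real.pi * Complex.Gamma a * Complex.Gamma b * Complex.Gamma (1 + a - f) *
      Complex.Gamma (1 + b - f) / Complex.Gamma (1 + a + b - f))) := by
    rw [← gauss_threeDiff ha hb ha' hb' hfab]
    have l1 := tendsto_tsum_threeTerm (c := c) hh0 hfab
    have l2 := tendsto_tsum_threeTerm (c := 1 + c - f) hh0 hfab'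
    have m1 := tendsto_Gamma_ratio (c + h - a) (1 + c - f) (c + h)
    have m2 := tendsto_Gamma_ratio (c + h - a) c (1 + c - f + h)
    have := (m1.mul l1).sub (m2.mul l2)
    rw [one_mul, one_mul] at this
    refine this.congr (fun N => ?_)
    have hN0 : (0 : ℝ) ≤ N := N.cast_nonneg
    have p1 : Complex.Gamma (N + (c + h)) ≠ 0 :=
      Complex.Gamma_ne_zero_of_re_pos (by simp at hc ⊢; linarith)
    have p2 : Complex.Gamma (N + (1 + c - f + h)) ≠ 0 :=
      Complex.Gamma_ne_zero_of_re_pos (by simp at hc' ⊢; linarith)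
    simp only [threeDiff, hR]
    rw [show (1 + c - f + (c + h) - (c + h - a) : ℂ) = c + h - b by rw [hh]; ring,
      show (c + (1 + c - f + h) - (c + h - a) : ℂ) = c + h - b by rw [hh]; ring,
      show (1 + ((N : ℂ) + c) - f : ℂ) = N + (1 + c - f) by ring,
      show (1 + ((N : ℂ) + c + h) - f : ℂ) = N + (1 + c - f + h) by ring,
      show ((N : ℂ) + c + h - a : ℂ) = N + (c + h - a) by ring,
      show ((N : ℂ) + c + h - b : ℂ) = N + (c + h - b) by ring,
      show ((N : ℂ) + c + h : ℂ) = N + (c + h) by ring]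
    field_simp
  have hfin := tendsto_nhds_unique hlim (by simp_rw [hN]; exact tendsto_const_nhds)
  have g1 := Complex.Gamma_ne_zero_of_re_pos hc
  have g2 := Complex.Gamma_ne_zero_of_re_pos hc'
  have g3 := Complex.Gamma_ne_zero_of_re_pos hca
  have g4 := Complex.Gamma_ne_zero_of_re_pos hcb
  rw [← hh] at hfin
  have hR0 : R c ≠ 0 := by
    simp only [hR]; exact div_ne_zero (mul_ne_zero g3 g4) (mul_ne_zero g1 g2)
  rw [← mul_right_inj' hR0, ← hfin]
  simp only [hR]
  rw [div_mul_div_comm, show Complex.Gamma h * Complex.Gamma (c + h - a) * Complex.Gamma (c + h - b) =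
    Complex.Gamma h * (Complex.Gamma (c + h - a) * Complex.Gamma (c + h - b)) by ring]
  field_simp

theorem ne_neg_nat_of_re_pos {z : ℂ} (hz : 0 < z.re) (m : ℕ) : z ≠ -m := by
  rintro rfl
  simp at hz
  have : (0 : ℝ) ≤ m := m.cast_nonneg
  linarith

theorem tsum_threeTerm_contiguous {a b c f H : ℂ} (hc : ∀ m : ℕ, c ≠ -m)
    (h : 0 < (f + H - a - b - c).re) :
    (H - c) * ∑' k, threeTerm a b c f (H + 1) k =
      ∑' k, threeTerm a b c f H k - ∑' k, threeTerm a b (c + 1) f (H + 1) k := by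
  have s1 := summable_threeTerm h
  have s2 := summable_threeTerm (a := a) (b := b) (c := c + 1) (f := f) (H := H + 1)
    (by rwa [show f + (H + 1) - a - b - (c + 1) = f + H - a - b - c by ring])
  rw [← tsum_mul_left, ← s1.tsum_sub s2]
  refine tsum_congr fun k => ?_
  simp only [threeTerm, div_eq_mul_inv, mul_inv]
  rw [Gamma_inv_eq_mul (k + H), ← add_assoc, ← add_assoc,
    Complex.Gamma_add_one (k + c) (fun hh => hc k (by linear_combination hh))]
  ring

theorem threeDiff_contiguous {a b c f H : ℂ} (hc : ∀ m : ℕ, c ≠ -m)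
    (hc' : ∀ m : ℕ, 1 + c - f ≠ -m) (h : 0 < (f + H - a - b - c).re) :
    (H - c) * threeDiff a b c f (H + 1) = threeDiff a b c f H - threeDiff a b (c + 1) f (H + 1) := by
  have h1 := tsum_threeTerm_contiguous hc h
  have h2 := tsum_threeTerm_contiguous (a := 1 + a - f) (b := 1 + b - f) (f := 2 - f)
    (H := 1 + H - f) hc' (by convert h using 2; ring)
  simp only [threeDiff]
  rw [show 1 + c - f + 1 = 1 + (c + 1) - f by ring, show 1 + H - f + 1 = 1 + (H + 1) - f by ring] at h2
  linear_combination h1 - h2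

/-- The two-term combination of `₃F₂(1)` series as a single convergent series. -/
theorem threeDiff_eq_tsum {a b f h : ℂ} (ha : 0 < a.re) (hb : 0 < b.re)
    (ha' : 0 < (1 + a - f).re) (hb' : 0 < (1 + b - f).re)
    (hh : h = 1 + a + b - f) (hh0 : 0 < h.re) (hh1 : h.re < 1) (n : ℕ) :
    ∀ c : ℂ, 0 < c.re → 0 < (1 + c - f).re → 
    threeDiff a b c f (c + h + n) =
      Sn f / Real.pi * Complex.Gamma (1 + a - f) * Complex.Gamma (1 + b - f) * Complex.Gamma c /
        Complex.Gamma (h + n) * ∑' m, threeTerm a b (h + n) h (c + h + n) m := by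
  induction n with
  | zero =>
    intro c hc hc'
    have hca : 0 < (c + h - a).re := by rw [hh]; simp at hb' ⊢; linarith
    have hcb : 0 < (c + h - b).re := by rw [hh]; simp at ha' ⊢; linarith
    have e : ∀ m, threeTerm a b h h (c + h) m = Complex.Gamma (m + a) * Complex.Gamma (m + b) /
        (m.factorial * Complex.Gamma (m + (c + h))) := by
      intro m
      have : Complex.Gamma (m + h) ≠ 0 := Complex.Gamma_ne_zero_of_re_pos (by simp; positivity)
      rw [threeTerm]
      field_simp
    simp only [Nat.cast_zero, add_zero, e]
    rw [gauss_tsum (ne_neg_nat_of_re_pos ha) (ne_neg_nat_of_re_pos hb) (by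
      rw [hh]; convert hc' using 2; ring),
      threeDiff_saalschutz (ne_neg_nat_of_re_pos ha) (ne_neg_nat_of_re_pos hb) hc
        (ne_neg_nat_of_re_pos ha') (ne_neg_nat_of_re_pos hb') hc' hh hh0.le hh1 hca hcb,
      show c + h - a - b = 1 + c - f by rw [hh]; ring]
    simp only [div_eq_mul_inv, mul_inv]
    ring
  | succ n ih =>
    intro c hc hc'
    have h1 := ih c hc hc'
    have h2 := ih (c + 1) (by simp; linarith) (by simp at hc' ⊢; linarith)
    have h3 := threeDiff_contiguous (a := a) (b := b) (H := c + h + n)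
      (ne_neg_nat_of_re_pos hc) (ne_neg_nat_of_re_pos hc') (by rw [hh]; ring_nf; simp; positivity)
    have hn : 0 < (h + n).re := by simp; positivity
    rw [show c + 1 + h + (n : ℂ) = c + h + n + 1 by ring] at h2
    rw [h1, h2] at h3
    have h4 : (c + h + n - c : ℂ) = h + n := by ring
    rw [h4] at h3
    have nz := ne_zero_of_re_pos hn
    rw [← mul_right_inj' nz]
    push_cast
    rw [← add_assoc, ← add_assoc, h3, Complex.Gamma_add_one _ nz,
      Complex.Gamma_add_one _ (ne_zero_of_re_pos hc)]
    have s1 := summable_threeTerm (a := a) (b := b) (c := h + n) (f := h) (H := c + h + n) (by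
      rw [hh]; convert hc' using 2; ring)
    have s2 := summable_threeTerm (a := a) (b := b) (c := h + n) (f := h) (H := c + h + n + 1) (by
      rw [hh]; simp at hc' ⊢; linarith)
    have key : ∑' m, threeTerm a b (h + n) h (c + h + n) m -
        c * ∑' m, threeTerm a b (h + n) h (c + h + n + 1) m =
        ∑' m, threeTerm a b (h + n + 1) h (c + h + n + 1) m := by
      rw [← tsum_mul_left, ← s1.tsum_sub (s2.mul_left c)]
      refine tsum_congr fun m => ?_
      simp only [threeTerm, div_eq_mul_inv, mul_inv]
      rw [Gamma_inv_eq_mul (m + (c + h + n)), show (m : ℂ) + (c + h + n + 1) = m + (c + h + n) + 1 by ring,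
        show (m : ℂ) + (h + n + 1) = m + (h + n) + 1 by ring,
        Complex.Gamma_add_one (m + (h + n)) (ne_zero_of_re_pos (by simp; positivity))]
      ring
    have gz : Complex.Gamma (h + n) ≠ 0 := Complex.Gamma_ne_zero_of_re_pos hn
    field_simp
    linear_combination (Sn f * Complex.Gamma (1 + a - f) * Complex.Gamma (1 + b - f) *
      Complex.Gamma c) * key

/-- The coefficients `(α)ₙ(β)ₙ/n!`. -/
def gaussCoeff (α β : ℂ) (n : ℕ) : ℂ :=
  Complex.Gamma (n + α) * Complex.Gamma (n + β) / (n.factorial * (Complex.Gamma α * Complex.Gamma β))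

theorem norm_inv_Gamma_add_le {z : ℂ} (hz : 0 < z.re) (k n : ℕ) :
    ‖(Complex.Gamma (k + (z + n)))⁻¹‖ ≤
      ‖Complex.Gamma z‖ * ‖(Complex.Gamma (k + z))⁻¹‖ * ‖(Complex.Gamma (n + z))⁻¹‖ := by
  have h := norm_Gamma_ratio_le hz k n
  have g : Complex.Gamma (n + z) ≠ 0 := Complex.Gamma_ne_zero_of_re_pos (by simp; positivity)
  rw [div_eq_mul_inv, div_eq_mul_inv, norm_mul, norm_mul] at h
  rw [add_comm z, norm_inv (Complex.Gamma (n + z)), ← div_eq_mul_inv,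
    le_div_iff₀ (norm_pos_iff.mpr g)]
  linarith

theorem Fstar_eq_tsum_threeTerm {a b c d e f g : ℂ} (hs : e + f + g = a + b + c + d + 1)
    (hd : 0 < d.re) (hz : 0 < (e + g - d).re) (he : 0 < (e - d).re) (hg : 0 < (g - d).re) :
    HasSum (fun n => gaussCoeff (e - d) (g - d) n * ∑' k, threeTerm a b c f (e + g - d + n) k)
      (Fstar a b c d f e g) := by
  set z := e + g - d with hzdef
  set α := e - d with hα
  set β := g - d with hβ
  have gα : Complex.Gamma α ≠ 0 := Complex.Gamma_ne_zero_of_re_pos he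
  have gβ : Complex.Gamma β ≠ 0 := Complex.Gamma_ne_zero_of_re_pos hg
  set u : ℕ × ℕ → ℂ := fun p => gaussCoeff α β p.2 * threeTerm a b c f (z + p.2) p.1 with hu
  have hsum : Summable u := by
    obtain ⟨A, hA, hA'⟩ := exists_norm_threeTerm_le a b c f z
    obtain ⟨B, hB, hB'⟩ := exists_norm_gauss_term_le α β z
    have s1 := summable_rpow_nat_add_one (p := (a + b + c - f - z).re - 1) (by
      rw [hzdef]; rw [show a + b + c - f - (e + g - d) = -1 by linear_combination -hs]; simp)
    have s2 := summable_rpow_nat_add_one (p := (α + β - z).re - 1) (by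
      rw [hzdef, hα, hβ, show e - d + (g - d) - (e + g - d) = -d by ring, Complex.neg_re]; linarith)
    have s3 := (s1.mul_left A).mul_of_nonneg (s2.mul_left B) (fun k => by positivity)
      (fun n => by positivity)
    refine Summable.of_norm_bounded (s3.mul_left
      (‖Complex.Gamma z‖ * ‖(Complex.Gamma α * Complex.Gamma β)⁻¹‖)) (fun p => ?_)
    obtain ⟨k, n⟩ := p
    calc ‖u (k, n)‖ = ‖(Complex.Gamma α * Complex.Gamma β)⁻¹‖ *
          ‖Complex.Gamma (n + α) * Complex.Gamma (n + β) / n.factorial‖ *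
          ‖Complex.Gamma (k + a) * Complex.Gamma (k + b) * Complex.Gamma (k + c) /
            (k.factorial * Complex.Gamma (k + f))‖ * ‖(Complex.Gamma (k + (z + n)))⁻¹‖ := by
          simp only [← norm_mul, hu, gaussCoeff, threeTerm, div_eq_mul_inv, mul_inv]
          ring_nf
      _ ≤ ‖(Complex.Gamma α * Complex.Gamma β)⁻¹‖ *
          ‖Complex.Gamma (n + α) * Complex.Gamma (n + β) / n.factorial‖ *
          ‖Complex.Gamma (k + a) * Complex.Gamma (k + b) * Complex.Gamma (k + c) /
            (k.factorial * Complex.Gamma (k + f))‖ * (‖Complex.Gamma z‖ *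
            ‖(Complex.Gamma (k + z))⁻¹‖ * ‖(Complex.Gamma (n + z))⁻¹‖) := by
          gcongr
          exact norm_inv_Gamma_add_le hz k n
      _ = ‖Complex.Gamma z‖ * ‖(Complex.Gamma α * Complex.Gamma β)⁻¹‖ *
          (‖threeTerm a b c f z k‖ * ‖Complex.Gamma (n + α) * Complex.Gamma (n + β) /
            (n.factorial * Complex.Gamma (n + z))‖) := by
          simp only [← norm_mul, threeTerm, div_eq_mul_inv, mul_inv]
          ring_nf
      _ ≤ _ := by
          gcongr
          · exact hA' k
          · exact hB' n
  have hrow : ∀ k, ∑' n, u (k, n) = Complex.Gamma (k + a) * Complex.Gamma (k + b) *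
      Complex.Gamma (k + c) * Complex.Gamma (k + d) /
      ((k.factorial : ℂ) * Complex.Gamma (k + f) * Complex.Gamma (k + e) * Complex.Gamma (k + g)) := by
    intro k
    have G := gauss_tsum (x := α) (y := β) (z := k + z) (ne_neg_nat_of_re_pos he)
      (ne_neg_nat_of_re_pos hg) (by
        rw [hzdef, hα, hβ, show k + (e + g - d) - (e - d) - (g - d) = k + d by ring]; simp; positivity)
    have e1 : ∀ n : ℕ, u (k, n) = Complex.Gamma (k + a) * Complex.Gamma (k + b) *
      Complex.Gamma (k + c) / ((k.factorial : ℂ) * Complex.Gamma (k + f)) *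
      (Complex.Gamma α * Complex.Gamma β)⁻¹ * (Complex.Gamma (n + α) * Complex.Gamma (n + β) /
      (n.factorial * Complex.Gamma (n + (k + z)))) := by
      intro n
      simp only [hu, gaussCoeff, threeTerm, div_eq_mul_inv, mul_inv]
      rw [show (k : ℂ) + (z + n) = n + (k + z) by ring]
      ring
    simp only [e1]
    rw [tsum_mul_left, G, hzdef, hα, hβ,
      show k + (e + g - d) - (e - d) - (g - d) = k + d by ring,
      show k + (e + g - d) - (e - d) = k + g by ring,
      show k + (e + g - d) - (g - d) = k + e by ring]
    rw [hα] at gα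
    rw [hβ] at gβ
    field_simp
  have h1 : ∑' p, u p = Fstar a b c d f e g := by
    rw [hsum.tsum_prod, Fstar]
    exact tsum_congr hrow
  have h2 := hsum.hasSum
  rw [h1] at h2
  have h3 : HasSum (fun p : ℕ × ℕ => u (p.2, p.1)) (Fstar a b c d f e g) :=
    (Equiv.prodComm ℕ ℕ).hasSum_iff.mpr h2
  have h4 := h3.prod_fiberwise (fun n => (h3.summable.comp_injective
    (Prod.mk_right_injective n)).hasSum)
  convert h4 using 1
  funext n
  simp only [Function.comp_def, hu, tsum_mul_left]

/-- The summand of the double series that makes the reflection symmetry of `L` visible. -/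
def baileyTerm (a b α β h c : ℂ) (p : ℕ × ℕ) : ℂ :=
  Complex.Gamma (p.1 + α) * Complex.Gamma (p.1 + β) / (p.1.factorial * Complex.Gamma (p.1 + h)) *
    (Complex.Gamma (p.2 + a) * Complex.Gamma (p.2 + b) /
      (p.2.factorial * Complex.Gamma (p.2 + h))) *
    (Complex.Gamma ((p.1 + p.2 : ℕ) + h) / Complex.Gamma ((p.1 + p.2 : ℕ) + (h + c)))

theorem baileyTerm_swap (a b α β h c : ℂ) (p : ℕ × ℕ) :
    baileyTerm α β a b h c p.swap = baileyTerm a b α β h c p := by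
  simp only [baileyTerm, Prod.fst_swap, Prod.snd_swap, add_comm p.2 p.1]
  ring

theorem summable_baileyTerm {a b α β h c : ℂ} (hc : 0 < c.re)
    (h1 : (a + b - h).re < c.re / 2) (h2 : (α + β - h).re < c.re / 2) :
    Summable (baileyTerm a b α β h c) := by
  obtain ⟨A, hA, hA'⟩ := exists_norm_gauss_term_le α β h
  obtain ⟨B, hB, hB'⟩ := exists_norm_gauss_term_le a b h
  obtain ⟨D, hD, hD'⟩ := exists_norm_Gamma_div_Gamma_le h (h + c)
  have s1 := summable_rpow_nat_add_one (p := (α + β - h).re - 1 - c.re / 2) (by linarith)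
  have s2 := summable_rpow_nat_add_one (p := (a + b - h).re - 1 - c.re / 2) (by linarith)
  refine Summable.of_norm_bounded (((s1.mul_left A).mul_of_nonneg (s2.mul_left B)
    (fun k => by positivity) (fun n => by positivity)).mul_left D) (fun p => ?_)
  obtain ⟨n, m⟩ := p
  have hn : (0 : ℝ) < (n : ℝ) + 1 := by positivity
  have hm : (0 : ℝ) < (m : ℝ) + 1 := by positivity
  have hle : (((n + m : ℕ) : ℝ) + 1) ^ (-c.re) ≤
      ((n : ℝ) + 1) ^ (-(c.re / 2)) * ((m : ℝ) + 1) ^ (-(c.re / 2)) := by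
    have hnm : (0 : ℝ) < ((n + m : ℕ) : ℝ) + 1 := by positivity
    rw [show -c.re = -(c.re / 2) + -(c.re / 2) by ring, Real.rpow_add hnm]
    have hn0 : (0 : ℝ) ≤ n := n.cast_nonneg
    have hm0 : (0 : ℝ) ≤ m := m.cast_nonneg
    gcongr ?_ * ?_
    · exact Real.rpow_le_rpow_of_nonpos hn (by push_cast; linarith) (by linarith)
    · exact Real.rpow_le_rpow_of_nonpos hm (by push_cast; linarith) (by linarith)
  simp only [baileyTerm]
  rw [norm_mul, norm_mul]
  calc _ ≤ (A * ((n : ℝ) + 1) ^ ((α + β - h).re - 1)) * (B * ((m : ℝ) + 1) ^ ((a + b - h).re - 1)) *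
        (D * (((n + m : ℕ) : ℝ) + 1) ^ (h - (h + c)).re) := by
        gcongr
        · exact hA' n
        · exact hB' m
        · exact hD' (n + m)
    _ ≤ (A * ((n : ℝ) + 1) ^ ((α + β - h).re - 1)) * (B * ((m : ℝ) + 1) ^ ((a + b - h).re - 1)) *
        (D * (((n : ℝ) + 1) ^ (-(c.re / 2)) * ((m : ℝ) + 1) ^ (-(c.re / 2)))) := by
        gcongr
        rwa [show h - (h + c) = -c by ring, Complex.neg_re]
    _ = _ := by
        rw [sub_eq_add_neg _ (c.re / 2), sub_eq_add_neg _ (c.re / 2), Real.rpow_add hn,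
          Real.rpow_add hm]
        ring

theorem Fstar_sub_eq_tsum_baileyTerm {a b c d e f g h : ℂ} (hs : e + f + g = a + b + c + d + 1)
    (ha : 0 < a.re) (hb : 0 < b.re) (hc : 0 < c.re) (hd : 0 < d.re)
    (ha' : 0 < (1 + a - f).re) (hb' : 0 < (1 + b - f).re) (hc' : 0 < (1 + c - f).re)
    (hd' : 0 < (1 + d - f).re) (he : 0 < (e - d).re) (hg : 0 < (g - d).re)
    (hh : h = 1 + a + b - f) (hh0 : 0 < h.re) (hh1 : h.re < 1)
    (hcd : c.re / 2 < d.re) (hfc : f.re < 1 + c.re / 2) :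
    Fstar a b c d f e g -
      Fstar (1 + a - f) (1 + b - f) (1 + c - f) (1 + d - f) (2 - f) (1 + e - f) (1 + g - f) =
    Sn f / Real.pi * Complex.Gamma (1 + a - f) * Complex.Gamma (1 + b - f) * Complex.Gamma c /
      (Complex.Gamma (e - d) * Complex.Gamma (g - d)) *
      ∑' p, baileyTerm a b (e - d) (g - d) h c p := by
  have hz : e + g - d = c + h := by rw [hh]; linear_combination hs
  have hz0 : 0 < (e + g - d).re := by rw [hz]; simp; linarith
  have hz' : (1 + e - f) + (1 + g - f) - (1 + d - f) = 1 + (c + h) - f := by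
    rw [← hz]; ring
  have H1 := Fstar_eq_tsum_threeTerm hs hd hz0 he hg
  have H2 := Fstar_eq_tsum_threeTerm (a := 1 + a - f) (b := 1 + b - f) (c := 1 + c - f)
    (d := 1 + d - f) (e := 1 + e - f) (f := 2 - f) (g := 1 + g - f) (by linear_combination hs) hd'
    (by rw [hz']; simp at hc' ⊢; linarith) (by convert he using 2; ring) (by convert hg using 2; ring)
  rw [hz', show 1 + e - f - (1 + d - f) = e - d by ring,
    show 1 + g - f - (1 + d - f) = g - d by ring] at H2
  rw [hz] at H1
  have H3 := H1.sub H2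
  rw [← H3.tsum_eq, (summable_baileyTerm hc (by
      rw [hh, show a + b - (1 + a + b - f) = f - 1 by ring]; simp; linarith) (by
      rw [show h = e + g - d - c by rw [hz]; ring,
        show e - d + (g - d) - (e + g - d - c) = c - d by ring]; simp; linarith)).tsum_prod,
    ← tsum_mul_left]
  refine tsum_congr fun n => ?_
  rw [← mul_sub, show 1 + (c + h) - f + (n : ℂ) = 1 + (c + h + n) - f by ring]
  change gaussCoeff (e - d) (g - d) n * threeDiff a b c f (c + h + n) = _
  rw [threeDiff_eq_tsum ha hb ha' hb' hh hh0 hh1 n c hc hc', ← tsum_mul_left, ← tsum_mul_left,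
    ← tsum_mul_left]
  refine tsum_congr fun m => ?_
  simp only [gaussCoeff, threeTerm, baileyTerm, div_eq_mul_inv, mul_inv]
  rw [show ((n + m : ℕ) : ℂ) + h = m + (h + n) by push_cast; ring,
    show ((n + m : ℕ) : ℂ) + (h + c) = m + (c + h + n) by push_cast; ring, add_comm (n : ℂ) h]
  ring

/-- A region of parameters in which the double series for `L` converges absolutely; it is stable
under `(a, b, c, d; f; e, g) ↦ (e-d, g-d, c, 1+c-f; 1+c-d; 1+a+c-f, 1+b+c-f)`. -/
structure BaileyRegion (a b c d e f g : ℂ) : Prop where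
  saal : e + f + g = a + b + c + d + 1
  ha : 0 < a.re
  hb : 0 < b.re
  hc : 0 < c.re
  hd : 0 < d.re
  haf : 0 < (1 + a - f).re
  hbf : 0 < (1 + b - f).re
  hcf : 0 < (1 + c - f).re
  hdf : 0 < (1 + d - f).re
  hed : 0 < (e - d).re
  hgd : 0 < (g - d).re
  hec : 0 < (e - c).re
  hgc : 0 < (g - c).re
  hh0 : 0 < (1 + a + b - f).re
  hh1 : (1 + a + b - f).re < 1
  hcd : c.re / 2 < d.re
  hfc : f.re < 1 + c.re / 2
  sinf : Sn f ≠ 0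
  sincd : Sn (1 + c - d) ≠ 0

theorem BaileyRegion.reflect {a b c d e f g : ℂ} (h : BaileyRegion a b c d e f g) :
    BaileyRegion (e - d) (g - d) c (1 + c - f) (1 + a + c - f) (1 + c - d) (1 + b + c - f) where
  saal := by linear_combination -h.saal
  ha := h.hed
  hb := h.hgd
  hc := h.hc
  hd := h.hcf
  haf := by convert h.hec using 2; ring
  hbf := by convert h.hgc using 2; ring
  hcf := by convert h.hd using 2; ring
  hdf := by convert h.hdf using 2; ring
  hed := by convert h.ha using 2; ring
  hgd := by convert h.hb using 2; ring
  hec := by convert h.haf using 2; ring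
  hgc := by convert h.hbf using 2; ring
  hh0 := by convert h.hh0 using 2; linear_combination h.saal
  hh1 := by convert h.hh1 using 2; linear_combination h.saal
  hcd := by have := h.hfc; simp; linarith
  hfc := by have := h.hcd; simp; linarith
  sinf := h.sincd
  sincd := by rw [show 1 + c - (1 + c - f) = f by ring]; exact h.sinf

theorem Lf_eq_tsum_baileyTerm {a b c d e f g : ℂ} (h : BaileyRegion a b c d e f g) :
    Lf a b c d f e g = (∑' p, baileyTerm a b (e - d) (g - d) (1 + a + b - f) c p) /
      (Real.pi * (Complex.Gamma a * Complex.Gamma b * (Complex.Gamma (e - d) * Complex.Gamma (g - d)) *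
        (Complex.Gamma d * Complex.Gamma (1 + c - f)) * Complex.Gamma (1 + d - f))) := by
  have g1 := Complex.Gamma_ne_zero_of_re_pos h.haf
  have g2 := Complex.Gamma_ne_zero_of_re_pos h.hbf
  have g3 := Complex.Gamma_ne_zero_of_re_pos h.hc
  have hs := h.sinf
  rw [Lf, Fstar_sub_eq_tsum_baileyTerm h.saal h.ha h.hb h.hc h.hd h.haf h.hbf h.hcf h.hdf h.hed
    h.hgd rfl h.hh0 h.hh1 h.hcd h.hfc]
  field_simp

/-- One reflection of `L`, a form of Bailey's transformation. -/
theorem Lf_reflect {a b c d e f g : ℂ} (h : BaileyRegion a b c d e f g) :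
    Lf a b c d f e g =
      Lf (e - d) (g - d) c (1 + c - f) (1 + c - d) (1 + a + c - f) (1 + b + c - f) := by
  rw [Lf_eq_tsum_baileyTerm h, Lf_eq_tsum_baileyTerm h.reflect]
  rw [show 1 + a + c - f - (1 + c - f) = a by ring, show 1 + b + c - f - (1 + c - f) = b by ring,
    show 1 + (e - d) + (g - d) - (1 + c - d) = 1 + a + b - f by linear_combination h.saal,
    show 1 + c - (1 + c - d) = d by ring, show 1 + (1 + c - f) - (1 + c - d) = 1 + d - f by ring]
  congr 1
  · rw [← (Equiv.prodComm ℕ ℕ).tsum_eq]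
    exact tsum_congr fun p => (baileyTerm_swap _ _ _ _ _ _ p)
  · ring

theorem Lf_perm (a b c d e f g : ℂ) : Lf a b c d f e g = Lf c d a b f e g := by
  simp only [Lf, Fstar]
  congr 1
  · congr 1 <;> refine tsum_congr fun k => ?_ <;> ring
  · ring

/-- The duality of `L` in an open region of parameters. -/
theorem Lf_dual_of_region {a b c d e f g : ℂ} (h : BaileyRegion a b c d e f g)
    (h' : BaileyRegion c (1 + c - f) (e - d) (g - d) (1 + a + c - f) (1 + c - d) (1 + b + c - f)) :
    Lf a b c d f e g = Lf (e - a) (e - b) (e - c) (e - d) (1 + e - g) e (1 + e - f) := by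
  rw [Lf_reflect h, Lf_perm, Lf_reflect h']
  rw [show 1 + a + c - f - (g - d) = e - b by linear_combination -h.saal,
    show 1 + b + c - f - (g - d) = e - a by linear_combination -h.saal,
    show 1 + (e - d) - (1 + c - d) = e - c by ring,
    show 1 + (e - d) - (g - d) = 1 + e - g by ring,
    show 1 + c + (e - d) - (1 + c - d) = e by ring,
    show 1 + (1 + c - f) + (e - d) - (1 + c - d) = 1 + e - f by ring]
  simp only [Lf, Fstar]
  congr 1
  · congr 1 <;> refine tsum_congr fun k => ?_ <;> ring
  · ring

/-- The `k`-th term of the series `Fstar`. -/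
def fourTerm (a b c d e f g : ℂ) (k : ℕ) : ℂ :=
  (Complex.Gamma (k + a) * Complex.Gamma (k + b) *
      Complex.Gamma (k + c) * Complex.Gamma (k + d)) /
    ((k.factorial : ℂ) * Complex.Gamma (k + e) * Complex.Gamma (k + f) *
      Complex.Gamma (k + g))

theorem fourTerm_succ {a b c d : ℂ} (e f g : ℂ) (ha : ∀ m : ℕ, a ≠ -m) (hb : ∀ m : ℕ, b ≠ -m)
    (hc : ∀ m : ℕ, c ≠ -m) (hd : ∀ m : ℕ, d ≠ -m) (k : ℕ) :
    (k + 1) * (k + e) * (k + f) * (k + g) * fourTerm a b c d e f g (k + 1) =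
      (k + a) * (k + b) * (k + c) * (k + d) * fourTerm a b c d e f g k := by
  have r : ∀ x : ℂ, ((k + 1 : ℕ) : ℂ) + x = k + x + 1 := fun x => by push_cast; ring
  simp only [fourTerm, div_eq_mul_inv, mul_inv]
  rw [Gamma_natCast_succ_add ha, Gamma_natCast_succ_add hb, Gamma_natCast_succ_add hc,
    Gamma_natCast_succ_add hd, r e, r f, r g, Gamma_inv_eq_mul (k + e), Gamma_inv_eq_mul (k + f),
    Gamma_inv_eq_mul (k + g), Nat.factorial_succ]
  have h1 : (k : ℂ) + 1 ≠ 0 := by exact_mod_cast k.succ_ne_zero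
  rw [Nat.cast_mul, mul_inv, Nat.cast_add_one]
  linear_combination (k + e) * (k + f) * (k + g) * ((k + a) * Complex.Gamma (k + a) *
    ((k + b) * Complex.Gamma (k + b)) * ((k + c) * Complex.Gamma (k + c)) *
    ((k + d) * Complex.Gamma (k + d))) * (k.factorial : ℂ)⁻¹ *
    (Complex.Gamma (k + e + 1))⁻¹ * (Complex.Gamma (k + f + 1))⁻¹ *
    (Complex.Gamma (k + g + 1))⁻¹ * mul_inv_cancel₀ h1

theorem norm_add_ge_half {x : ℝ} {z : ℂ} (h : 2 * ‖z‖ ≤ x) : x / 2 ≤ ‖(x : ℂ) + z‖ := by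
  have h0 : 0 ≤ ‖z‖ := norm_nonneg z
  have h1 : ‖(x : ℂ)‖ - ‖z‖ ≤ ‖(x : ℂ) + z‖ := by
    have := norm_sub_norm_le (x : ℂ) (-z)
    simpa using this
  rw [Complex.norm_real, Real.norm_of_nonneg (by linarith)] at h1
  linarith

theorem norm_quartic_le {a b c d e f g : ℂ} (hs : e + f + g = a + b + c + d + 2) {M x : ℝ}
    (he : ‖e‖ ≤ M) (hf : ‖f‖ ≤ M) (hg : ‖g‖ ≤ M)
    (h2 : ‖(a * b + a * c + a * d + b * c + b * d + c * d) - (e * f + e * g + f * g) +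
      2 * (e + f + g)‖ ≤ M)
    (h1 : ‖(a * b * c + a * b * d + a * c * d + b * c * d) - e * f * g +
      2 * (e * f + e * g + f * g)‖ ≤ M)
    (h0 : ‖a * b * c * d + 2 * (e * f * g)‖ ≤ M) (hx : 48 * M + 3 ≤ x) :
    ‖((x : ℂ) + a) * (x + b) * (x + c) * (x + d)‖ ≤
      (1 - 3 / 2 / x) * ‖(x : ℂ) * (x + e) * (x + f) * (x + g)‖ ∧
    0 < ‖(x : ℂ) * (x + e) * (x + f) * (x + g)‖ := by
  have hM : 0 ≤ M := (norm_nonneg _).trans he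
  have hx0 : 0 < x := by linarith
  have hx1 : 1 ≤ x := by linarith
  set N := ((x : ℂ) + a) * (x + b) * (x + c) * (x + d)
  set D := (x : ℂ) * (x + e) * (x + f) * (x + g) with hD
  have id : N = ((1 - 2 / x : ℝ) : ℂ) * D + (x ^ 2 *
      ((a * b + a * c + a * d + b * c + b * d + c * d) - (e * f + e * g + f * g) +
      2 * (e + f + g)) + x * ((a * b * c + a * b * d + a * c * d + b * c * d) - e * f * g +
      2 * (e * f + e * g + f * g)) + (a * b * c * d + 2 * (e * f * g))) := by
    have hxc : (x : ℂ) ≠ 0 := by exact_mod_cast hx0.ne'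
    simp only [N, D]
    push_cast
    field_simp
    linear_combination (-(x : ℂ) ^ 3) * hs
  have hDl : x ^ 4 / 8 ≤ ‖D‖ := by
    have l1 := norm_add_ge_half (x := x) (z := e) (by linarith)
    have l2 := norm_add_ge_half (x := x) (z := f) (by linarith)
    have l3 := norm_add_ge_half (x := x) (z := g) (by linarith)
    rw [hD, norm_mul, norm_mul, norm_mul, Complex.norm_real, Real.norm_of_nonneg hx0.le]
    calc x ^ 4 / 8 = x * (x / 2) * (x / 2) * (x / 2) := by ring
      _ ≤ _ := by gcongr
  have hrem : ‖(x : ℂ) ^ 2 *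
      ((a * b + a * c + a * d + b * c + b * d + c * d) - (e * f + e * g + f * g) +
      2 * (e + f + g)) + x * ((a * b * c + a * b * d + a * c * d + b * c * d) - e * f * g +
      2 * (e * f + e * g + f * g)) + (a * b * c * d + 2 * (e * f * g))‖ ≤ 3 * M * x ^ 2 := by
    refine (norm_add₃_le).trans ?_
    rw [norm_mul, norm_mul, norm_pow, Complex.norm_real, Real.norm_of_nonneg hx0.le]
    calc _ ≤ x ^ 2 * M + x * M + M := by gcongr
      _ ≤ _ := by nlinarith [mul_nonneg hM hx0.le, mul_nonneg hM (sub_nonneg.mpr hx1), mul_nonneg (mul_nonneg hM hx0.le) (sub_nonneg.mpr hx1)]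
  have h12 : 0 ≤ 1 - 2 / x := by
    rw [sub_nonneg, div_le_one hx0]; linarith
  refine ⟨?_, lt_of_lt_of_le (by positivity) hDl⟩
  rw [id]
  refine (norm_add_le _ _).trans ?_
  rw [norm_mul, Complex.norm_real, Real.norm_of_nonneg h12]
  have : 3 * M * x ^ 2 ≤ 1 / 2 / x * ‖D‖ := by
    calc 3 * M * x ^ 2 ≤ 1 / 2 / x * (x ^ 4 / 8) := by
          rw [show 1 / 2 / x * (x ^ 4 / 8) = x ^ 3 / 16 by field_simp; norm_num]
          nlinarith [sq_nonneg x]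
      _ ≤ _ := by gcongr
  calc _ ≤ (1 - 2 / x) * ‖D‖ + 1 / 2 / x * ‖D‖ := by linarith
    _ = _ := by ring

theorem one_sub_le_rpow (k : ℕ) :
    1 - 3 / 2 / ((k : ℝ) + 1 + 1) ≤ (((k : ℝ) + 1) / (k + 1 + 1)) ^ (3 / 2 : ℝ) := by
  have hk : (0 : ℝ) < (k : ℝ) + 1 + 1 := by positivity
  have := one_add_mul_self_le_rpow_one_add (s := -(1 / ((k : ℝ) + 1 + 1))) (by
    rw [neg_le_neg_iff, div_le_one hk]; have : (0 : ℝ) ≤ k := k.cast_nonneg; linarith)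
    (p := 3 / 2) (by norm_num)
  convert this using 1
  · ring
  · congr 1; field_simp; ring

theorem norm_fourTerm_succ_le {a b c d e f g : ℂ} (hs : e + f + g = a + b + c + d + 1)
    (ha : ∀ m : ℕ, a ≠ -m) (hb : ∀ m : ℕ, b ≠ -m)
    (hc : ∀ m : ℕ, c ≠ -m) (hd : ∀ m : ℕ, d ≠ -m) {M : ℝ}
    (he : ‖e - 1‖ ≤ M) (hf : ‖f - 1‖ ≤ M) (hg : ‖g - 1‖ ≤ M)
    (h2 : ‖((a - 1) * (b - 1) + (a - 1) * (c - 1) + (a - 1) * (d - 1) + (b - 1) * (c - 1) +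
      (b - 1) * (d - 1) + (c - 1) * (d - 1)) - ((e - 1) * (f - 1) + (e - 1) * (g - 1) +
      (f - 1) * (g - 1)) + 2 * ((e - 1) + (f - 1) + (g - 1))‖ ≤ M)
    (h1 : ‖((a - 1) * (b - 1) * (c - 1) + (a - 1) * (b - 1) * (d - 1) +
      (a - 1) * (c - 1) * (d - 1) + (b - 1) * (c - 1) * (d - 1)) - (e - 1) * (f - 1) * (g - 1) +
      2 * ((e - 1) * (f - 1) + (e - 1) * (g - 1) + (f - 1) * (g - 1))‖ ≤ M)
    (h0 : ‖(a - 1) * (b - 1) * (c - 1) * (d - 1) + 2 * ((e - 1) * (f - 1) * (g - 1))‖ ≤ M)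
    (k : ℕ) (hk : 48 * M + 3 ≤ k + 2) :
    ‖fourTerm a b c d e f g (k + 1 + 1)‖ ≤
      (((k : ℝ) + 1) / (k + 1 + 1)) ^ (3 / 2 : ℝ) * ‖fourTerm a b c d e f g (k + 1)‖ := by
  obtain ⟨q1, q2⟩ := norm_quartic_le (a := a - 1) (b := b - 1) (c := c - 1) (d := d - 1)
    (e := e - 1) (f := f - 1) (g := g - 1) (by linear_combination hs) he hf hg h2 h1 h0
    (x := (k : ℝ) + 1 + 1) (by linarith)
  have hrec := fourTerm_succ e f g ha hb hc hd (k + 1)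
  have r : ∀ z : ℂ, (((k : ℝ) + 1 + 1 : ℝ) : ℂ) + (z - 1) = ((k + 1 : ℕ) : ℂ) + z := by
    intro z; push_cast; ring
  have r' : (((k : ℝ) + 1 + 1 : ℝ) : ℂ) = ((k + 1 : ℕ) : ℂ) + 1 := by push_cast; ring
  simp only [r] at q1 q2
  rw [r'] at q1 q2
  have hrec' := congrArg norm hrec
  rw [norm_mul _ (fourTerm _ _ _ _ _ _ _ _), norm_mul _ (fourTerm _ _ _ _ _ _ _ _)] at hrec'
  have := one_sub_le_rpow k
  refine le_of_mul_le_mul_left (a := _) ?_ q2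
  rw [hrec']
  calc _ ≤ _ := mul_le_mul_of_nonneg_right q1 (norm_nonneg _)
    _ ≤ _ := mul_le_mul_of_nonneg_right (mul_le_mul_of_nonneg_right this (norm_nonneg _))
      (norm_nonneg _)
    _ = _ := by ring

theorem norm_le_of_ratio_le {T : ℕ → ℂ} {m : ℕ} (h : ∀ k, m ≤ k → ‖T (k + 1 + 1)‖ ≤
    (((k : ℝ) + 1) / (k + 1 + 1)) ^ (3 / 2 : ℝ) * ‖T (k + 1)‖) (n : ℕ) :
    ‖T (n + (m + 1))‖ ≤ (((m : ℝ) + 1) / ((n + m : ℕ) + 1)) ^ (3 / 2 : ℝ) * ‖T (m + 1)‖ := by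
  induction n with
  | zero =>
    have : ((m : ℝ) + 1) ≠ 0 := by positivity
    simp [div_self this]
  | succ n ih =>
    have := h (n + m) (by omega)
    rw [show n + 1 + (m + 1) = n + m + 1 + 1 by ring]
    refine this.trans ?_
    rw [show n + m + 1 = n + (m + 1) by ring]
    refine (mul_le_mul_of_nonneg_left ih (by positivity)).trans (le_of_eq ?_)
    rw [← mul_assoc, ← Real.mul_rpow (by positivity) (by positivity)]
    congr 2
    push_cast
    field_simp
    ring

theorem eventually_norm_le_of_continuous {t₀ : ℂ} {φ : ℂ → ℂ} (h : ContinuousAt φ t₀) {M : ℝ} (hM : ‖φ t₀‖ < M) :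
    ∀ᶠ t in 𝓝 t₀, ‖φ t‖ ≤ M :=
  (h.norm.eventually (gt_mem_nhds hM)).mono fun _ => le_of_lt

theorem eventually_ne_neg_nat {φ : ℂ → ℂ} {t₀ : ℂ} (h : ContinuousAt φ t₀)
    (h0 : ∀ m : ℕ, φ t₀ ≠ -m) : ∀ᶠ t in 𝓝 t₀, ∀ m : ℕ, φ t ≠ -m := by
  have hc : ContinuousAt (fun t => (Complex.Gamma (φ t))⁻¹) t₀ :=
    (Complex.differentiable_one_div_Gamma.continuous.continuousAt).comp h
  have : (Complex.Gamma (φ t₀))⁻¹ ≠ 0 := inv_ne_zero (Complex.Gamma_ne_zero h0)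
  filter_upwards [hc.eventually_ne this] with t ht m hm
  exact ht (by simp [hm, Complex.Gamma_neg_nat_eq_zero])

theorem differentiableAt_fourTerm {a b c d e f g : ℂ → ℂ} {t : ℂ}
    (ha : DifferentiableAt ℂ a t) (hb : DifferentiableAt ℂ b t) (hc : DifferentiableAt ℂ c t)
    (hd : DifferentiableAt ℂ d t) (he : DifferentiableAt ℂ e t) (hf : DifferentiableAt ℂ f t)
    (hg : DifferentiableAt ℂ g t) (ha0 : ∀ m : ℕ, a t ≠ -m) (hb0 : ∀ m : ℕ, b t ≠ -m)
    (hc0 : ∀ m : ℕ, c t ≠ -m) (hd0 : ∀ m : ℕ, d t ≠ -m) (k : ℕ) :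
    DifferentiableAt ℂ (fun t => fourTerm (a t) (b t) (c t) (d t) (e t) (f t) (g t) k) t := by
  have hG : ∀ {φ : ℂ → ℂ}, DifferentiableAt ℂ φ t → (∀ m : ℕ, φ t ≠ -m) →
      DifferentiableAt ℂ (fun t => Complex.Gamma (k + φ t)) t := by
    intro φ h h0
    refine DifferentiableAt.comp t (Complex.differentiableAt_Gamma _ ?_) (h.const_add _)
    intro m hm
    apply h0 (m + k)
    push_cast
    linear_combination hm
  have hI : ∀ {φ : ℂ → ℂ}, DifferentiableAt ℂ φ t →
      DifferentiableAt ℂ (fun t => (Complex.Gamma (k + φ t))⁻¹) t := fun h =>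
    DifferentiableAt.comp (g := fun s => (Complex.Gamma s)⁻¹) t
      (Complex.differentiable_one_div_Gamma _) (h.const_add _)
  simp only [fourTerm, div_eq_mul_inv, mul_inv]
  exact ((((hG ha ha0).mul (hG hb hb0)).mul (hG hc hc0)).mul (hG hd hd0)).mul
    ((((differentiableAt_const _).mul (hI he)).mul (hI hf)).mul (hI hg))

theorem analyticAt_Fstar {a b c d e f g : ℂ → ℂ} {t₀ : ℂ}
    (ha : Differentiable ℂ a) (hb : Differentiable ℂ b) (hc : Differentiable ℂ c)
    (hd : Differentiable ℂ d) (he : Differentiable ℂ e) (hf : Differentiable ℂ f)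
    (hg : Differentiable ℂ g) (hs : ∀ t, e t + f t + g t = a t + b t + c t + d t + 1)
    (ha0 : ∀ m : ℕ, a t₀ ≠ -m) (hb0 : ∀ m : ℕ, b t₀ ≠ -m)
    (hc0 : ∀ m : ℕ, c t₀ ≠ -m) (hd0 : ∀ m : ℕ, d t₀ ≠ -m) :
    AnalyticAt ℂ (fun t => Fstar (a t) (b t) (c t) (d t) (e t) (f t) (g t)) t₀ := by
  set p2 : ℂ → ℂ := fun t => ((a t - 1) * (b t - 1) + (a t - 1) * (c t - 1) +
      (a t - 1) * (d t - 1) + (b t - 1) * (c t - 1) +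
      (b t - 1) * (d t - 1) + (c t - 1) * (d t - 1)) - ((e t - 1) * (f t - 1) +
      (e t - 1) * (g t - 1) + (f t - 1) * (g t - 1)) + 2 * ((e t - 1) + (f t - 1) + (g t - 1))
    with hp2
  set p1 : ℂ → ℂ := fun t => ((a t - 1) * (b t - 1) * (c t - 1) +
      (a t - 1) * (b t - 1) * (d t - 1) +
      (a t - 1) * (c t - 1) * (d t - 1) + (b t - 1) * (c t - 1) * (d t - 1)) -
      (e t - 1) * (f t - 1) * (g t - 1) +
      2 * ((e t - 1) * (f t - 1) + (e t - 1) * (g t - 1) + (f t - 1) * (g t - 1)) with hp1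
  set p0 : ℂ → ℂ := fun t => (a t - 1) * (b t - 1) * (c t - 1) * (d t - 1) +
      2 * ((e t - 1) * (f t - 1) * (g t - 1)) with hp0
  set M : ℝ := ‖e t₀ - 1‖ + ‖f t₀ - 1‖ + ‖g t₀ - 1‖ + ‖p2 t₀‖ + ‖p1 t₀‖ + ‖p0 t₀‖ + 1 with hM
  have n1 := norm_nonneg (e t₀ - 1)
  have n2 := norm_nonneg (f t₀ - 1)
  have n3 := norm_nonneg (g t₀ - 1)
  have n4 := norm_nonneg (p2 t₀)
  have n5 := norm_nonneg (p1 t₀)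
  have n6 := norm_nonneg (p0 t₀)
  have c1 := ha.continuous
  have c2 := hb.continuous
  have c3 := hc.continuous
  have c4 := hd.continuous
  have c5 := he.continuous
  have c6 := hf.continuous
  have c7 := hg.continuous
  obtain ⟨m, hm⟩ := exists_nat_ge (48 * M + 3)
  set C : ℝ := ‖fourTerm (a t₀) (b t₀) (c t₀) (d t₀) (e t₀) (f t₀) (g t₀) (m + 1)‖ + 1 with hC
  have hT : ContinuousAt (fun t => fourTerm (a t) (b t) (c t) (d t) (e t) (f t) (g t) (m + 1)) t₀ :=
    (differentiableAt_fourTerm (ha _) (hb _) (hc _) (hd _) (he _) (hf _) (hg _) ha0 hb0 hc0 hd0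
      (m + 1)).continuousAt
  have ev : ∀ᶠ t in 𝓝 t₀, ((∀ m : ℕ, a t ≠ -m) ∧ (∀ m : ℕ, b t ≠ -m) ∧ (∀ m : ℕ, c t ≠ -m) ∧
      (∀ m : ℕ, d t ≠ -m)) ∧ ∀ n, ‖fourTerm (a t) (b t) (c t) (d t) (e t) (f t) (g t)
        (n + (m + 1))‖ ≤ (((m : ℝ) + 1) / ((n + m : ℕ) + 1)) ^ (3 / 2 : ℝ) * C := by
    filter_upwards [eventually_ne_neg_nat c1.continuousAt ha0,
      eventually_ne_neg_nat c2.continuousAt hb0, eventually_ne_neg_nat c3.continuousAt hc0,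
      eventually_ne_neg_nat c4.continuousAt hd0,
      eventually_norm_le_of_continuous (φ := fun t => e t - 1) (t₀ := t₀) (M := M)
        (by fun_prop) (by linarith),
      eventually_norm_le_of_continuous (φ := fun t => f t - 1) (t₀ := t₀) (M := M)
        (by fun_prop) (by linarith),
      eventually_norm_le_of_continuous (φ := fun t => g t - 1) (t₀ := t₀) (M := M)
        (by fun_prop) (by linarith),
      eventually_norm_le_of_continuous (φ := p2) (t₀ := t₀) (M := M)
        (by fun_prop) (by linarith),
      eventually_norm_le_of_continuous (φ := p1) (t₀ := t₀) (M := M)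
        (by fun_prop) (by linarith),
      eventually_norm_le_of_continuous (φ := p0) (t₀ := t₀) (M := M)
        (by fun_prop) (by linarith),
      eventually_norm_le_of_continuous hT (M := C) (by linarith)]
      with t t1 t2 t3 t4 t5 t6 t7 t8 t9 t10 t11
    refine ⟨⟨t1, t2, t3, t4⟩, fun n => (norm_le_of_ratio_le (fun k hk =>
      norm_fourTerm_succ_le (hs t) t1 t2 t3 t4 t5 t6 t7 t8 t9 t10 k ?_) n).trans ?_⟩
    · have : (m : ℝ) ≤ k := by exact_mod_cast hk
      linarith
    · exact mul_le_mul_of_nonneg_left t11 (by positivity)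
  obtain ⟨U, hU, hUo, htU⟩ := eventually_nhds_iff.mp ev
  have hsum : Summable fun n : ℕ => (((m : ℝ) + 1) / ((n + m : ℕ) + 1)) ^ (3 / 2 : ℝ) * C := by
    have := ((summable_nat_add_iff m).mpr
      (summable_rpow_nat_add_one (p := -(3 / 2)) (by norm_num))).mul_left
      (((m : ℝ) + 1) ^ (3 / 2 : ℝ) * C)
    refine this.congr fun n => ?_
    rw [Real.div_rpow (by positivity) (by positivity), Real.rpow_neg (by positivity)]
    ring
  have hdiff : ∀ k, DifferentiableOn ℂ
      (fun t => fourTerm (a t) (b t) (c t) (d t) (e t) (f t) (g t) k) U := fun k t ht =>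
    have := (hU t ht).1
    (differentiableAt_fourTerm (ha _) (hb _) (hc _) (hd _) (he _) (hf _) (hg _)
      this.1 this.2.1 this.2.2.1 this.2.2.2 k).differentiableWithinAt
  have hmain := (DifferentiableOn.fun_sum (u := Finset.range (m + 1)) fun k _ => hdiff k).add
    (differentiableOn_tsum_of_summable_norm hsum (fun n => hdiff (n + (m + 1))) hUo
      fun n t ht => (hU t ht).2 n)
  refine (DifferentiableOn.analyticAt ?_ (hUo.mem_nhds htU))
  refine hmain.congr fun t ht => ?_
  have hsm : Summable fun k => fourTerm (a t) (b t) (c t) (d t) (e t) (f t) (g t) k :=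
    (summable_nat_add_iff (m + 1)).mp (Summable.of_norm_bounded hsum (hU t ht).2)
  exact (hsm.sum_add_tsum_nat_add (m + 1)).symm

/-- No entry of `x` and no difference of two entries of `x` is an integer. -/
structure IsGeneric (x : Fin 7 → ℂ) : Prop where
  ne_int : ∀ i, ∀ n : ℤ, x i ≠ n
  sub_ne_int : ∀ i j, i ≠ j → ∀ n : ℤ, x i - x j ≠ n

theorem countable_setOf_affine_eq_int {α β : ℂ} (h : ∀ n : ℤ, α + β ≠ n) :
    {t : ℂ | ∃ n : ℤ, α + t * β = n}.Countable := by
  by_cases hβ : β = 0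
  · convert Set.countable_empty
    ext t
    simp only [hβ, mul_zero, add_zero, Set.mem_ofPred_eq, Set.mem_empty_iff_false, iff_false,
      not_exists] at h ⊢
    exact h
  · refine (Set.countable_range fun n : ℤ => ((n : ℂ) - α) / β).mono ?_
    rintro t ⟨n, hn⟩
    refine ⟨n, ?_⟩
    simp only
    rw [← hn]
    field_simp
    ring

theorem isClosed_setOf_eq_int {φ : ℂ → ℂ} (h : Continuous φ) :
    IsClosed {t : ℂ | ∃ n : ℤ, φ t = n} := by
  convert Complex.isClosed_range_intCast.preimage h using 1
  ext t
  simp [eq_comm]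

/-- The identity theorem along the complex line through `p` and `q`. -/
theorem eq_zero_of_eventually_eq_zero {p q : Fin 7 → ℂ} (hq : IsGeneric q)
    (Φ : (Fin 7 → ℂ) → ℂ)
    (han : ∀ t : ℂ, IsGeneric (fun i => p i + t * (q i - p i)) →
      AnalyticAt ℂ (fun t : ℂ => Φ (fun i => p i + t * (q i - p i))) t)
    (h0 : ∀ᶠ t in 𝓝 (0 : ℂ), IsGeneric (fun i => p i + t * (q i - p i)) →
      Φ (fun i => p i + t * (q i - p i)) = 0) : Φ q = 0 := by
  set P : ℂ → Fin 7 → ℂ := fun t i => p i + t * (q i - p i) with hP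
  have hP1 : P 1 = q := by ext i; simp [hP]
  set V : Set ℂ := (⋃ i, {t | ∃ n : ℤ, P t i = n}) ∪
    ⋃ i, ⋃ j, ⋃ (_ : i ≠ j), {t | ∃ n : ℤ, P t i - P t j = n} with hV
  have hmem : ∀ t, t ∈ Vᶜ ↔ IsGeneric (P t) := by
    intro t
    simp only [hV, Set.mem_compl_iff, Set.mem_union, Set.mem_iUnion, Set.mem_ofPred_eq, not_or,
      not_exists]
    exact ⟨fun h => ⟨h.1, h.2⟩, fun h => ⟨h.1, h.2⟩⟩
  have hcount : V.Countable := by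
    refine (Set.countable_iUnion fun i => ?_).union (Set.countable_iUnion fun i =>
      Set.countable_iUnion fun j => Set.countable_iUnion fun hij => ?_)
    · exact countable_setOf_affine_eq_int fun n hn => hq.ne_int i n (by rw [← hn]; ring)
    · refine (countable_setOf_affine_eq_int (α := p i - p j) (β := q i - p i - (q j - p j))
        fun n hn => hq.sub_ne_int i j hij n (by rw [← hn]; ring)).mono ?_
      rintro t ⟨n, hn⟩
      exact ⟨n, by rw [← hn]; simp only [hP]; ring⟩
  have hclosed : IsClosed V := by
    refine (isClosed_iUnion_of_finite fun i => ?_).union (isClosed_iUnion_of_finite fun i =>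
      isClosed_iUnion_of_finite fun j => isClosed_iUnion_of_finite fun hij => ?_)
    · exact isClosed_setOf_eq_int (φ := fun t => P t i) (by simp only [hP]; fun_prop)
    · exact isClosed_setOf_eq_int (φ := fun t => P t i - P t j) (by simp only [hP]; fun_prop)
  have hpre : IsPreconnected Vᶜ :=
    (hcount.isPathConnected_compl_of_one_lt_rank (by
      rw [Complex.rank_real_complex]; norm_num)).isConnected.isPreconnected
  obtain ⟨W, hW, hWo, h0W⟩ := eventually_nhds_iff.mp h0
  obtain ⟨z, hzW, hzV⟩ := (hcount.dense_compl ℝ).inter_open_nonempty W hWo ⟨0, h0W⟩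
  have han' : AnalyticOnNhd ℂ (fun t => Φ (P t)) Vᶜ := fun t ht => han t ((hmem t).mp ht)
  have := han'.eqOn_zero_of_preconnected_of_eventuallyEq_zero hpre hzV (by
    filter_upwards [hWo.mem_nhds hzW, hclosed.isOpen_compl.mem_nhds hzV] with t h1 h2
    exact hW t h1 ((hmem t).mp h2))
  have h1 : (1 : ℂ) ∈ Vᶜ := (hmem 1).mpr (by rw [hP1]; exact hq)
  have := this h1
  simpa [hP1] using this

theorem Sn_ne_zero {z : ℂ} (h : ∀ n : ℤ, z ≠ n) : Sn z ≠ 0 := by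
  rw [Sn, Complex.sin_ne_zero_iff]
  intro n hn
  have hpi : (Real.pi : ℂ) ≠ 0 := by exact_mod_cast Real.pi_ne_zero
  apply h n
  rw [mul_comm] at hn
  exact mul_right_cancel₀ hpi hn

theorem ne_neg_nat_of_ne_int {z : ℂ} (h : ∀ n : ℤ, z ≠ n) (m : ℕ) : z ≠ -m := by
  have := h (-m)
  push_cast at this
  exact this

theorem differentiable_Sn : Differentiable ℂ Sn := by
  unfold Sn
  fun_prop

theorem analyticAt_Lf {a b c d e f g : ℂ → ℂ} {t₀ : ℂ}
    (ha : Differentiable ℂ a) (hb : Differentiable ℂ b) (hc : Differentiable ℂ c)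
    (hd : Differentiable ℂ d) (he : Differentiable ℂ e) (hf : Differentiable ℂ f)
    (hg : Differentiable ℂ g) (hs : ∀ t, e t + f t + g t = a t + b t + c t + d t + 1)
    (ha0 : ∀ m : ℕ, a t₀ ≠ -m) (hb0 : ∀ m : ℕ, b t₀ ≠ -m)
    (hc0 : ∀ m : ℕ, c t₀ ≠ -m) (hd0 : ∀ m : ℕ, d t₀ ≠ -m)
    (ha1 : ∀ m : ℕ, 1 + a t₀ - e t₀ ≠ -m) (hb1 : ∀ m : ℕ, 1 + b t₀ - e t₀ ≠ -m)
    (hc1 : ∀ m : ℕ, 1 + c t₀ - e t₀ ≠ -m) (hd1 : ∀ m : ℕ, 1 + d t₀ - e t₀ ≠ -m)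
    (he0 : Sn (e t₀) ≠ 0) :
    AnalyticAt ℂ (fun t => Lf (a t) (b t) (c t) (d t) (e t) (f t) (g t)) t₀ := by
  have hI : ∀ {φ : ℂ → ℂ}, Differentiable ℂ φ →
      AnalyticAt ℂ (fun t => (Complex.Gamma (φ t))⁻¹) t₀ := fun {φ} h =>
    (Complex.differentiable_one_div_Gamma.comp h).analyticAt t₀
  have hS : AnalyticAt ℂ (fun t => (Sn (e t))⁻¹) t₀ :=
    ((differentiable_Sn.comp he).analyticAt t₀).inv he0
  have h1 := analyticAt_Fstar ha hb hc hd he hf hg hs ha0 hb0 hc0 hd0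
  have h2 := analyticAt_Fstar (a := fun t => 1 + a t - e t) (b := fun t => 1 + b t - e t)
    (c := fun t => 1 + c t - e t) (d := fun t => 1 + d t - e t) (e := fun t => 2 - e t)
    (f := fun t => 1 + f t - e t) (g := fun t => 1 + g t - e t) (t₀ := t₀) (by fun_prop)
    (by fun_prop) (by fun_prop) (by fun_prop) (by fun_prop) (by fun_prop) (by fun_prop)
    (fun t => by linear_combination hs t) ha1 hb1 hc1 hd1
  simp only [Lf, div_eq_mul_inv, mul_inv]
  exact (h1.sub h2).mul ((((((((hS.mul (hI ha)).mul (hI hb)).mul (hI hc)).mul (hI hd)).mul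
    (hI (by fun_prop))).mul (hI (by fun_prop))).mul (hI (by fun_prop))).mul (hI (by fun_prop)))

theorem IsGeneric.add_sub_ne_int {x : Fin 7 → ℂ} (h : IsGeneric x) (i j : Fin 7) (hij : i ≠ j)
    (k : ℤ) {z : ℂ} (hz : z = k + (x i - x j)) (n : ℤ) : z ≠ n := by
  intro hn
  apply h.sub_ne_int i j hij (n - k)
  push_cast
  linear_combination hn - hz

theorem eventually_abs_re_sub_lt (p q : Fin 7 → ℂ) {ε : ℝ} (hε : 0 < ε) :
    ∀ᶠ t in 𝓝 (0 : ℂ), ∀ i, |(p i + t * (q i - p i)).re - (p i).re| < ε := by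
  rw [eventually_all]
  intro i
  have hc : Continuous fun t : ℂ => |(p i + t * (q i - p i)).re - (p i).re| := by fun_prop
  exact hc.continuousAt.eventually (gt_mem_nhds (by simpa using hε))

theorem eq_zero_of_forall_near {r : Fin 7 → ℝ} {ε : ℝ} (hε : 0 < ε)
    (hr : r 4 + r 5 + r 6 = r 0 + r 1 + r 2 + r 3 + 1) (Φ : (Fin 7 → ℂ) → ℂ)
    (han : ∀ y : ℂ → Fin 7 → ℂ, (∀ i, Differentiable ℂ fun t => y t i) →
      (∀ t, y t 4 + y t 5 + y t 6 = y t 0 + y t 1 + y t 2 + y t 3 + 1) →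
      ∀ t, IsGeneric (y t) → AnalyticAt ℂ (fun t => Φ (y t)) t)
    (hnear : ∀ x : Fin 7 → ℂ, x 4 + x 5 + x 6 = x 0 + x 1 + x 2 + x 3 + 1 → IsGeneric x →
      (∀ i, |(x i).re - r i| < ε) → Φ x = 0)
    {x : Fin 7 → ℂ} (hs : x 4 + x 5 + x 6 = x 0 + x 1 + x 2 + x 3 + 1) (hx : IsGeneric x) :
    Φ x = 0 := by
  have hr' : (r 4 + r 5 + r 6 : ℂ) = r 0 + r 1 + r 2 + r 3 + 1 := by exact_mod_cast hr
  have hsum : ∀ t : ℂ, (r 4 + t * (x 4 - r 4)) + (r 5 + t * (x 5 - r 5)) +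
      (r 6 + t * (x 6 - r 6)) = (r 0 + t * (x 0 - r 0)) + (r 1 + t * (x 1 - r 1)) +
      (r 2 + t * (x 2 - r 2)) + (r 3 + t * (x 3 - r 3)) + 1 := fun t => by
    linear_combination t * hs + (1 - t) * hr'
  refine eq_zero_of_eventually_eq_zero (p := fun i => (r i : ℂ)) hx Φ ?_ ?_
  · exact fun t ht => han (fun t i => (r i : ℂ) + t * (x i - r i)) (fun i => by fun_prop) hsum t ht
  · filter_upwards [eventually_abs_re_sub_lt (fun i => (r i : ℂ)) x hε] with t ht hg
    exact hnear _ (hsum t) hg fun i => by simpa using ht i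

/-- A base point for `BaileyRegion`. -/
def baileyBase : Fin 7 → ℝ := ![3 / 10, 3 / 10, 3 / 10, 7 / 20, 13 / 20, 9 / 10, 7 / 10]

theorem Lf_dual_of_near {x : Fin 7 → ℂ} (hs : x 4 + x 5 + x 6 = x 0 + x 1 + x 2 + x 3 + 1)
    (hx : IsGeneric x) (h : ∀ i, |(x i).re - baileyBase i| < 1 / 200) :
    Lf (x 0) (x 1) (x 2) (x 3) (x 5) (x 4) (x 6) =
      Lf (x 4 - x 0) (x 4 - x 1) (x 4 - x 2) (x 4 - x 3) (1 + x 4 - x 6) (x 4)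
        (1 + x 4 - x 5) := by
  have h0 := abs_lt.mp (h 0)
  have h1 := abs_lt.mp (h 1)
  have h2 := abs_lt.mp (h 2)
  have h3 := abs_lt.mp (h 3)
  have h4 := abs_lt.mp (h 4)
  have h5 := abs_lt.mp (h 5)
  have h6 := abs_lt.mp (h 6)
  simp [baileyBase] at h0 h1 h2 h3 h4 h5 h6
  have s5 : Sn (x 5) ≠ 0 := Sn_ne_zero (hx.ne_int 5)
  have s23 : Sn (1 + x 2 - x 3) ≠ 0 :=
    Sn_ne_zero (hx.add_sub_ne_int 2 3 (by decide) 1 (by push_cast; ring))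
  have s46 : Sn (1 + (x 4 - x 3) - (x 6 - x 3)) ≠ 0 :=
    Sn_ne_zero (hx.add_sub_ne_int 4 6 (by decide) 1 (by push_cast; ring))
  apply Lf_dual_of_region
  · constructor <;> first | assumption | ((try simp); linarith)
  · constructor <;> first
      | assumption
      | linear_combination -hs
      | ((try simp); linarith)

theorem Lf_dual_of_isGeneric {x : Fin 7 → ℂ}
    (hs : x 4 + x 5 + x 6 = x 0 + x 1 + x 2 + x 3 + 1) (hx : IsGeneric x) :
    Lf (x 0) (x 1) (x 2) (x 3) (x 5) (x 4) (x 6) =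
      Lf (x 4 - x 0) (x 4 - x 1) (x 4 - x 2) (x 4 - x 3) (1 + x 4 - x 6) (x 4)
        (1 + x 4 - x 5) := by
  rw [← sub_eq_zero]
  refine eq_zero_of_forall_near (r := baileyBase) (ε := 1 / 200) (by norm_num)
    (by simp [baileyBase]; norm_num) (fun x => Lf (x 0) (x 1) (x 2) (x 3) (x 5) (x 4) (x 6) -
      Lf (x 4 - x 0) (x 4 - x 1) (x 4 - x 2) (x 4 - x 3) (1 + x 4 - x 6) (x 4)
        (1 + x 4 - x 5)) ?_ (fun x hs hx h => sub_eq_zero.mpr (Lf_dual_of_near hs hx h)) hs hx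
  intro y hyd hys t ht
  have s1 : ∀ i, ∀ m : ℕ, y t i ≠ -m := fun i => ne_neg_nat_of_ne_int (ht.ne_int i)
  have s2 : ∀ i j, i ≠ j → ∀ m : ℕ, y t i - y t j ≠ -m := fun i j hij =>
    ne_neg_nat_of_ne_int (ht.sub_ne_int i j hij)
  have s3 : ∀ i j, i ≠ j → ∀ m : ℕ, 1 + y t i - y t j ≠ -m := fun i j hij =>
    ne_neg_nat_of_ne_int (ht.add_sub_ne_int i j hij 1 (by push_cast; ring))
  have s4 : ∀ i j k, i ≠ j → ∀ m : ℕ, 1 + (y t k - y t j) - (1 + y t k - y t i) ≠ -m :=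
    fun i j k hij => ne_neg_nat_of_ne_int (ht.add_sub_ne_int i j hij 0 (by push_cast; ring))
  exact (analyticAt_Lf (hyd 0) (hyd 1) (hyd 2) (hyd 3) (hyd 5) (hyd 4) (hyd 6)
    (fun t => by linear_combination hys t) (s1 0) (s1 1) (s1 2) (s1 3)
    (s3 0 5 (by decide)) (s3 1 5 (by decide)) (s3 2 5 (by decide)) (s3 3 5 (by decide))
    (Sn_ne_zero (ht.ne_int 5))).sub
    (analyticAt_Lf (a := fun t => y t 4 - y t 0) (b := fun t => y t 4 - y t 1)
    (c := fun t => y t 4 - y t 2) (d := fun t => y t 4 - y t 3)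
    (e := fun t => 1 + y t 4 - y t 6) (g := fun t => 1 + y t 4 - y t 5)
    ((hyd 4).sub (hyd 0)) ((hyd 4).sub (hyd 1)) ((hyd 4).sub (hyd 2)) ((hyd 4).sub (hyd 3))
    (((hyd 4).const_add 1).sub (hyd 6)) (hyd 4) (((hyd 4).const_add 1).sub (hyd 5))
    (fun t => by linear_combination -hys t) (s2 4 0 (by decide)) (s2 4 1 (by decide))
    (s2 4 2 (by decide)) (s2 4 3 (by decide)) (s4 6 0 4 (by decide)) (s4 6 1 4 (by decide))
    (s4 6 2 4 (by decide)) (s4 6 3 4 (by decide))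
    (Sn_ne_zero (ht.add_sub_ne_int 4 6 (by decide) 1 (by push_cast; ring))))

/-- Bailey's transformation of `L` in the dual parameters. -/
theorem Lf_dual {a b c d e f g : ℂ} (hs : e + f + g = a + b + c + d + 1)
    (hx : IsGeneric ![a, b, c, d, e, f, g]) :
    Lf a b c d f e g = Lf (e - a) (e - b) (e - c) (e - d) (1 + e - g) e (1 + e - f) :=
  Lf_dual_of_isGeneric (x := ![a, b, c, d, e, f, g]) hs hx

theorem exists_between_exponents {σ τ : ℝ} (hσ : 0 < σ) (hτ : 0 < τ) (h : 1 < σ + τ) :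
    ∃ θ : ℝ, 0 ≤ θ ∧ θ ≤ 1 ∧ θ < σ ∧ 1 - τ < θ := by
  have h1 : max 0 (1 - τ) < min 1 σ := by
    simp only [max_lt_iff, lt_min_iff]
    refine ⟨⟨one_pos, ?_⟩, ?_, ?_⟩ <;> linarith
  obtain ⟨θ, h2, h3⟩ := exists_between h1
  simp only [max_lt_iff, lt_min_iff] at h2 h3
  exact ⟨θ, h2.1.le, h3.1.le, h3.2, h2.2⟩

theorem inv_one_add_abs_sub_le (k m : ℕ) {θ : ℝ} (h0 : 0 ≤ θ) (h1 : θ ≤ 1) :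
    (1 + |(k : ℝ) - m|)⁻¹ ≤ ((k : ℝ) + 1) ^ θ * ((m : ℝ) + 1) ^ (-θ) := by
  have hk : (0 : ℝ) < k + 1 := by positivity
  have hm : (0 : ℝ) < m + 1 := by positivity
  have ha : 0 ≤ |(k : ℝ) - m| := abs_nonneg _
  rw [Real.rpow_neg hm.le, ← div_eq_mul_inv, ← Real.div_rpow hk.le hm.le]
  have hd : 0 < ((k : ℝ) + 1) / (m + 1) := by positivity
  have key : (1 + |(k : ℝ) - m|)⁻¹ ≤ ((k : ℝ) + 1) / (m + 1) := by
    rw [inv_le_iff_one_le_mul₀ (by positivity), div_mul_eq_mul_div, le_div_iff₀ hm]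
    have := neg_abs_le ((k : ℝ) - m)
    have : (0 : ℝ) ≤ k * |(k : ℝ) - m| := by positivity
    nlinarith
  rcases le_total 1 (((k : ℝ) + 1) / (m + 1)) with h | h
  · exact (inv_le_one_of_one_le₀ (by linarith)).trans (Real.one_le_rpow h h0)
  · exact key.trans (by
      simpa using Real.rpow_le_rpow_of_exponent_ge hd h h1)

theorem inv_one_add_add_le (k m : ℕ) {θ : ℝ} (h0 : 0 ≤ θ) (h1 : θ ≤ 1) :
    (1 + (k : ℝ) + m)⁻¹ ≤ ((k : ℝ) + 1) ^ (-(1 - θ)) * ((m : ℝ) + 1) ^ (-θ) := by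
  have hk : (0 : ℝ) < k + 1 := by positivity
  have hm : (0 : ℝ) < m + 1 := by positivity
  have hs : (0 : ℝ) < 1 + (k : ℝ) + m := by positivity
  rw [Real.rpow_neg hk.le, Real.rpow_neg hm.le, ← mul_inv]
  refine inv_anti₀ (by positivity) ?_
  calc ((k : ℝ) + 1) ^ (1 - θ) * ((m : ℝ) + 1) ^ θ
      ≤ (1 + (k : ℝ) + m) ^ (1 - θ) * (1 + (k : ℝ) + m) ^ θ := by
        have hk0 : (0 : ℝ) ≤ k := k.cast_nonneg
        have hm0 : (0 : ℝ) ≤ m := m.cast_nonneg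
        exact mul_le_mul (Real.rpow_le_rpow hk.le (by linarith) (by linarith))
          (Real.rpow_le_rpow hm.le (by linarith) h0) (by positivity) (by positivity)
    _ = _ := by rw [← Real.rpow_add hs]; simp

theorem summable_prod_of_norm_le {F : ℕ × ℕ → ℂ} {C p q : ℝ} (hp : p < -1) (hq : q < -1)
    (h : ∀ k m : ℕ, ‖F (k, m)‖ ≤ C * (((k : ℝ) + 1) ^ p * ((m : ℝ) + 1) ^ q)) : Summable F :=
  Summable.of_norm_bounded (((summable_rpow_nat_add_one hp).mul_of_nonneg
    (summable_rpow_nat_add_one hq) (fun _ => by positivity) (fun _ => by positivity)).mul_left C)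
    fun x => h x.1 x.2

theorem summable_prod_same_side {α β : ℕ → ℂ} {x y s : ℂ} {C δ σ τ : ℝ} (hδ : 0 < δ) (hσ : 0 < σ)
    (hτ : 0 < τ) (hστ : 1 < σ + τ) (hα : ∀ k, ‖α k‖ ≤ C * ((k : ℝ) + 1) ^ (-σ))
    (hβ : ∀ k, ‖β k‖ ≤ C * ((k : ℝ) + 1) ^ (-τ))
    (hxy : ∀ k m : ℕ, δ * (1 + |(k : ℝ) - m|) ≤ ‖y + m - (x + k)‖)
    (hx : ∀ k : ℕ, δ * (k + 1) ≤ ‖s + (x + k)‖) :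
    Summable fun p : ℕ × ℕ => α p.1 / (s + (x + p.1)) * (β p.2 / (y + p.2 - (x + p.1))) := by
  obtain ⟨θ, h0, h1, h2, h3⟩ := exists_between_exponents hσ hτ hστ
  refine summable_prod_of_norm_le (C := C * C * δ⁻¹ * δ⁻¹) (p := -σ + θ - 1) (q := -τ - θ)
    (by linarith) (by linarith) fun k m => ?_
  have hk : (0 : ℝ) < k + 1 := by positivity
  have hm : (0 : ℝ) < m + 1 := by positivity
  have hC : 0 ≤ C * ((k : ℝ) + 1) ^ (-σ) := (norm_nonneg _).trans (hα k)
  have hC' : 0 ≤ C * ((m : ℝ) + 1) ^ (-τ) := (norm_nonneg _).trans (hβ m)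
  simp only [norm_mul, div_eq_mul_inv, norm_inv]
  calc _ ≤ (C * ((k : ℝ) + 1) ^ (-σ)) * (δ * ((k : ℝ) + 1))⁻¹ *
        ((C * ((m : ℝ) + 1) ^ (-τ)) * (δ * (1 + |(k : ℝ) - m|))⁻¹) := by
        gcongr
        · exact hα k
        · exact hx k
        · exact hβ m
        · exact hxy k m
    _ = (C * ((k : ℝ) + 1) ^ (-σ)) * (δ⁻¹ * ((k : ℝ) + 1)⁻¹) *
        ((C * ((m : ℝ) + 1) ^ (-τ)) * δ⁻¹) * (1 + |(k : ℝ) - m|)⁻¹ := by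
        rw [mul_inv, mul_inv]; ring
    _ ≤ (C * ((k : ℝ) + 1) ^ (-σ)) * (δ⁻¹ * ((k : ℝ) + 1)⁻¹) *
        ((C * ((m : ℝ) + 1) ^ (-τ)) * δ⁻¹) * (((k : ℝ) + 1) ^ θ * ((m : ℝ) + 1) ^ (-θ)) := by
        have := inv_one_add_abs_sub_le k m h0 h1
        gcongr
    _ = _ := by
        rw [sub_eq_add_neg (-σ + θ), Real.rpow_add hk, Real.rpow_add hk, sub_eq_add_neg (-τ),
          Real.rpow_add hm, Real.rpow_neg_one]
        ring

theorem summable_prod_opposite_side {α β : ℕ → ℂ} {x : ℂ} {C δ σ τ : ℝ} (hδ : 0 < δ) (hσ : 0 < σ)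
    (hτ : 0 < τ) (hστ : 1 < σ + τ) (hα : ∀ k, ‖α k‖ ≤ C * ((k : ℝ) + 1) ^ (-σ))
    (hβ : ∀ k, ‖β k‖ ≤ C * ((k : ℝ) + 1) ^ (-τ))
    (hx : ∀ k m : ℕ, δ * (1 + (k : ℝ) + m) ≤ ‖x + k + m‖) :
    Summable fun p : ℕ × ℕ => α p.1 * (β p.2 / (x + p.1 + p.2)) := by
  obtain ⟨θ, h0, h1, h2, h3⟩ := exists_between_exponents hσ hτ hστ
  refine summable_prod_of_norm_le (C := C * C * δ⁻¹) (p := -σ - (1 - θ)) (q := -τ - θ)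
    (by linarith) (by linarith) fun k m => ?_
  have hk : (0 : ℝ) < k + 1 := by positivity
  have hm : (0 : ℝ) < m + 1 := by positivity
  have hC : 0 ≤ C * ((k : ℝ) + 1) ^ (-σ) := (norm_nonneg _).trans (hα k)
  have hC' : 0 ≤ C * ((m : ℝ) + 1) ^ (-τ) := (norm_nonneg _).trans (hβ m)
  simp only [norm_mul, div_eq_mul_inv, norm_inv]
  calc _ ≤ (C * ((k : ℝ) + 1) ^ (-σ)) *
        ((C * ((m : ℝ) + 1) ^ (-τ)) * (δ * (1 + (k : ℝ) + m))⁻¹) := by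
        gcongr
        · exact hα k
        · exact hβ m
        · exact hx k m
    _ = (C * ((k : ℝ) + 1) ^ (-σ)) *
        ((C * ((m : ℝ) + 1) ^ (-τ)) * δ⁻¹) * (1 + (k : ℝ) + m)⁻¹ := by
        rw [mul_inv]; ring
    _ ≤ (C * ((k : ℝ) + 1) ^ (-σ)) *
        ((C * ((m : ℝ) + 1) ^ (-τ)) * δ⁻¹) *
          (((k : ℝ) + 1) ^ (-(1 - θ)) * ((m : ℝ) + 1) ^ (-θ)) := by
        have := inv_one_add_add_le k m h0 h1
        gcongr
    _ = _ := by
        rw [sub_eq_add_neg (-σ), Real.rpow_add hk, sub_eq_add_neg (-τ), Real.rpow_add hm]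
        ring

/-- The partial fraction expansion of a product of two partial fraction series. -/
theorem partialFraction_mul {α β : ℕ → ℂ} {x y s : ℂ} {C δ σ τ : ℝ} (hδ : 0 < δ) (hσ : 0 < σ)
    (hτ : 0 < τ) (hστ : 1 < σ + τ) (hα : ∀ k, ‖α k‖ ≤ C * ((k : ℝ) + 1) ^ (-σ))
    (hβ : ∀ k, ‖β k‖ ≤ C * ((k : ℝ) + 1) ^ (-τ))
    (hxy : ∀ k m : ℕ, δ * (1 + |(k : ℝ) - m|) ≤ ‖y + m - (x + k)‖)
    (hx : ∀ k : ℕ, δ * (k + 1) ≤ ‖s + (x + k)‖) (hy : ∀ k : ℕ, δ * (k + 1) ≤ ‖s + (y + k)‖) :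
    Summable (fun k : ℕ => α k / (s + (x + k)) * ∑' m : ℕ, β m / (y + m - (x + k))) ∧
    Summable (fun m : ℕ => β m / (s + (y + m)) * ∑' k : ℕ, α k / (x + k - (y + m))) ∧
    (∑' k : ℕ, α k / (s + (x + k))) * ∑' m : ℕ, β m / (s + (y + m)) =
      (∑' k : ℕ, α k / (s + (x + k)) * ∑' m : ℕ, β m / (y + m - (x + k))) +
        ∑' m : ℕ, β m / (s + (y + m)) * ∑' k : ℕ, α k / (x + k - (y + m)) := by
  have hs1 := summable_prod_same_side hδ hσ hτ hστ hα hβ hxy hx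
  have hs2 := summable_prod_same_side hδ hτ hσ (by linarith) hβ hα (x := y) (y := x) (s := s)
    (fun k m => by rw [abs_sub_comm, ← norm_neg, neg_sub]; exact hxy m k) hy
  have hs2' := (Equiv.prodComm ℕ ℕ).summable_iff.mpr hs2
  have ne1 : ∀ k m : ℕ, y + m - (x + k) ≠ 0 := fun k m h => by
    have h1 := hxy k m
    rw [h, norm_zero] at h1
    have : 0 < δ * (1 + |(k : ℝ) - m|) := by positivity
    linarith
  have ne2 : ∀ k : ℕ, s + (x + k) ≠ 0 := fun k h => by
    have h1 := hx k
    rw [h, norm_zero] at h1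
    have : 0 < δ * ((k : ℝ) + 1) := by positivity
    linarith
  have ne3 : ∀ k : ℕ, s + (y + k) ≠ 0 := fun k h => by
    have h1 := hy k
    rw [h, norm_zero] at h1
    have : 0 < δ * ((k : ℝ) + 1) := by positivity
    linarith
  have e1 : ∑' p : ℕ × ℕ, α p.1 / (s + (x + p.1)) * (β p.2 / (y + p.2 - (x + p.1))) =
      ∑' k : ℕ, α k / (s + (x + k)) * ∑' m : ℕ, β m / (y + m - (x + k)) := by
    rw [hs1.tsum_prod]
    exact tsum_congr fun k => by simp only [tsum_mul_left]
  have e2 : ∑' p : ℕ × ℕ, β p.1 / (s + (y + p.1)) * (α p.2 / (x + p.2 - (y + p.1))) =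
      ∑' m : ℕ, β m / (s + (y + m)) * ∑' k : ℕ, α k / (x + k - (y + m)) := by
    rw [hs2.tsum_prod]
    exact tsum_congr fun k => by simp only [tsum_mul_left]
  refine ⟨hs1.prod.congr fun k => by simp only [tsum_mul_left],
    hs2.prod.congr fun k => by simp only [tsum_mul_left], ?_⟩
  rw [← e1, ← e2, ← (Equiv.prodComm ℕ ℕ).tsum_eq (fun p : ℕ × ℕ => β p.1 / (s + (y + p.1)) * _)]
  refine Eq.trans ?_ (hs1.tsum_add hs2')
  have term : ∀ p : ℕ × ℕ, α p.1 / (s + (x + p.1)) * (β p.2 / (y + p.2 - (x + p.1))) +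
      ((fun p : ℕ × ℕ => β p.1 / (s + (y + p.1)) * (α p.2 / (x + p.2 - (y + p.1)))) ∘
        (Equiv.prodComm ℕ ℕ)) p = α p.1 / (s + (x + p.1)) * (β p.2 / (s + (y + p.2))) := by
    rintro ⟨k, m⟩
    have n1 := ne1 k m
    have n1' : x + k - (y + m) ≠ 0 := by rw [← neg_sub]; exact neg_ne_zero.mpr n1
    have n2 := ne2 k
    have n3 := ne3 m
    simp only [Function.comp, Equiv.prodComm_apply, Prod.swap_prod_mk]
    rw [show x + (k : ℂ) - (y + m) = -(y + m - (x + k)) by ring]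
    field_simp
    ring
  have hsum := (hs1.add hs2').congr fun p => (term p)
  have := hsum.tsum_prod
  refine Eq.trans ?_ ((tsum_congr term).symm)
  rw [this, ← tsum_mul_right]
  exact tsum_congr fun k => tsum_mul_left.symm

/-- The quotient `Γ(s+x)/Γ(s+y)`. -/
def gammaQuot (x y s : ℂ) : ℂ := Complex.Gamma (s + x) / Complex.Gamma (s + y)

/-- The coefficients of the partial fraction expansion of `gammaQuot x y`. -/
def gammaQuotCoeff (x y : ℂ) (k : ℕ) : ℂ :=
  Complex.Gamma (k + (1 + x - y)) /
    (k.factorial * (Complex.Gamma (1 + x - y) * Complex.Gamma (y - x)))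

theorem Sn_add_one (z : ℂ) : Sn (z + 1) = -Sn z := by
  rw [Sn, Sn, mul_add, mul_one, Complex.sin_add_pi]

theorem Sn_add_nat (z : ℂ) (n : ℕ) : Sn (z + n) = (-1) ^ n * Sn z := by
  induction n with
  | zero => simp
  | succ n ih =>
    rw [Nat.cast_add_one, ← add_assoc, Sn_add_one, ih, pow_succ]
    ring

theorem Sn_sub_nat (z : ℂ) (n : ℕ) : Sn (z - n) = (-1) ^ n * Sn z := by
  have := Sn_add_nat (z - n) n
  rw [sub_add_cancel] at this
  rw [this, ← mul_assoc, ← mul_pow]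
  simp

theorem Sn_neg (z : ℂ) : Sn (-z) = -Sn z := by
  rw [Sn, Sn, mul_neg, Complex.sin_neg]

theorem Sn_one_add (z : ℂ) : Sn (1 + z) = -Sn z := by
  rw [add_comm, Sn_add_one]

theorem Sn_one_sub (z : ℂ) : Sn (1 - z) = Sn z := by
  rw [sub_eq_add_neg, Sn_one_add, Sn_neg, neg_neg]

theorem ne_neg_nat_of_Sn_ne_zero {z : ℂ} (h : Sn z ≠ 0) (m : ℕ) : z ≠ -m := by
  rintro rfl
  apply h
  have := Sn_sub_nat 0 m
  simpa [Sn] using this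

theorem Gamma_ne_zero_of_Sn_ne_zero {z : ℂ} (h : Sn z ≠ 0) : Complex.Gamma z ≠ 0 :=
  Complex.Gamma_ne_zero (ne_neg_nat_of_Sn_ne_zero h)

theorem inv_Gamma_eq {z : ℂ} (h : Sn z ≠ 0) :
    (Complex.Gamma z)⁻¹ = Sn z / Real.pi * Complex.Gamma (1 - z) := by
  have h1 : Complex.Gamma (1 - z) ≠ 0 := Gamma_ne_zero_of_Sn_ne_zero (by rwa [Sn_one_sub])
  rw [← Gamma_mul_Gamma_one_sub' z, mul_assoc, inv_mul_cancel₀ h1, mul_one]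

theorem gammaQuot_neg {x y q : ℂ} (hx : Sn (x - q) ≠ 0) (hy : Sn (y - q) ≠ 0) (k : ℕ) :
    gammaQuot x y (-(q + k)) = Sn (y - q) / Sn (x - q) *
      (Complex.Gamma (k + (1 + q - y)) / Complex.Gamma (k + (1 + q - x))) := by
  have e1 : ∀ z : ℂ, -(q + k) + z = z - q - k := fun z => by ring
  have e2 : ∀ z : ℂ, 1 - (z - q - k) = k + (1 + q - z) := fun z => by ring
  have hs : ((-1 : ℂ) ^ k) ≠ 0 := pow_ne_zero _ (by norm_num)
  have hpi : (Real.pi : ℂ) ≠ 0 := by exact_mod_cast Real.pi_ne_zero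
  have hx' : Sn (x - q - k) ≠ 0 := by rw [Sn_sub_nat]; exact mul_ne_zero hs hx
  have hy' : Sn (y - q - k) ≠ 0 := by rw [Sn_sub_nat]; exact mul_ne_zero hs hy
  have i1 := inv_Gamma_eq hx'
  have i2 := inv_Gamma_eq hy'
  rw [e2, Sn_sub_nat] at i1 i2
  have g1 : Complex.Gamma (k + (1 + q - x)) ≠ 0 := by
    rw [← e2]; exact Gamma_ne_zero_of_Sn_ne_zero (by rwa [Sn_one_sub])
  rw [gammaQuot, e1, e1, div_eq_mul_inv, i2, ← inv_inv (Complex.Gamma (x - q - k)), i1]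
  field_simp

theorem gammaQuot_eq_tsum {x y s : ℂ} (h : 0 < (y - x).re) (hxy : Sn (y - x) ≠ 0)
    (hs : ∀ m : ℕ, s + x ≠ -m) :
    ∑' k : ℕ, gammaQuotCoeff x y k / (s + (x + k)) = gammaQuot x y s := by
  have h1 : Sn (1 + x - y) ≠ 0 := by
    rw [show 1 + x - y = 1 - (y - x) by ring, Sn_one_sub]; exact hxy
  have g := gauss_tsum (x := 1 + x - y) (y := s + x) (z := s + x + 1)
    (ne_neg_nat_of_Sn_ne_zero h1) hs (by
      rw [show s + x + 1 - (1 + x - y) - (s + x) = y - x by ring]; exact h)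
  rw [show s + x + 1 - (1 + x - y) - (s + x) = y - x by ring,
    show s + x + 1 - (1 + x - y) = s + y by ring, add_sub_cancel_left, Complex.Gamma_one,
    mul_one] at g
  have n1 := Gamma_ne_zero_of_Sn_ne_zero h1
  have n2 := Gamma_ne_zero_of_Sn_ne_zero hxy
  have : ∀ k : ℕ, gammaQuotCoeff x y k / (s + (x + k)) =
      Complex.Gamma (k + (1 + x - y)) * Complex.Gamma (k + (s + x)) /
        (k.factorial * Complex.Gamma (k + (s + x + 1))) *
        (Complex.Gamma (1 + x - y) * Complex.Gamma (y - x))⁻¹ := by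
    intro k
    have hk : s + x + k ≠ 0 := fun h => hs k (by linear_combination h)
    have hG : Complex.Gamma (k + (s + x)) ≠ 0 := by
      refine Complex.Gamma_ne_zero fun m hm => hs (m + k) ?_
      push_cast
      linear_combination hm
    rw [show (k : ℂ) + (s + x + 1) = k + (s + x) + 1 by ring,
      Complex.Gamma_add_one _ (by rwa [add_comm]), gammaQuotCoeff]
    have hk' : s + (x + k) ≠ 0 := by rwa [← add_assoc]
    have hk'' : k + (s + x) ≠ 0 := by rwa [add_comm]
    have := k.factorial_ne_zero
    field_simp
    ring
  rw [tsum_congr this, tsum_mul_right, g, gammaQuot]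
  field_simp

/-- `α k = O((k+1)^(-σ))`. -/
def HasDecay (α : ℕ → ℂ) (σ : ℝ) : Prop := ∃ C > 0, ∀ k : ℕ, ‖α k‖ ≤ C * ((k : ℝ) + 1) ^ (-σ)

/-- The points `-(x+k)` are uniformly separated from the points `-(y+m)`. -/
def IsSeparated (x y : ℂ) : Prop :=
  ∃ δ > 0, ∀ k m : ℕ, δ * (1 + |(k : ℝ) - m|) ≤ ‖y + m - (x + k)‖

/-- `s` stays away from the points `-(x+k)`. -/
def IsAway (s x : ℂ) : Prop := ∃ δ > 0, ∀ k : ℕ, δ * ((k : ℝ) + 1) ≤ ‖s + (x + k)‖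

theorem HasDecay.mul {α β : ℕ → ℂ} {σ τ : ℝ} (hα : HasDecay α σ) (hβ : HasDecay β τ) :
    HasDecay (fun k => α k * β k) (σ + τ) := by
  obtain ⟨C, hC, h⟩ := hα
  obtain ⟨D, hD, h'⟩ := hβ
  refine ⟨C * D, mul_pos hC hD, fun k => ?_⟩
  have hk : (0 : ℝ) < k + 1 := by positivity
  rw [norm_mul, neg_add, Real.rpow_add hk]
  calc _ ≤ (C * ((k : ℝ) + 1) ^ (-σ)) * (D * ((k : ℝ) + 1) ^ (-τ)) := by
        gcongr
        · exact h k
        · exact h' k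
    _ = _ := by ring

theorem hasDecay_gammaQuotCoeff (x y : ℂ) : HasDecay (gammaQuotCoeff x y) (y - x).re := by
  obtain ⟨C, hC, h⟩ := exists_norm_Gamma_div_Gamma_le (1 + x - y) 1
  refine ⟨C * (‖(Complex.Gamma (1 + x - y) * Complex.Gamma (y - x))⁻¹‖ + 1), by positivity,
    fun k => ?_⟩
  have := h k
  rw [Complex.Gamma_nat_eq_factorial, show (1 + x - y - 1).re = -(y - x).re by simp; ring] at this
  rw [gammaQuotCoeff, ← div_div, div_eq_mul_inv, norm_mul]
  calc _ ≤ (C * ((k : ℝ) + 1) ^ (-(y - x).re)) * (‖(Complex.Gamma (1 + x - y) *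
        Complex.Gamma (y - x))⁻¹‖ + 1) := by
        gcongr
        linarith
    _ = _ := by ring

theorem hasDecay_gammaQuot_neg {x y q : ℂ} (hx : Sn (x - q) ≠ 0) (hy : Sn (y - q) ≠ 0) :
    HasDecay (fun k => gammaQuot x y (-(q + k))) (y - x).re := by
  obtain ⟨C, hC, h⟩ := exists_norm_Gamma_div_Gamma_le (1 + q - y) (1 + q - x)
  refine ⟨(‖Sn (y - q) / Sn (x - q)‖ + 1) * C, by positivity, fun k => ?_⟩
  have := h k
  rw [show (1 + q - y - (1 + q - x)).re = -(y - x).re by simp] at this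
  simp only [gammaQuot_neg hx hy, norm_mul, mul_assoc]
  gcongr
  linarith

theorem isSeparated_of_re {x y : ℂ} (h0 : 0 < (y - x).re) (h1 : (y - x).re < 1) :
    IsSeparated x y := by
  refine ⟨min (y - x).re ((1 - (y - x).re) / 2), by
    rw [gt_iff_lt, lt_min_iff]; constructor <;> linarith, fun k m => ?_⟩
  refine le_trans ?_ (Complex.abs_re_le_norm _)
  set ρ := (y - x).re with hρ
  rw [show (y + m - (x + k)).re = ρ + ((m : ℝ) - k) by simp [hρ]; ring]
  have l1 := min_le_left ρ ((1 - ρ) / 2)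
  have l2 := min_le_right ρ ((1 - ρ) / 2)
  set δ := min ρ ((1 - ρ) / 2)
  rcases le_or_gt k m with h | h
  · have hkm : (k : ℝ) ≤ m := by exact_mod_cast h
    rw [abs_of_nonpos (by linarith)]
    refine le_trans ?_ (le_abs_self _)
    nlinarith
  · have hkm : (m : ℝ) + 1 ≤ k := by exact_mod_cast h
    rw [abs_of_nonneg (by linarith)]
    refine le_trans ?_ (neg_le_abs _)
    nlinarith

theorem IsSeparated.symm {x y : ℂ} (h : IsSeparated x y) : IsSeparated y x := by
  obtain ⟨δ, hδ, h⟩ := h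
  refine ⟨δ, hδ, fun k m => ?_⟩
  rw [abs_sub_comm, ← norm_neg, neg_sub]
  exact h m k

theorem IsSeparated.isAway {x y : ℂ} (h : IsSeparated x y) (m : ℕ) : IsAway (-(y + m)) x := by
  obtain ⟨δ, hδ, h⟩ := h
  refine ⟨δ / (m + 1), by positivity, fun k => ?_⟩
  rw [← norm_neg, show -(-(y + m) + (x + k)) = y + m - (x + k) by ring]
  refine le_trans ?_ (h k m)
  rw [div_mul_eq_mul_div, mul_div_assoc]
  refine mul_le_mul_of_nonneg_left ?_ hδ.le
  rw [div_le_iff₀ (by positivity)]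
  have := le_abs_self ((k : ℝ) - m)
  have : (0 : ℝ) ≤ m * |(k : ℝ) - m| := by positivity
  nlinarith

theorem le_norm_add_nat (z : ℂ) (k : ℕ) : min 1 z.re * ((k : ℝ) + 1) ≤ ‖z + k‖ := by
  refine le_trans ?_ ((le_abs_self _).trans (Complex.abs_re_le_norm _))
  have l1 := min_le_left 1 z.re
  have l2 := min_le_right 1 z.re
  have : (0 : ℝ) ≤ k := k.cast_nonneg
  simp
  nlinarith

theorem isAway_of_re {s x : ℂ} (h : 0 < (s + x).re) : IsAway s x :=
  ⟨min 1 (s + x).re, by simpa using h, fun k => by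
    rw [← add_assoc]; exact le_norm_add_nat _ k⟩

theorem partialFraction_mul' {α β : ℕ → ℂ} {x y s : ℂ} {σ τ : ℝ} (hσ : 0 < σ)
    (hτ : 0 < τ) (hστ : 1 < σ + τ) (hα : HasDecay α σ) (hβ : HasDecay β τ)
    (hxy : IsSeparated x y) (hx : IsAway s x) (hy : IsAway s y) :
    Summable (fun k : ℕ => α k / (s + (x + k)) * ∑' m : ℕ, β m / (-(x + k) + (y + m))) ∧
    Summable (fun m : ℕ => β m / (s + (y + m)) * ∑' k : ℕ, α k / (-(y + m) + (x + k))) ∧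
    (∑' k : ℕ, α k / (s + (x + k))) * ∑' m : ℕ, β m / (s + (y + m)) =
      (∑' k : ℕ, α k / (s + (x + k)) * ∑' m : ℕ, β m / (-(x + k) + (y + m))) +
        ∑' m : ℕ, β m / (s + (y + m)) * ∑' k : ℕ, α k / (-(y + m) + (x + k)) := by
  obtain ⟨C, hC, hα⟩ := hα
  obtain ⟨D, hD, hβ⟩ := hβ
  obtain ⟨δ₁, h1, hxy⟩ := hxy
  obtain ⟨δ₂, h2, hx⟩ := hx
  obtain ⟨δ₃, h3, hy⟩ := hy
  simp only [neg_add_eq_sub]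
  have e1 : min δ₁ (min δ₂ δ₃) ≤ δ₁ := min_le_left _ _
  have e2 : min δ₁ (min δ₂ δ₃) ≤ δ₂ := (min_le_right _ _).trans (min_le_left _ _)
  have e3 : min δ₁ (min δ₂ δ₃) ≤ δ₃ := (min_le_right _ _).trans (min_le_right _ _)
  refine partialFraction_mul (C := max C D) (δ := min δ₁ (min δ₂ δ₃)) (by simp [h1, h2, h3]) hσ hτ
    hστ (fun k => (hα k).trans ?_) (fun k => (hβ k).trans ?_)
    (fun k m => le_trans ?_ (hxy k m)) (fun k => le_trans ?_ (hx k)) fun k => le_trans ?_ (hy k)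
  · gcongr; exact le_max_left _ _
  · gcongr; exact le_max_right _ _
  all_goals gcongr

theorem IsAway.ne {s x : ℂ} (h : IsAway s x) (m : ℕ) : s + x ≠ -m := by
  obtain ⟨δ, hδ, h⟩ := h
  intro h0
  have h1 := h m
  rw [← add_assoc, h0, neg_add_cancel, norm_zero] at h1
  have : 0 < δ * ((m : ℝ) + 1) := by positivity
  linarith

theorem gammaQuot_mul {x₁ y₁ x₂ y₂ s : ℂ} (h₁ : 0 < (y₁ - x₁).re) (h₂ : 0 < (y₂ - x₂).re)
    (h : 1 < (y₁ - x₁).re + (y₂ - x₂).re) (hs₁ : Sn (y₁ - x₁) ≠ 0) (hs₂ : Sn (y₂ - x₂) ≠ 0)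
    (h12 : IsSeparated x₁ x₂) (ha₁ : IsAway s x₁) (ha₂ : IsAway s x₂) :
    gammaQuot x₁ y₁ s * gammaQuot x₂ y₂ s =
      (∑' k : ℕ, gammaQuotCoeff x₁ y₁ k * gammaQuot x₂ y₂ (-(x₁ + k)) / (s + (x₁ + k))) +
      ∑' k : ℕ, gammaQuotCoeff x₂ y₂ k * gammaQuot x₁ y₁ (-(x₂ + k)) / (s + (x₂ + k)) := by
  have := (partialFraction_mul' h₁ h₂ h (hasDecay_gammaQuotCoeff x₁ y₁)
    (hasDecay_gammaQuotCoeff x₂ y₂) h12 ha₁ ha₂).2.2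
  rw [gammaQuot_eq_tsum h₁ hs₁ ha₁.ne, gammaQuot_eq_tsum h₂ hs₂ ha₂.ne] at this
  rw [this]
  congr 1
  · refine tsum_congr fun k => ?_
    rw [gammaQuot_eq_tsum h₂ hs₂ (h12.symm.isAway k).ne, div_mul_eq_mul_div]
  · refine tsum_congr fun k => ?_
    rw [gammaQuot_eq_tsum h₁ hs₁ (h12.isAway k).ne, div_mul_eq_mul_div]

/-- The residue at `-(x₁+k)` of `gammaQuot x₁ y₁ * gammaQuot x₂ y₂ * gammaQuot x₃ y₃`. -/
def residueCoeff (x₁ y₁ x₂ y₂ x₃ y₃ : ℂ) (k : ℕ) : ℂ :=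
  gammaQuotCoeff x₁ y₁ k * gammaQuot x₂ y₂ (-(x₁ + k)) * gammaQuot x₃ y₃ (-(x₁ + k))

theorem hasDecay_residueCoeff {x₁ y₁ x₂ y₂ x₃ y₃ : ℂ} (hx₂ : Sn (x₂ - x₁) ≠ 0)
    (hy₂ : Sn (y₂ - x₁) ≠ 0) (hx₃ : Sn (x₃ - x₁) ≠ 0) (hy₃ : Sn (y₃ - x₁) ≠ 0) :
    HasDecay (residueCoeff x₁ y₁ x₂ y₂ x₃ y₃)
      ((y₁ - x₁).re + (y₂ - x₂).re + (y₃ - x₃).re) :=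
  ((hasDecay_gammaQuotCoeff x₁ y₁).mul (hasDecay_gammaQuot_neg hx₂ hy₂)).mul
    (hasDecay_gammaQuot_neg hx₃ hy₃)

theorem gammaQuot_mul_mul {x₁ y₁ x₂ y₂ x₃ y₃ s : ℂ} (h₁ : 0 < (y₁ - x₁).re)
    (h₂ : 0 < (y₂ - x₂).re) (h₃ : 0 < (y₃ - x₃).re) (h : 1 < (y₁ - x₁).re + (y₂ - x₂).re)
    (hs₁ : Sn (y₁ - x₁) ≠ 0) (hs₂ : Sn (y₂ - x₂) ≠ 0) (hs₃ : Sn (y₃ - x₃) ≠ 0)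
    (hx12 : Sn (x₂ - x₁) ≠ 0) (hy12 : Sn (y₂ - x₁) ≠ 0) (hy21 : Sn (y₁ - x₂) ≠ 0)
    (h12 : IsSeparated x₁ x₂) (h13 : IsSeparated x₁ x₃) (h23 : IsSeparated x₂ x₃)
    (ha₁ : IsAway s x₁) (ha₂ : IsAway s x₂) (ha₃ : IsAway s x₃) :
    gammaQuot x₁ y₁ s * gammaQuot x₂ y₂ s * gammaQuot x₃ y₃ s =
      (∑' k : ℕ, residueCoeff x₁ y₁ x₂ y₂ x₃ y₃ k / (s + (x₁ + k))) +
      (∑' k : ℕ, residueCoeff x₂ y₂ x₁ y₁ x₃ y₃ k / (s + (x₂ + k))) +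
      ∑' k : ℕ, residueCoeff x₃ y₃ x₁ y₁ x₂ y₂ k / (s + (x₃ + k)) := by
  have hx21 : Sn (x₁ - x₂) ≠ 0 := by rw [← neg_sub, Sn_neg]; exact neg_ne_zero.mpr hx12
  obtain ⟨-, s₁, e₁⟩ := partialFraction_mul' (σ := (y₁ - x₁).re + (y₂ - x₂).re) (by linarith) h₃
    (by linarith) ((hasDecay_gammaQuotCoeff x₁ y₁).mul (hasDecay_gammaQuot_neg hx12 hy12))
    (hasDecay_gammaQuotCoeff x₃ y₃) h13 ha₁ ha₃
  obtain ⟨-, s₂, e₂⟩ := partialFraction_mul' (σ := (y₂ - x₂).re + (y₁ - x₁).re) (by linarith) h₃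
    (by linarith) ((hasDecay_gammaQuotCoeff x₂ y₂).mul (hasDecay_gammaQuot_neg hx21 hy21))
    (hasDecay_gammaQuotCoeff x₃ y₃) h23 ha₂ ha₃
  rw [gammaQuot_mul h₁ h₂ h hs₁ hs₂ h12 ha₁ ha₂, ← gammaQuot_eq_tsum h₃ hs₃ ha₃.ne, add_mul, e₁,
    e₂, add_add_add_comm, ← s₁.tsum_add s₂]
  congr 1
  · congr 1
    · refine tsum_congr fun k => ?_
      rw [gammaQuot_eq_tsum h₃ hs₃ (h13.symm.isAway k).ne, residueCoeff, div_mul_eq_mul_div]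
    · refine tsum_congr fun k => ?_
      rw [gammaQuot_eq_tsum h₃ hs₃ (h23.symm.isAway k).ne, residueCoeff, div_mul_eq_mul_div]
  · refine tsum_congr fun k => ?_
    rw [← mul_add, ← gammaQuot_mul h₁ h₂ h hs₁ hs₂ h12 (h13.isAway k) (h23.isAway k),
      residueCoeff]
    ring

theorem tsum_swap_gammaQuot {r : ℕ → ℂ} {σ : ℝ} (hσ : 1 < σ) (hr : HasDecay r σ) {a g x : ℂ}
    (hag : 0 < (g - a).re) (hs : Sn (g - a) ≠ 0) (hax : 0 < (x + a).re) :
    (Summable fun j : ℕ => gammaQuotCoeff a g j * ∑' k : ℕ, r k / (a + j + (x + k))) ∧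
    ∑' j : ℕ, gammaQuotCoeff a g j * ∑' k : ℕ, r k / (a + j + (x + k)) =
      ∑' k : ℕ, r k * gammaQuot a g (x + k) := by
  obtain ⟨C, hC, hr'⟩ := hr
  obtain ⟨D, hD, hu⟩ := hasDecay_gammaQuotCoeff a g
  have hsum : Summable fun p : ℕ × ℕ => r p.1 * (gammaQuotCoeff a g p.2 / (x + a + p.1 + p.2)) := by
    refine summable_prod_opposite_side (C := max C D) (δ := min 1 (x + a).re) (σ := σ)
      (τ := (g - a).re) ?_ (by linarith) hag (by linarith) (fun k => (hr' k).trans ?_)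
      (fun k => (hu k).trans ?_) fun k m => ?_
    · simpa using hax
    · gcongr; exact le_max_left _ _
    · gcongr; exact le_max_right _ _
    · have := le_norm_add_nat (x + a) (k + m)
      rw [Nat.cast_add, Nat.cast_add, ← add_assoc] at this
      rw [add_assoc 1, add_comm (1 : ℝ)]
      exact this
  have hsum' : Summable fun p : ℕ × ℕ =>
    r p.2 * (gammaQuotCoeff a g p.1 / (x + a + p.2 + p.1)) := hsum.prod_symm
  have e1 : ∀ j : ℕ, gammaQuotCoeff a g j * ∑' k : ℕ, r k / (a + j + (x + k)) =
      ∑' k : ℕ, r k * (gammaQuotCoeff a g j / (x + a + k + j)) := by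
    intro j
    rw [← tsum_mul_left]
    refine tsum_congr fun k => ?_
    rw [show a + j + (x + k) = x + a + k + j by ring]
    ring
  have e2 : ∀ k : ℕ, r k * gammaQuot a g (x + k) =
      ∑' j : ℕ, r k * (gammaQuotCoeff a g j / (x + a + k + j)) := by
    intro k
    rw [tsum_mul_left, ← gammaQuot_eq_tsum hag hs fun m h => ?_]
    · congr 1
      refine tsum_congr fun j => ?_
      rw [show x + a + k + j = x + k + (a + j) by ring]
    · have := congrArg Complex.re h
      simp only [Complex.add_re, Complex.neg_re, Complex.natCast_re] at this hax
      have h1 : (0 : ℝ) ≤ k := k.cast_nonneg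
      have h2 : (0 : ℝ) ≤ m := m.cast_nonneg
      linarith
  rw [tsum_congr e1, tsum_congr e2, summable_congr e1]
  exact ⟨hsum'.prod, hsum.tsum_comm⟩

theorem gammaQuotCoeff_eq (x y : ℂ) (k : ℕ) :
    gammaQuotCoeff x y k =
      Sn (y - x) / Real.pi * (Complex.Gamma (k + (1 + x - y)) / k.factorial) := by
  rw [← Gamma_mul_Gamma_one_sub', show 1 - (y - x) = 1 + x - y by ring, gammaQuotCoeff,
    ← mul_inv, ← div_div, div_eq_mul_inv, mul_comm, mul_comm (Complex.Gamma (y - x))]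

theorem residueCoeff_mul_gammaQuot {x₁ y₁ x₂ y₂ x₃ y₃ : ℂ} (hx₂ : Sn (x₂ - x₁) ≠ 0)
    (hy₂ : Sn (y₂ - x₁) ≠ 0) (hx₃ : Sn (x₃ - x₁) ≠ 0) (hy₃ : Sn (y₃ - x₁) ≠ 0) (a g : ℂ) (k : ℕ) :
    residueCoeff x₁ y₁ x₂ y₂ x₃ y₃ k * gammaQuot a g (x₁ + k) =
      Sn (y₁ - x₁) * Sn (y₂ - x₁) * Sn (y₃ - x₁) / (Real.pi * (Sn (x₂ - x₁) * Sn (x₃ - x₁))) *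
        fourTerm (x₁ + a) (1 + x₁ - y₁) (1 + x₁ - y₂) (1 + x₁ - y₃) (1 + x₁ - x₂) (1 + x₁ - x₃)
          (x₁ + g) k := by
  rw [residueCoeff, gammaQuotCoeff_eq, gammaQuot_neg hx₂ hy₂, gammaQuot_neg hx₃ hy₃, gammaQuot,
    fourTerm, show x₁ + k + a = k + (x₁ + a) by ring, show x₁ + k + g = k + (x₁ + g) by ring]
  simp only [div_eq_mul_inv, mul_inv]
  ring

theorem Fstar_four_term_of_re {x₁ y₁ x₂ y₂ x₃ y₃ a g : ℂ} (h₁ : 0 < (y₁ - x₁).re)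
    (h₂ : 0 < (y₂ - x₂).re) (h₃ : 0 < (y₃ - x₃).re) (h : 1 < (y₁ - x₁).re + (y₂ - x₂).re)
    (hag : 0 < (g - a).re) (ha₁ : 0 < (x₁ + a).re) (ha₂ : 0 < (x₂ + a).re)
    (ha₃ : 0 < (x₃ + a).re) (h12 : IsSeparated x₁ x₂) (h13 : IsSeparated x₁ x₃)
    (h23 : IsSeparated x₂ x₃) (hga : Sn (g - a) ≠ 0)
    (y11 : Sn (y₁ - x₁) ≠ 0) (y12 : Sn (y₁ - x₂) ≠ 0) (y13 : Sn (y₁ - x₃) ≠ 0)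
    (y21 : Sn (y₂ - x₁) ≠ 0) (y22 : Sn (y₂ - x₂) ≠ 0) (y23 : Sn (y₂ - x₃) ≠ 0)
    (y31 : Sn (y₃ - x₁) ≠ 0) (y32 : Sn (y₃ - x₂) ≠ 0) (y33 : Sn (y₃ - x₃) ≠ 0)
    (x12 : Sn (x₁ - x₂) ≠ 0) (x13 : Sn (x₁ - x₃) ≠ 0) (x23 : Sn (x₂ - x₃) ≠ 0) :
    Sn (g - a) * Fstar (1 + a - g) (x₁ + a) (x₂ + a) (x₃ + a) (y₁ + a) (y₂ + a) (y₃ + a) =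
      Sn (y₁ - x₁) * Sn (y₂ - x₁) * Sn (y₃ - x₁) / (Sn (x₂ - x₁) * Sn (x₃ - x₁)) *
        Fstar (x₁ + a) (1 + x₁ - y₁) (1 + x₁ - y₂) (1 + x₁ - y₃) (1 + x₁ - x₂) (1 + x₁ - x₃)
          (x₁ + g) +
      Sn (y₂ - x₂) * Sn (y₁ - x₂) * Sn (y₃ - x₂) / (Sn (x₁ - x₂) * Sn (x₃ - x₂)) *
        Fstar (x₂ + a) (1 + x₂ - y₂) (1 + x₂ - y₁) (1 + x₂ - y₃) (1 + x₂ - x₁) (1 + x₂ - x₃)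
          (x₂ + g) +
      Sn (y₃ - x₃) * Sn (y₁ - x₃) * Sn (y₂ - x₃) / (Sn (x₁ - x₃) * Sn (x₂ - x₃)) *
        Fstar (x₃ + a) (1 + x₃ - y₃) (1 + x₃ - y₁) (1 + x₃ - y₂) (1 + x₃ - x₁) (1 + x₃ - x₂)
          (x₃ + g) := by
  have hneg : ∀ {u v : ℂ}, Sn (u - v) ≠ 0 → Sn (v - u) ≠ 0 := fun {u v} h => by
    rw [← neg_sub, Sn_neg]; exact neg_ne_zero.mpr h
  have hpi : (Real.pi : ℂ) ≠ 0 := by exact_mod_cast Real.pi_ne_zero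
  have x21 := hneg x12
  have x31 := hneg x13
  have x32 := hneg x23
  have away : ∀ {x : ℂ}, 0 < (x + a).re → ∀ j : ℕ, IsAway (a + j) x := fun {x} hx j =>
    isAway_of_re (by
      simp only [Complex.add_re, Complex.natCast_re] at hx ⊢
      have : (0 : ℝ) ≤ j := j.cast_nonneg
      linarith)
  obtain ⟨s₁, e₁⟩ := tsum_swap_gammaQuot (by linarith)
    (hasDecay_residueCoeff (y₁ := y₁) x21 y21 x31 y31) hag hga ha₁
  obtain ⟨s₂, e₂⟩ := tsum_swap_gammaQuot (by linarith)
    (hasDecay_residueCoeff (y₁ := y₂) x12 y12 x32 y32) hag hga ha₂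
  obtain ⟨s₃, e₃⟩ := tsum_swap_gammaQuot (by linarith)
    (hasDecay_residueCoeff (y₁ := y₃) x13 y13 x23 y23) hag hga ha₃
  have hF : ∀ a b c d e f g : ℂ, ∑' k, fourTerm a b c d e f g k = Fstar a b c d e f g :=
    fun _ _ _ _ _ _ _ => rfl
  simp only [residueCoeff_mul_gammaQuot x21 y21 x31 y31, tsum_mul_left, hF] at e₁
  simp only [residueCoeff_mul_gammaQuot x12 y12 x32 y32, tsum_mul_left, hF] at e₂
  simp only [residueCoeff_mul_gammaQuot x13 y13 x23 y23, tsum_mul_left, hF] at e₃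
  have key : ∑' j : ℕ, gammaQuotCoeff a g j * (gammaQuot x₁ y₁ (a + j) * gammaQuot x₂ y₂ (a + j) *
      gammaQuot x₃ y₃ (a + j)) = Sn (g - a) / Real.pi *
      Fstar (1 + a - g) (x₁ + a) (x₂ + a) (x₃ + a) (y₁ + a) (y₂ + a) (y₃ + a) := by
    rw [Fstar, ← tsum_mul_left]
    refine tsum_congr fun j => ?_
    have e : ∀ z : ℂ, a + j + z = j + (z + a) := fun z => by ring
    rw [gammaQuotCoeff_eq]
    simp only [gammaQuot, e, div_eq_mul_inv, mul_inv]
    ring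
  rw [tsum_congr fun j => by
    rw [gammaQuot_mul_mul h₁ h₂ h₃ h y11 y22 y33 x21 y21 y12 h12 h13 h23 (away ha₁ j)
      (away ha₂ j) (away ha₃ j), mul_add, mul_add], (s₁.add s₂).tsum_add s₃, s₁.tsum_add s₂,
    e₁, e₂, e₃] at key
  refine mul_left_cancel₀ (inv_ne_zero hpi) ?_
  linear_combination -key

theorem Fstar_swap_ab (a b c d e f g : ℂ) : Fstar a b c d e f g = Fstar b a c d e f g := by
  rw [Fstar, Fstar]
  exact tsum_congr fun k => by rw [mul_comm (Complex.Gamma (k + a))]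

theorem Fstar_swap_bc (a b c d e f g : ℂ) : Fstar a b c d e f g = Fstar a c b d e f g := by
  rw [Fstar, Fstar]
  exact tsum_congr fun k => by rw [mul_right_comm (Complex.Gamma (k + a))]

theorem Fstar_swap_cd (a b c d e f g : ℂ) : Fstar a b c d e f g = Fstar a b d c e f g := by
  rw [Fstar, Fstar]
  exact tsum_congr fun k => by rw [mul_right_comm _ (Complex.Gamma (k + c))]

theorem Fstar_rotate_bcd (a b c d e f g : ℂ) : Fstar a b c d e f g = Fstar a c d b e f g := by
  rw [Fstar_swap_bc, Fstar_swap_cd]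

theorem Fstar_rotate_abcd (a b c d e f g : ℂ) : Fstar a b c d e f g = Fstar b c d a e f g := by
  rw [Fstar_swap_ab, Fstar_rotate_bcd]

theorem Fstar_swap_ef (a b c d e f g : ℂ) : Fstar a b c d e f g = Fstar a b c d f e g := by
  rw [Fstar, Fstar]
  exact tsum_congr fun k => by rw [mul_right_comm (k.factorial : ℂ)]

theorem Fstar_swap_fg (a b c d e f g : ℂ) : Fstar a b c d e f g = Fstar a b c d e g f := by
  rw [Fstar, Fstar]
  exact tsum_congr fun k => by rw [mul_right_comm _ (Complex.Gamma (k + f))]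

/-- The defect of the four-term relation between Saalschützian series. -/
def fourTermDefect (x : Fin 7 → ℂ) : ℂ :=
  Sn (x 4 - x 5) * (Sn (x 1) * Sn (x 2) * Sn (x 3)) *
      Fstar (x 0) (x 1) (x 2) (x 3) (x 4) (x 5) (x 6) -
    Sn (x 5) * (Sn (x 4 - x 1) * Sn (x 4 - x 2) * Sn (x 4 - x 3)) *
      Fstar (1 + x 0 - x 4) (1 + x 1 - x 4) (1 + x 2 - x 4) (1 + x 3 - x 4) (2 - x 4)
        (1 + x 5 - x 4) (1 + x 6 - x 4) +
    Sn (x 4) * (Sn (x 5 - x 1) * Sn (x 5 - x 2) * Sn (x 5 - x 3)) *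
      Fstar (1 + x 0 - x 5) (1 + x 1 - x 5) (1 + x 2 - x 5) (1 + x 3 - x 5) (2 - x 5)
        (1 + x 4 - x 5) (1 + x 6 - x 5) -
    Sn (x 4) * Sn (x 5) * Sn (x 4 - x 5) * Sn (x 6 - x 0) *
      Fstar (x 0) (1 + x 0 - x 4) (1 + x 0 - x 5) (1 + x 0 - x 6) (1 + x 0 - x 1)
        (1 + x 0 - x 2) (1 + x 0 - x 3)

/-- A base point in the region of convergence of the four-term relation. -/
def fourTermBase : Fin 7 → ℝ := ![3 / 10, 3 / 10, 1 / 10, 1 / 10, 6 / 10, 4 / 10, 8 / 10]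

theorem fourTermDefect_eq_zero_of_near {x : Fin 7 → ℂ} (hx : IsGeneric x)
    (h : ∀ i, |(x i).re - fourTermBase i| < 1 / 200) : fourTermDefect x = 0 := by
  have h0 := abs_lt.mp (h 0)
  have h1 := abs_lt.mp (h 1)
  have h2 := abs_lt.mp (h 2)
  have h3 := abs_lt.mp (h 3)
  have h4 := abs_lt.mp (h 4)
  have h5 := abs_lt.mp (h 5)
  have h6 := abs_lt.mp (h 6)
  simp [fourTermBase] at h0 h1 h2 h3 h4 h5 h6
  have hS : ∀ i, Sn (x i) ≠ 0 := fun i => Sn_ne_zero (hx.ne_int i)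
  have hD : ∀ i j, i ≠ j → Sn (x i - x j) ≠ 0 := fun i j hij =>
    Sn_ne_zero (hx.sub_ne_int i j hij)
  have r0 : ∀ z : ℂ, Sn (1 - z - 0) = Sn z := fun z => by rw [sub_zero, Sn_one_sub]
  have r1 : ∀ z : ℂ, Sn (0 - (1 - z)) = -Sn z := fun z => by rw [zero_sub, Sn_neg, Sn_one_sub]
  have r2 : ∀ z w : ℂ, Sn (1 - z - (1 - w)) = Sn (w - z) := fun z w => by congr 1; ring
  have hef : Sn (x 5 - x 4) = -Sn (x 4 - x 5) := by rw [← Sn_neg, neg_sub]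
  have key := Fstar_four_term_of_re (x₁ := 0) (x₂ := 1 - x 4) (x₃ := 1 - x 5) (y₁ := 1 - x 1)
    (y₂ := 1 - x 2) (y₃ := 1 - x 3) (a := x 0) (g := x 6) (by simp; linarith) (by simp; linarith)
    (by simp; linarith) (by simp; linarith) (by simp; linarith) (by simp; linarith)
    (by simp; linarith) (by simp; linarith) (isSeparated_of_re (by simp; linarith)
    (by simp; linarith)) (isSeparated_of_re (by simp; linarith) (by simp; linarith))
    (isSeparated_of_re (by simp; linarith) (by simp; linarith)) (hD _ _ (by decide))
    (by rw [r0]; exact hS _) (by rw [r2]; exact hD _ _ (by decide))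
    (by rw [r2]; exact hD _ _ (by decide)) (by rw [r0]; exact hS _)
    (by rw [r2]; exact hD _ _ (by decide)) (by rw [r2]; exact hD _ _ (by decide))
    (by rw [r0]; exact hS _) (by rw [r2]; exact hD _ _ (by decide))
    (by rw [r2]; exact hD _ _ (by decide)) (by rw [r1]; exact neg_ne_zero.mpr (hS _))
    (by rw [r1]; exact neg_ne_zero.mpr (hS _)) (by rw [r2]; exact hD _ _ (by decide))
  have f1 : ∀ z w : ℂ, 1 + (1 - z) - (1 - w) = 1 + w - z := fun z w => by ring
  have f2 : ∀ z : ℂ, 1 + (1 - z) - 0 = 2 - z := fun z => by ring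
  have f3 : ∀ z w : ℂ, 1 - z + w = 1 + w - z := fun z w => by ring
  simp only [r0, r1, r2, f1, f2, f3, add_zero, sub_sub_cancel, zero_add, hef] at key
  rw [Fstar_rotate_abcd (1 + x 0 - x 6), Fstar_swap_bc (1 + x 0 - x 4),
    Fstar_rotate_bcd (1 + x 0 - x 5)] at key
  have n4 := hS 4
  have n5 := hS 5
  have n45 := hD 4 5 (by decide)
  field_simp at key
  rw [fourTermDefect]
  linear_combination -key

theorem analyticAt_fourTermDefect {y : ℂ → Fin 7 → ℂ} (hy : ∀ i, Differentiable ℂ fun t => y t i)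
    (hs : ∀ t, y t 4 + y t 5 + y t 6 = y t 0 + y t 1 + y t 2 + y t 3 + 1) {t : ℂ}
    (ht : IsGeneric (y t)) : AnalyticAt ℂ (fun t => fourTermDefect (y t)) t := by
  have s0 : ∀ i, ∀ m : ℕ, y t i ≠ -m := fun i => ne_neg_nat_of_ne_int (ht.ne_int i)
  have s1 : ∀ i j, i ≠ j → ∀ m : ℕ, 1 + y t i - y t j ≠ -m := fun i j hij =>
    ne_neg_nat_of_ne_int (ht.add_sub_ne_int i j hij 1 (by push_cast; ring))
  have hS : ∀ i, AnalyticAt ℂ (fun t => Sn (y t i)) t := fun i =>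
    (differentiable_Sn.comp (hy i)).analyticAt t
  have hD : ∀ i j, AnalyticAt ℂ (fun t => Sn (y t i - y t j)) t := fun i j =>
    (differentiable_Sn.comp ((hy i).sub (hy j))).analyticAt t
  have hd1 : ∀ i j, Differentiable ℂ fun t => 1 + y t i - y t j := fun i j =>
    ((hy i).const_add 1).sub (hy j)
  have hd2 : ∀ i, Differentiable ℂ fun t => 2 - y t i := fun i => (hy i).const_sub 2
  have F0 := analyticAt_Fstar (hy 0) (hy 1) (hy 2) (hy 3) (hy 4) (hy 5) (hy 6) hs (s0 0) (s0 1)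
    (s0 2) (s0 3)
  have Fe := analyticAt_Fstar (hd1 0 4) (hd1 1 4) (hd1 2 4) (hd1 3 4) (hd2 4) (hd1 5 4) (hd1 6 4)
    (fun t => by linear_combination hs t) (s1 0 4 (by decide)) (s1 1 4 (by decide))
    (s1 2 4 (by decide)) (s1 3 4 (by decide))
  have Ff := analyticAt_Fstar (hd1 0 5) (hd1 1 5) (hd1 2 5) (hd1 3 5) (hd2 5) (hd1 4 5) (hd1 6 5)
    (fun t => by linear_combination hs t) (s1 0 5 (by decide)) (s1 1 5 (by decide))
    (s1 2 5 (by decide)) (s1 3 5 (by decide))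
  have Ga := analyticAt_Fstar (hy 0) (hd1 0 4) (hd1 0 5) (hd1 0 6) (hd1 0 1) (hd1 0 2) (hd1 0 3)
    (fun t => by linear_combination hs t) (s0 0) (s1 0 4 (by decide)) (s1 0 5 (by decide))
    (s1 0 6 (by decide))
  exact (((((hD 4 5).mul (((hS 1).mul (hS 2)).mul (hS 3))).mul F0).sub
    (((hS 5).mul (((hD 4 1).mul (hD 4 2)).mul (hD 4 3))).mul Fe)).add
    (((hS 4).mul (((hD 5 1).mul (hD 5 2)).mul (hD 5 3))).mul Ff)).sub
    (((((hS 4).mul (hS 5)).mul (hD 4 5)).mul (hD 6 0)).mul Ga)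

/-- The four-term relation between Saalschützian series. -/
theorem fourTermDefect_eq_zero {x : Fin 7 → ℂ}
    (hs : x 4 + x 5 + x 6 = x 0 + x 1 + x 2 + x 3 + 1) (hx : IsGeneric x) :
    fourTermDefect x = 0 :=
  eq_zero_of_forall_near (r := fourTermBase) (ε := 1 / 200) (by norm_num)
    (by simp [fourTermBase]; norm_num) fourTermDefect
    (fun _ hy hys _ ht => analyticAt_fourTermDefect hy hys ht)
    (fun _ _ hx h => fourTermDefect_eq_zero_of_near hx h) hs hx

theorem Sn_eq_exp (z : ℂ) :
    Sn z = (Complex.exp (Real.pi * I * z) - (Complex.exp (Real.pi * I * z))⁻¹) * (-I / 2) := by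
  rw [Sn, Complex.sin, ← Complex.exp_neg, show -((Real.pi : ℂ) * z) * I = -(Real.pi * I * z) by ring,
    show (Real.pi : ℂ) * z * I = Real.pi * I * z by ring]
  ring

theorem Sn_four_term_sum {a b c d e f g : ℂ} (hs : e + f + g = a + b + c + d + 1) :
    Sn (e - f) * (Sn b * Sn c * Sn d) - Sn f * (Sn (e - b) * Sn (e - c) * Sn (e - d)) +
      Sn e * (Sn (f - b) * Sn (f - c) * Sn (f - d)) + Sn e * Sn f * Sn (e - f) * Sn (g - a) = 0 := by
  have hg : Sn (g - a) = Sn (e + f - b - c - d) := by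
    rw [show g - a = 1 - (e + f - b - c - d) by linear_combination hs, Sn_one_sub]
  rw [hg]
  simp only [Sn_eq_exp, mul_add, mul_sub, Complex.exp_add, Complex.exp_sub]
  have hb := Complex.exp_ne_zero (Real.pi * I * b)
  have hc := Complex.exp_ne_zero (Real.pi * I * c)
  have hd := Complex.exp_ne_zero (Real.pi * I * d)
  have he := Complex.exp_ne_zero (Real.pi * I * e)
  have hf := Complex.exp_ne_zero (Real.pi * I * f)
  set B := Complex.exp (Real.pi * I * b)
  set C := Complex.exp (Real.pi * I * c)
  set D := Complex.exp (Real.pi * I * d)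
  set E := Complex.exp (Real.pi * I * e)
  set F := Complex.exp (Real.pi * I * f)
  field_simp
  ring

theorem Sn_dual_sum {a b c d e f g : ℂ} (hs : e + f + g = a + b + c + d + 1) :
    Sn a * (Sn (e - b) * Sn (e - c) * Sn (e - d) + Sn (f - a) * Sn e * Sn (g - e)) -
      Sn (e - a) * (Sn b * Sn c * Sn d + Sn (g - a) * Sn f * Sn e) +
      Sn e * (Sn (b - a) * Sn (c - a) * Sn (d - a) + Sn (e - 2 * a) * Sn (f - a) * Sn (g - a)) =
      0 := by
  have hg : Sn (g - a) = Sn (e + f - b - c - d) := by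
    rw [show g - a = 1 - (e + f - b - c - d) by linear_combination hs, Sn_one_sub]
  have hge : Sn (g - e) = Sn (2 * e + f - a - b - c - d) := by
    rw [show g - e = 1 - (2 * e + f - a - b - c - d) by linear_combination hs, Sn_one_sub]
  rw [hg, hge]
  simp only [Sn_eq_exp, two_mul, mul_add, mul_sub, Complex.exp_add, Complex.exp_sub]
  have ha := Complex.exp_ne_zero (Real.pi * I * a)
  have hb := Complex.exp_ne_zero (Real.pi * I * b)
  have hc := Complex.exp_ne_zero (Real.pi * I * c)
  have hd := Complex.exp_ne_zero (Real.pi * I * d)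
  have he := Complex.exp_ne_zero (Real.pi * I * e)
  have hf := Complex.exp_ne_zero (Real.pi * I * f)
  set A := Complex.exp (Real.pi * I * a)
  set B := Complex.exp (Real.pi * I * b)
  set C := Complex.exp (Real.pi * I * c)
  set D := Complex.exp (Real.pi * I * d)
  set E := Complex.exp (Real.pi * I * e)
  set F := Complex.exp (Real.pi * I * f)
  field_simp
  ring

theorem IsGeneric.reindex {x x' : Fin 7 → ℂ} (hx : IsGeneric x)
    {σ : Option (Fin 7) → Option (Fin 7)} (hσ : Function.Injective σ) {ε t : ℂ}
    (hε : ε = 1 ∨ ε = -1) (k : Option (Fin 7) → ℤ)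
    (h : ∀ p, p.elim 0 x' = t + ε * (σ p).elim 0 x + k p) : IsGeneric x' := by
  have key : ∀ p q : Option (Fin 7), p ≠ q → ∀ n : ℤ, p.elim 0 x - q.elim 0 x ≠ n := by
    rintro (_ | i) (_ | j) hpq n
    · exact absurd rfl hpq
    · intro h
      refine hx.ne_int j (-n) ?_
      push_cast
      rw [← h]
      simp
    · simpa using hx.ne_int i n
    · exact hx.sub_ne_int i j (fun h => hpq (by rw [h])) n
  have key' : ∀ p q : Option (Fin 7), p ≠ q → ∀ n : ℤ, p.elim 0 x' - q.elim 0 x' ≠ n := by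
    intro p q hpq n hn
    rw [h, h] at hn
    rcases hε with rfl | rfl
    · refine key _ _ (hσ.ne hpq) (n - k p + k q) ?_
      push_cast
      linear_combination hn
    · refine key _ _ (hσ.ne hpq.symm) (n - k p + k q) ?_
      push_cast
      linear_combination hn
  exact ⟨fun i n => by simpa using key' (some i) none (by simp) n,
    fun i j hij n => key' (some i) (some j) (by simpa using hij) n⟩

theorem IsGeneric.dual {a b c d e f g : ℂ} (hx : IsGeneric ![a, b, c, d, e, f, g]) :
    IsGeneric ![e - a, e - b, e - c, e - d, e, 1 + e - g, 1 + e - f] := by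
  refine hx.reindex (σ := fun p => p.elim (some 4)
    ![some 0, some 1, some 2, some 3, none, some 6, some 5]) (by decide) (Or.inr rfl) (t := e)
    (fun p => p.elim 0 ![0, 0, 0, 0, 0, 1, 1]) ?_
  rintro (_ | i)
  · simp
  · fin_cases i <;> simp <;> ring

theorem IsGeneric.shift {a b c d e f g : ℂ} (hx : IsGeneric ![a, b, c, d, e, f, g]) :
    IsGeneric ![1 + a - e, 1 + b - e, 1 + c - e, 1 + d - e, 2 - e, 1 + f - e, 1 + g - e] := by
  refine hx.reindex (σ := fun p => p.elim (some 4)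
    ![some 0, some 1, some 2, some 3, none, some 5, some 6]) (by decide) (Or.inl rfl) (t := -e)
    (fun p => p.elim 0 ![1, 1, 1, 1, 2, 1, 1]) ?_
  rintro (_ | i)
  · simp
  · fin_cases i <;> simp <;> ring

theorem Lf_swap_fg (a b c d e f g : ℂ) : Lf a b c d e f g = Lf a b c d e g f := by
  rw [Lf, Lf, Fstar_swap_fg, Fstar_swap_fg (1 + a - e)]

theorem Kf_swap_fg (a b c d e f g : ℂ) : Kf a b c d e f g = Kf a b c d e g f := by
  rw [Kf, Kf, Fstar_swap_fg, Fstar_swap_cd a (1 + a - e), mul_right_comm _ (Gamma (1 + a - f))]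

theorem Lf_shift_dual {a b c d e f g : ℂ} (hs : e + f + g = a + b + c + d + 1)
    (hx : IsGeneric ![a, b, c, d, e, f, g]) :
    Lf (1 + a - e) (1 + b - e) (1 + c - e) (1 + d - e) (1 + f - e) (2 - e) (1 + g - e) =
      Lf (1 - a) (1 - b) (1 - c) (1 - d) (2 - g) (2 - e) (2 - f) := by
  rw [Lf_dual (by linear_combination hs) hx.shift]
  congr 1 <;> ring

theorem Fstar_sub_eq {a b c d e f g : ℂ} (he : Sn e ≠ 0) (ha : Gamma a ≠ 0) (hb : Gamma b ≠ 0)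
    (hc : Gamma c ≠ 0) (hd : Gamma d ≠ 0) (ha' : Gamma (1 + a - e) ≠ 0)
    (hb' : Gamma (1 + b - e) ≠ 0) (hc' : Gamma (1 + c - e) ≠ 0) (hd' : Gamma (1 + d - e) ≠ 0) :
    Fstar a b c d e f g - Fstar (1 + a - e) (1 + b - e) (1 + c - e) (1 + d - e) (2 - e)
        (1 + f - e) (1 + g - e) =
      Lf a b c d e f g * (Sn e * Gamma a * Gamma b * Gamma c * Gamma d * Gamma (1 + a - e) *
        Gamma (1 + b - e) * Gamma (1 + c - e) * Gamma (1 + d - e)) := by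
  rw [Lf, div_mul_cancel₀]
  positivity

theorem Fstar_add_eq {a b c d e f g : ℂ} (hs : e + f + g = a + b + c + d + 1)
    (hx : IsGeneric ![a, b, c, d, e, f, g]) :
    Sn e * Sn f * Sn (e - f) * Sn (g - a) * (Fstar a b c d e f g +
        Fstar a (1 + a - e) (1 + a - f) (1 + a - g) (1 + a - b) (1 + a - c) (1 + a - d)) =
      Sn (e - f) * (Sn b * Sn c * Sn d + Sn e * Sn f * Sn (g - a)) *
        (Fstar a b c d e f g - Fstar (1 + a - f) (1 + b - f) (1 + c - f) (1 + d - f) (2 - f)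
          (1 + e - f) (1 + g - f)) -
      Sn f * (Sn (e - b) * Sn (e - c) * Sn (e - d)) *
        (Fstar (1 + a - e) (1 + b - e) (1 + c - e) (1 + d - e) (2 - e) (1 + f - e) (1 + g - e) -
          Fstar (1 + a - f) (1 + b - f) (1 + c - f) (1 + d - f) (2 - f) (1 + e - f)
            (1 + g - f)) := by
  have h : Sn (e - f) * (Sn b * Sn c * Sn d) * Fstar a b c d e f g -
    Sn f * (Sn (e - b) * Sn (e - c) * Sn (e - d)) *
      Fstar (1 + a - e) (1 + b - e) (1 + c - e) (1 + d - e) (2 - e) (1 + f - e) (1 + g - e) +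
    Sn e * (Sn (f - b) * Sn (f - c) * Sn (f - d)) *
      Fstar (1 + a - f) (1 + b - f) (1 + c - f) (1 + d - f) (2 - f) (1 + e - f) (1 + g - f) -
    Sn e * Sn f * Sn (e - f) * Sn (g - a) *
      Fstar a (1 + a - e) (1 + a - f) (1 + a - g) (1 + a - b) (1 + a - c) (1 + a - d) = 0 :=
    fourTermDefect_eq_zero (x := ![a, b, c, d, e, f, g]) hs hx
  linear_combination -h + Fstar (1 + a - f) (1 + b - f) (1 + c - f) (1 + d - f) (2 - f) (1 + e - f)
    (1 + g - f) * Sn_four_term_sum hs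

theorem Gamma_eq_div {z w : ℂ} (h : Sn w ≠ 0) (hzw : z = 1 - w) :
    Gamma z = Real.pi / (Sn w * Gamma w) := by
  have h1 := Gamma_ne_zero_of_Sn_ne_zero h
  have h2 : Gamma z ≠ 0 := by
    rw [hzw]; exact Gamma_ne_zero_of_Sn_ne_zero (by rwa [Sn_one_sub])
  have hpi : (Real.pi : ℂ) ≠ 0 := by exact_mod_cast Real.pi_ne_zero
  have := Gamma_mul_Gamma_one_sub' w
  rw [← hzw] at this
  field_simp at this ⊢
  linear_combination -this

/-- `K` as a combination of two values of `L`. -/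
theorem Kf_eq_Lf {a b c d e f g : ℂ} (hs : e + f + g = a + b + c + d + 1)
    (hx : IsGeneric ![a, b, c, d, e, f, g]) :
    Af (1 - a) (e - a) (f - a) (g - a) * Af (1 + a - f) (1 + b - f) (1 + c - f) (1 + d - f) *
        Kf a b c d e f g =
      (Sn b * Sn c * Sn d + Sn e * Sn f * Sn (g - a)) * Sn (e - a) * Sn (f - a) /
        (Sn e * (Real.pi : ℂ) ^ 4) * Lf a b c d f e g -
      Sn (f - a) / Sn e * (Af a b c d * Af (e - a) (e - b) (e - c) (e - d)) *
        Lf (1 + a - e) (1 + b - e) (1 + c - e) (1 + d - e) (1 + f - e) (2 - e) (1 + g - e) := by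
  have hS : ∀ i, Sn (![a, b, c, d, e, f, g] i) ≠ 0 := fun i => Sn_ne_zero (hx.ne_int i)
  have hD : ∀ i j, i ≠ j → Sn (![a, b, c, d, e, f, g] i - ![a, b, c, d, e, f, g] j) ≠ 0 :=
    fun i j hij => Sn_ne_zero (hx.sub_ne_int i j hij)
  have hpi : (Real.pi : ℂ) ≠ 0 := by exact_mod_cast Real.pi_ne_zero
  have sa : Sn a ≠ 0 := hS 0
  have sb : Sn b ≠ 0 := hS 1
  have sc : Sn c ≠ 0 := hS 2
  have sd : Sn d ≠ 0 := hS 3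
  have se : Sn e ≠ 0 := hS 4
  have sf : Sn f ≠ 0 := hS 5
  have sea : Sn (e - a) ≠ 0 := hD 4 0 (by decide)
  have seb : Sn (e - b) ≠ 0 := hD 4 1 (by decide)
  have sec : Sn (e - c) ≠ 0 := hD 4 2 (by decide)
  have sed : Sn (e - d) ≠ 0 := hD 4 3 (by decide)
  have sfa : Sn (f - a) ≠ 0 := hD 5 0 (by decide)
  have sfb : Sn (f - b) ≠ 0 := hD 5 1 (by decide)
  have sfc : Sn (f - c) ≠ 0 := hD 5 2 (by decide)
  have sfd : Sn (f - d) ≠ 0 := hD 5 3 (by decide)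
  have sga : Sn (g - a) ≠ 0 := hD 6 0 (by decide)
  have sef : Sn (e - f) ≠ 0 := hD 4 5 (by decide)
  have ga := Gamma_ne_zero_of_Sn_ne_zero sa
  have gb := Gamma_ne_zero_of_Sn_ne_zero sb
  have gc := Gamma_ne_zero_of_Sn_ne_zero sc
  have gd := Gamma_ne_zero_of_Sn_ne_zero sd
  have gea := Gamma_ne_zero_of_Sn_ne_zero sea
  have geb := Gamma_ne_zero_of_Sn_ne_zero seb
  have gec := Gamma_ne_zero_of_Sn_ne_zero sec
  have ged := Gamma_ne_zero_of_Sn_ne_zero sed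
  have gfa := Gamma_ne_zero_of_Sn_ne_zero sfa
  have gfb := Gamma_ne_zero_of_Sn_ne_zero sfb
  have gfc := Gamma_ne_zero_of_Sn_ne_zero sfc
  have gfd := Gamma_ne_zero_of_Sn_ne_zero sfd
  have gga := Gamma_ne_zero_of_Sn_ne_zero sga
  have reflect : ∀ {z w : ℂ}, Sn (w - z) ≠ 0 →
      Gamma (1 + z - w) = Real.pi / (Sn (w - z) * Gamma (w - z)) := fun {z w} h =>
    Gamma_eq_div h (by ring)
  have hne : ∀ {z w : ℂ}, Sn (w - z) ≠ 0 → Gamma (1 + z - w) ≠ 0 := fun {z w} h =>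
    Gamma_ne_zero_of_Sn_ne_zero (by
      rwa [show 1 + z - w = 1 - (w - z) by ring, Sn_one_sub])
  have hfe : Sn (1 + f - e) = Sn (e - f) := by
    rw [show 1 + f - e = 1 - (e - f) by ring, Sn_one_sub]
  have e1 : ∀ z : ℂ, 1 + (1 + z - e) - (1 + f - e) = 1 + z - f := fun z => by ring
  have h0 := Fstar_sub_eq (f := e) (g := g) sf ga gb gc gd (hne sfa) (hne sfb) (hne sfc) (hne sfd)
  have h1 := Fstar_sub_eq (a := 1 + a - e) (b := 1 + b - e) (c := 1 + c - e) (d := 1 + d - e)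
    (e := 1 + f - e) (f := 2 - e) (g := 1 + g - e) (by rwa [hfe]) (hne sea) (hne seb) (hne sec)
    (hne sed) (by rw [e1]; exact hne sfa) (by rw [e1]; exact hne sfb) (by rw [e1]; exact hne sfc)
    (by rw [e1]; exact hne sfd)
  rw [show 1 + (2 - e) - (1 + f - e) = 2 - f by ring, show 2 - (1 + f - e) = 1 + e - f by ring,
    e1, e1, e1, e1, e1, hfe, Fstar_swap_ef (1 + a - e), Fstar_swap_ef (1 + a - f)] at h1
  rw [Fstar_swap_ef a b c d f] at h0
  have key := Fstar_add_eq hs hx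
  rw [h0, h1, reflect sea, reflect seb, reflect sec, reflect sed] at key
  rw [Kf, eq_div_of_mul_eq (by positivity) ((mul_comm _ _).trans key), reflect sea, reflect sga]
  have rfa : Gamma (f - a) = Real.pi / (Sn (f - a) * Gamma (1 + a - f)) := by
    rw [reflect sfa]
    field_simp
  simp only [Af]
  rw [rfa, Gamma_eq_div sa rfl]
  have ga' := hne sfa
  have gb' := hne sfb
  have gc' := hne sfc
  have gd' := hne sfd
  clear h0 h1 key hne reflect hS hD hx
  generalize Lf a b c d f e g = X
  generalize Lf (1 + a - e) (1 + b - e) (1 + c - e) (1 + d - e) (1 + f - e) (2 - e) (1 + g - e) = Y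
  field_simp

end

theorem orbit5_LKK_relation (a b c d e f g : ℂ)
    (hsaal : e + f + g = a + b + c + d + 1)
    (hint : ∀ i : Fin 7, ∀ n : ℤ, ![a, b, c, d, e, f, g] i ≠ (n : ℂ))
    (hdiff : ∀ i j : Fin 7, i ≠ j → ∀ n : ℤ,
      ![a, b, c, d, e, f, g] i - ![a, b, c, d, e, f, g] j ≠ (n : ℂ)) :
    Af (1 - a) (e - a) (f - a) (g - a) * Af (1 + a - f) (1 + b - f) (1 + c - f) (1 + d - f) *
        B4 (e - a) (e - b) (e - c) (e - d) (1 + e - f) e (1 + e - g) * Kf a b c d e f g -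
      Af (g - a) (g - b) (g - c) (g - d) * Af a (1 + a - e) (1 + a - f) (1 + a - g) *
        B4 a b c d g f e * Kf (e - a) (e - b) (e - c) (e - d) e (1 + e - f) (1 + e - g) -
      Af a b c d * Af (e - a) (e - b) (e - c) (e - d) * B2 a b c d e f g *
        Lf (1 - a) (1 - b) (1 - c) (1 - d) (2 - g) (2 - f) (2 - e) = 0 := by
  have hx : IsGeneric ![a, b, c, d, e, f, g] := ⟨hint, hdiff⟩
  have se : Sn e ≠ 0 := Sn_ne_zero (hint 4)
  have hpi : (Real.pi : ℂ) ≠ 0 := by exact_mod_cast Real.pi_ne_zero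
  have hK := Kf_eq_Lf hsaal hx
  have hK' := Kf_eq_Lf (by linear_combination -hsaal) hx.dual
  have i1 : ∀ z w : ℂ, 1 + (z - w) - z = 1 - w := fun z w => by ring
  have i2 : ∀ z w v : ℂ, 1 + (z - w) - (1 + z - v) = v - w := fun z w v => by ring
  have i3 : ∀ z w v : ℂ, 1 + z - v - (z - w) = 1 + w - v := fun z w v => by ring
  have i4 : ∀ z w : ℂ, 1 - (z - w) = 1 + w - z := fun z w => by ring
  have i5 : ∀ z w : ℂ, 1 + (1 + z - w) - z = 2 - w := fun z w => by ring
  have s1 : ∀ z w : ℂ, Sn (1 + z - w) = Sn (w - z) := fun z w => by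
    rw [← Sn_one_sub]
    congr 1
    ring
  simp only [i1, i2, i3, i4, i5, sub_sub_cancel, s1] at hK'
  rw [← Lf_dual hsaal hx, Kf_swap_fg, Lf_swap_fg (1 - a)] at hK'
  rw [Lf_shift_dual hsaal hx, Lf_swap_fg (1 - a)] at hK
  have hB : B4 (e - a) (e - b) (e - c) (e - d) (1 + e - f) e (1 + e - g) =
      Sn a * Sn (g - a) * (Sn (e - b) * Sn (e - c) * Sn (e - d) + Sn (f - a) * Sn e * Sn (g - e)) /
        (Real.pi : ℂ) ^ 4 := by
    simp only [B4, i3, sub_sub_cancel, s1]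
  have hT := Sn_dual_sum hsaal
  have hYX : ∀ X W Y : ℂ,
      B4 (e - a) (e - b) (e - c) (e - d) (1 + e - f) e (1 + e - g) *
        ((Sn b * Sn c * Sn d + Sn e * Sn f * Sn (g - a)) * Sn (e - a) * Sn (f - a) /
          (Sn e * (Real.pi : ℂ) ^ 4) * X - Sn (f - a) / Sn e * W * Y) -
      B4 a b c d g f e *
        ((Sn (e - b) * Sn (e - c) * Sn (e - d) + Sn e * Sn (g - e) * Sn (f - a)) * Sn a *
          Sn (g - a) / (Sn e * (Real.pi : ℂ) ^ 4) * X - Sn (g - a) / Sn e * W * Y) -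
      W * B2 a b c d e f g * Y = 0 := by
    intro X W Y
    rw [hB, B4, B2]
    generalize Sn (e - 2 * a) = T at hT ⊢
    field_simp
    linear_combination (-Y * W * Sn (f - a) * Sn (g - a) * (Real.pi : ℂ) ^ 4) * hT
  have hA : Af (1 + a - e) a (1 + a - g) (1 + a - f) =
      Af a (1 + a - e) (1 + a - f) (1 + a - g) := by
    simp only [Af]
    ring
  rw [hA, mul_comm (Af (e - a) _ _ _)] at hK'
  linear_combination B4 (e - a) (e - b) (e - c) (e - d) (1 + e - f) e (1 + e - g) * hK -
    B4 a b c d g f e * hK' + hYX (Lf a b c d f e g)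
      (Af a b c d * Af (e - a) (e - b) (e - c) (e - d))
      (Lf (1 - a) (1 - b) (1 - c) (1 - d) (2 - g) (2 - f) (2 - e))
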